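/- Let g := J(A_1^{E8}, A_2^{E8}, A_3^{E8}, A_4^{E8}, A_5^{E8}, B_2^{E8}, B_3^{E8}, B_4^{E8}, B_6^{E8}) / Φ_{E8}. Then g is a modular form of weight 172 on SL₂(ℤ); for every W(E_8)-invariant weak Jacobi form φ_m of weight k and index m associated to E_8 there exists a unique polynomial P over M_*(SL₂(ℤ)) in nine variables such that g^{m−1}·φ_m = P(A_1^{E8},…,A_5^{E8},B_2^{E8},…,B_6^{E8}); and, setting Â_i := A_i^{E8}/g^i and B̂_j := B_j^{E8}/g^j, one has J^{w,W(E_8)}_{*,E_8,*} ⊊ M_*(SL₂(ℤ))[Â_1,…,Â_5,B̂_2,…,B̂_6] (the containment is strict). -/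

import Mathlib

open Complex Matrix

noncomputable section

/-- The ℂ-bilinear pairing on `ℂ^l` induced by an integral Gram matrix `M`. -/
def pairC {l : ℕ} (M : Matrix (Fin l) (Fin l) ℤ) (v w : Fin l → ℂ) : ℂ :=
  ∑ i, ∑ j, v i * (M i j : ℂ) * w j

/-- The ℚ-bilinear pairing on `ℚ^l` induced by an integral Gram matrix `M`. -/
def pairQ {l : ℕ} (M : Matrix (Fin l) (Fin l) ℤ) (v w : Fin l → ℚ) : ℚ :=
  ∑ i, ∑ j, v i * (M i j : ℚ) * w j

def zc {l : ℕ} (x : Fin l → ℤ) : Fin l → ℂ := fun i => (x i : ℂ)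
def qc {l : ℕ} (x : Fin l → ℚ) : Fin l → ℂ := fun i => (x i : ℂ)

/-- `M` is the Gram matrix of an even positive definite lattice. -/
structure IsEvenPosDef {l : ℕ} (M : Matrix (Fin l) (Fin l) ℤ) : Prop where
  symm : M.IsSymm
  even_diag : ∀ i, Even (M i i)
  posDef : (M.map (Int.cast : ℤ → ℝ)).PosDef

/-- `G` is a subgroup of the integral orthogonal group `O(L)` of the lattice with
Gram matrix `M`. -/
structure IsOrthSubgroup {l : ℕ} (M : Matrix (Fin l) (Fin l) ℤ)
    (G : Set (Matrix (Fin l) (Fin l) ℤ)) : Prop where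
  one_mem : 1 ∈ G
  mul_mem : ∀ σ₁ ∈ G, ∀ σ₂ ∈ G, σ₁ * σ₂ ∈ G
  inv_mem : ∀ σ ∈ G, ∃ σ' ∈ G, σ * σ' = 1 ∧ σ' * σ = 1
  isometry : ∀ σ ∈ G, σᵀ * M * σ = M

/-- `ℓ ∈ L^*`, the dual lattice. -/
def InDual {l : ℕ} (M : Matrix (Fin l) (Fin l) ℤ) (ℓ : Fin l → ℚ) : Prop :=
  ∀ x : Fin l → ℤ, ∃ n : ℤ, pairQ M ℓ (fun i => (x i : ℚ)) = n

/-- `c` is a family of Fourier coefficients, supported on `n ≥ 0` and `ℓ ∈ L^*`,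
whose associated Fourier series converges to `φ` on `ℍ × (L ⊗ ℂ)`. -/
def FourierRep {l : ℕ} (M : Matrix (Fin l) (Fin l) ℤ) (φ : ℂ → (Fin l → ℂ) → ℂ)
    (c : ℕ → (Fin l → ℚ) → ℂ) : Prop :=
  (∀ n ℓ, c n ℓ ≠ 0 → InDual M ℓ) ∧
  ∀ τ : ℂ, 0 < τ.im → ∀ z : Fin l → ℂ,
    HasSum (fun p : ℕ × (Fin l → ℚ) =>
      c p.1 p.2 * Complex.exp (2 * (Real.pi : ℂ) * Complex.I *
        ((p.1 : ℂ) * τ + pairC M (qc p.2) z))) (φ τ z)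

/-- `φ` is a weak Jacobi form of weight `k` and index `t` associated to the even
positive definite lattice with Gram matrix `M`. -/
def IsWeakJacobiForm {l : ℕ} (M : Matrix (Fin l) (Fin l) ℤ) (k : ℤ) (t : ℕ)
    (φ : ℂ → (Fin l → ℂ) → ℂ) : Prop :=
  (DifferentiableOn ℂ (fun p : ℂ × (Fin l → ℂ) => φ p.1 p.2)
    ({τ : ℂ | 0 < τ.im} ×ˢ (Set.univ : Set (Fin l → ℂ)))) ∧
  (∀ a b c d : ℤ, a * d - b * c = 1 → ∀ τ : ℂ, 0 < τ.im → ∀ z : Fin l → ℂ,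
    φ (((a : ℂ) * τ + (b : ℂ)) / ((c : ℂ) * τ + (d : ℂ)))
        (fun i => z i / ((c : ℂ) * τ + (d : ℂ))) =
      ((c : ℂ) * τ + (d : ℂ)) ^ k *
        Complex.exp ((t : ℂ) * (Real.pi : ℂ) * Complex.I * (c : ℂ) *
          pairC M z z / ((c : ℂ) * τ + (d : ℂ))) * φ τ z) ∧
  (∀ x y : Fin l → ℤ, ∀ τ : ℂ, 0 < τ.im → ∀ z : Fin l → ℂ,
    φ τ (fun i => z i + (x i : ℂ) * τ + (y i : ℂ)) =
      Complex.exp (-(t : ℂ) * (Real.pi : ℂ) * Complex.I *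
        (pairC M (zc x) (zc x) * τ + 2 * pairC M (zc x) z)) * φ τ z) ∧
  (∃ c : ℕ → (Fin l → ℚ) → ℂ, FourierRep M φ c)

/-- `φ` is invariant under the action of `G` on the lattice variable. -/
def GInvariant {l : ℕ} (G : Set (Matrix (Fin l) (Fin l) ℤ))
    (φ : ℂ → (Fin l → ℂ) → ℂ) : Prop :=
  ∀ σ ∈ G, ∀ τ : ℂ, 0 < τ.im → ∀ z : Fin l → ℂ,
    φ τ ((σ.map (Int.cast : ℤ → ℂ)).mulVec z) = φ τ z

/-- The partial derivative of `φ(τ, 𝔷)` in the `i`-th coordinate of the lattice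
variable `𝔷`. -/
def pderiv' {l : ℕ} (i : Fin l) (φ : ℂ → (Fin l → ℂ) → ℂ) (τ : ℂ) (z : Fin l → ℂ) : ℂ :=
  deriv (fun w : ℂ => φ τ (Function.update z i w)) (z i)

/-- The Jacobian `J(φ_1, ..., φ_{l+1})` of `l+1` Jacobi forms of indices `m j`:
the determinant of the matrix whose first row is `(m_j φ_j)_j` and whose later
rows are the partial derivatives `∂φ_j/∂z_i`. -/
def jacJacobian {l : ℕ} (m : Fin (l + 1) → ℕ) (φ : Fin (l + 1) → ℂ → (Fin l → ℂ) → ℂ)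
    (τ : ℂ) (z : Fin l → ℂ) : ℂ :=
  Matrix.det (Matrix.of fun i j : Fin (l + 1) =>
    Fin.cases ((m j : ℂ) * φ j τ z) (fun i' : Fin l => pderiv' i' (φ j) τ z) i)

/-- `f` is a (holomorphic) modular form of weight `k` on `SL₂(ℤ)`, viewed as a
holomorphic function on the upper half-plane with a Fourier expansion supported
on `n ≥ 0`. -/
def IsModularForm (k : ℤ) (f : ℂ → ℂ) : Prop :=
  DifferentiableOn ℂ f {τ : ℂ | 0 < τ.im} ∧
  (∀ a b c d : ℤ, a * d - b * c = 1 → ∀ τ : ℂ, 0 < τ.im →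
    f (((a : ℂ) * τ + (b : ℂ)) / ((c : ℂ) * τ + (d : ℂ))) =
      ((c : ℂ) * τ + (d : ℂ)) ^ k * f τ) ∧
  ∃ cf : ℕ → ℂ, ∀ τ : ℂ, 0 < τ.im →
    HasSum (fun n : ℕ => cf n * Complex.exp (2 * (Real.pi : ℂ) * Complex.I * (n : ℂ) * τ))
      (f τ)

/-- `φ` is not identically zero on `ℍ × (L ⊗ ℂ)`. -/
def NotIdenticallyZero {l : ℕ} (φ : ℂ → (Fin l → ℂ) → ℂ) : Prop :=
  ∃ τ z, 0 < τ.im ∧ φ τ z ≠ 0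

/-- `r` is a primitive lattice vector. -/
def PrimitiveVec {l : ℕ} (r : Fin l → ℤ) : Prop :=
  r ≠ 0 ∧ ∀ (n : ℤ) (s : Fin l → ℤ), r = n • s → IsUnit n

/-- The reflection `σ_r : v ↦ v - ⟨r^∨, v⟩ r` belongs to `G`. -/
def ReflectionIn {l : ℕ} (M : Matrix (Fin l) (Fin l) ℤ)
    (G : Set (Matrix (Fin l) (Fin l) ℤ)) (r : Fin l → ℤ) : Prop :=
  ∃ S ∈ G, ∀ v : Fin l → ℂ,
    (S.map (Int.cast : ℤ → ℂ)).mulVec v =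
      fun i => v i - 2 * pairC M (zc r) v / pairC M (zc r) (zc r) * (r i : ℂ)

/-- `(τ, z)` belongs to `D_r(τ)`, i.e. `⟨r^∨, z⟩ ∈ ℤτ ⊕ ℤ`. -/
def OnMirror {l : ℕ} (M : Matrix (Fin l) (Fin l) ℤ) (r : Fin l → ℤ) (τ : ℂ)
    (z : Fin l → ℂ) : Prop :=
  ∃ a b : ℤ, 2 * pairC M (zc r) z / pairC M (zc r) (zc r) = (a : ℂ) * τ + (b : ℂ)

/-- `J` vanishes precisely, and with multiplicity one, on the sets `D_r(τ)` for
primitive `r ∈ L` whose reflection lies in `G`. -/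
def VanishesOrderOneOnMirrors {l : ℕ} (M : Matrix (Fin l) (Fin l) ℤ)
    (G : Set (Matrix (Fin l) (Fin l) ℤ)) (J : ℂ → (Fin l → ℂ) → ℂ) : Prop :=
  ∀ τ : ℂ, 0 < τ.im → ∀ z : Fin l → ℂ,
    ((J τ z = 0) ↔ ∃ r, PrimitiveVec r ∧ ReflectionIn M G r ∧ OnMirror M r τ z) ∧
    (∀ r, PrimitiveVec r → ReflectionIn M G r → OnMirror M r τ z →
      (∀ r', PrimitiveVec r' → ReflectionIn M G r' → OnMirror M r' τ z →
        r' = r ∨ r' = -r) →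
      deriv (fun w : ℂ => J τ (fun i => z i + w * (r i : ℂ))) 0 ≠ 0)

/-- The Fourier expansion of `φ` has a non-zero coefficient of type `f(0, ℓ)`. -/
def HasNonzeroQZeroTerm {l : ℕ} (M : Matrix (Fin l) (Fin l) ℤ)
    (φ : ℂ → (Fin l → ℂ) → ℂ) : Prop :=
  ∃ c : ℕ → (Fin l → ℚ) → ℂ, FourierRep M φ c ∧ ∃ ℓ, c 0 ℓ ≠ 0

/-- `ψ = P(φ_1, ..., φ_n)` where `P` is a polynomial with coefficients which are
modular forms on `SL₂(ℤ)`, graded so that each monomial has weight `k` and index `t`. -/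
def MPolyRep {l n : ℕ} (kj : Fin n → ℤ) (mj : Fin n → ℕ)
    (φ : Fin n → ℂ → (Fin l → ℂ) → ℂ) (k : ℤ) (t : ℕ)
    (c : (Fin n → ℕ) → ℂ → ℂ) (ψ : ℂ → (Fin l → ℂ) → ℂ) : Prop :=
  {d : Fin n → ℕ | c d ≠ 0}.Finite ∧
  (∀ d : Fin n → ℕ, c d ≠ 0 →
    (∑ j, d j * mj j) = t ∧ IsModularForm (k - ∑ j, (d j : ℤ) * kj j) (c d)) ∧
  (∀ τ : ℂ, 0 < τ.im → ∀ z : Fin l → ℂ,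
    ψ τ z = ∑ᶠ d : Fin n → ℕ, c d τ * ∏ j, (φ j τ z) ^ (d j))

/-- The forms `φ_1, ..., φ_n` are algebraically independent over the graded ring
`M_*(SL₂(ℤ))` of modular forms on `SL₂(ℤ)`. -/
def AlgIndepOverM {l n : ℕ} (φ : Fin n → ℂ → (Fin l → ℂ) → ℂ) : Prop :=
  ∀ c : (Fin n → ℕ) → ℂ → ℂ,
    {d : Fin n → ℕ | c d ≠ 0}.Finite →
    (∀ d, c d ≠ 0 → ∃ w : ℤ, IsModularForm w (c d)) →
    (∀ τ : ℂ, 0 < τ.im → ∀ z : Fin l → ℂ,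
      (∑ᶠ d : Fin n → ℕ, c d τ * ∏ j, (φ j τ z) ^ (d j)) = 0) →
    ∀ d τ, 0 < τ.im → c d τ = 0


/-- The Jacobi theta function
`ϑ(τ,z) = q^{1/8}(ζ^{1/2}-ζ^{-1/2}) ∏_{n≥1} (1-q^n ζ)(1-q^n ζ^{-1})(1-q^n)`. -/
def jtheta (τ z : ℂ) : ℂ :=
  Complex.exp ((Real.pi : ℂ) * Complex.I * τ / 4) *
    (Complex.exp ((Real.pi : ℂ) * Complex.I * z) -
      Complex.exp (-((Real.pi : ℂ) * Complex.I * z))) *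
    ∏' n : ℕ,
      ((1 - Complex.exp (2 * (Real.pi : ℂ) * Complex.I * ((n : ℂ) + 1) * τ) *
            Complex.exp (2 * (Real.pi : ℂ) * Complex.I * z)) *
       (1 - Complex.exp (2 * (Real.pi : ℂ) * Complex.I * ((n : ℂ) + 1) * τ) *
            Complex.exp (-(2 * (Real.pi : ℂ) * Complex.I * z))) *
       (1 - Complex.exp (2 * (Real.pi : ℂ) * Complex.I * ((n : ℂ) + 1) * τ)))

/-- The Dedekind eta function `η(τ) = q^{1/24} ∏_{n≥1} (1-q^n)`. -/
def dedekindEta (τ : ℂ) : ℂ :=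
  Complex.exp ((Real.pi : ℂ) * Complex.I * τ / 12) *
    ∏' n : ℕ, (1 - Complex.exp (2 * (Real.pi : ℂ) * Complex.I * ((n : ℂ) + 1) * τ))

/-- The Gram matrix of the root lattice `E_8` (in a basis of simple roots: a chain
of nodes 0–6 with node 7 attached to node 4). -/
def E8Gram : Matrix (Fin 8) (Fin 8) ℤ :=
  !![2,-1,0,0,0,0,0,0;
     -1,2,-1,0,0,0,0,0;
     0,-1,2,-1,0,0,0,0;
     0,0,-1,2,-1,0,0,0;
     0,0,0,-1,2,-1,0,-1;
     0,0,0,0,-1,2,-1,0;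
     0,0,0,0,0,-1,2,0;
     0,0,0,0,-1,0,0,2]

/-- The integral bilinear form of the `E_8` lattice. -/
def pairE8 (v w : Fin 8 → ℤ) : ℤ := ∑ i, ∑ j, v i * E8Gram i j * w j

/-- The Weyl group `W(E_8)`: the group of lattice automorphisms generated by the
reflections in the 240 roots of `E_8` (the vectors of norm 2), realized as a set of
integral matrices.  (Each reflection is an involution, so the closure as a monoid is
already a group.) -/
def weylE8 : Set (Matrix (Fin 8) (Fin 8) ℤ) :=
  (Submonoid.closure {S : Matrix (Fin 8) (Fin 8) ℤ |
    ∃ r : Fin 8 → ℤ, pairE8 r r = 2 ∧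
      ∀ v : Fin 8 → ℤ, S.mulVec v = fun i => v i - pairE8 r v * r i} :
    Submonoid (Matrix (Fin 8) (Fin 8) ℤ))

/-- The theta block `Φ_{E_8}(τ,𝔷) = ∏_{r > 0} ϑ(τ,(r,𝔷))/η(τ)^3`, the product ranging
over the 120 positive roots of `E_8` (the norm 2 vectors with non-negative coordinates
in the basis of simple roots). -/
def PhiE8 (τ : ℂ) (z : Fin 8 → ℂ) : ℂ :=
  ∏ᶠ (r : Fin 8 → ℤ) (_ : pairE8 r r = 2 ∧ ∀ i, 0 ≤ r i),
    (jtheta τ (pairC E8Gram (zc r) z) / dedekindEta τ ^ 3)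

/-- The weights of Sakai's forms `A₁,...,A₅,B₂,...,B₆`. -/
def sakaiWt : Fin 9 → ℤ := ![4, 4, 4, 4, 4, 6, 6, 6, 6]

/-- The indices of Sakai's forms `A₁,...,A₅,B₂,...,B₆`. -/
def sakaiIdx : Fin 9 → ℕ := ![1, 2, 3, 4, 5, 2, 3, 4, 6]

section ModA
set_option linter.unusedVariables false
set_option linter.unusedSimpArgs false
namespace E8J

section HolBasic
variable {E : Type*} [NormedAddCommGroup E] [NormedSpace ℂ E]

/-- continuous and Gateaux holomorphic on an open set -/
def Hol (U : Set E) (f : E → ℂ) : Prop :=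
  ContinuousOn f U ∧ ∀ p ∈ U, ∀ v : E, DifferentiableAt ℂ (fun w : ℂ => f (p + w • v)) 0

/-- directional derivative -/
def dd (v : E) (f : E → ℂ) (p : E) : ℂ := deriv (fun w : ℂ => f (p + w • v)) 0

theorem lineCont (p v : E) : Continuous (fun w : ℂ => p + w • v) := by fun_prop

theorem Hol.line {U : Set E} {f : E → ℂ} (hf : Hol U f) (p v : E) (w : ℂ) (h : p + w • v ∈ U) :
    DifferentiableAt ℂ (fun w : ℂ => f (p + w • v)) w := by
  have := hf.2 _ h v
  have h2 : (fun w' : ℂ => f (p + w' • v)) = (fun s : ℂ => f (p + w • v + s • v)) ∘ (fun w' => w' - w) := by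
    funext w'
    simp only [Function.comp]
    congr 1
    rw [add_assoc, ← add_smul]; congr 2; ring
  rw [h2]
  apply DifferentiableAt.comp
  · simpa using this
  · fun_prop

theorem Hol.deriv_line {f : E → ℂ} (p v : E) (w : ℂ) :
    deriv (fun w : ℂ => f (p + w • v)) w = dd v f (p + w • v) := by
  have h2 : (fun w' : ℂ => f (p + w' • v)) = (fun w' => (fun s : ℂ => f (p + w • v + s • v)) (w' - w)) := by
    funext w'
    congr 1
    rw [add_assoc, ← add_smul]; congr 2; ring
  rw [h2]
  have := deriv_comp_sub_const (f := (fun s : ℂ => f (p + w • v + s • v))) (a := w) (x := w)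
  rw [this]
  simp [dd]

theorem Hol.lineOn {U : Set E} {f : E → ℂ} (hf : Hol U f) (p v : E) :
    DifferentiableOn ℂ (fun w : ℂ => f (p + w • v)) {w | p + w • v ∈ U} := fun w hw =>
  (hf.line p v w hw).differentiableWithinAt

theorem Hol.hasDeriv {U : Set E} {f : E → ℂ} (hf : Hol U f) (p v : E) (hp : p ∈ U) :
    HasDerivAt (fun w : ℂ => f (p + w • v)) (dd v f p) 0 := (hf.2 p hp v).hasDerivAt

theorem Hol.hasDerivLine {U : Set E} {f : E → ℂ} (hf : Hol U f) (p v : E) (w : ℂ) (h : p + w • v ∈ U) :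
    HasDerivAt (fun w : ℂ => f (p + w • v)) (dd v f (p + w • v)) w := by
  rw [← Hol.deriv_line]; exact (hf.line p v w h).hasDerivAt

theorem holOfDiff {U : Set E} (hU : IsOpen U) {f : E → ℂ} (hf : DifferentiableOn ℂ f U) : Hol U f := by
  refine ⟨hf.continuousOn, fun p hp v => ?_⟩
  have h1 : DifferentiableAt ℂ f (p + (0:ℂ) • v) := by
    simpa using (hf p hp).differentiableAt (hU.mem_nhds hp)
  exact DifferentiableAt.comp (f := fun w : ℂ => p + w • v) (0:ℂ) h1 (by fun_prop)

theorem Hol.mono {U V : Set E} {f : E → ℂ} (hf : Hol U f) (h : V ⊆ U) : Hol V f :=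
  ⟨hf.1.mono h, fun p hp v => hf.2 p (h hp) v⟩

theorem Hol.add {U : Set E} {f g : E → ℂ} (hf : Hol U f) (hg : Hol U g) :
    Hol U (fun p => f p + g p) := ⟨hf.1.add hg.1, fun p hp v => (hf.2 p hp v).add (hg.2 p hp v)⟩
theorem Hol.sub {U : Set E} {f g : E → ℂ} (hf : Hol U f) (hg : Hol U g) :
    Hol U (fun p => f p - g p) := ⟨hf.1.sub hg.1, fun p hp v => (hf.2 p hp v).sub (hg.2 p hp v)⟩
theorem Hol.neg {U : Set E} {f : E → ℂ} (hf : Hol U f) :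
    Hol U (fun p => - f p) := ⟨hf.1.neg, fun p hp v => (hf.2 p hp v).neg⟩
theorem Hol.mul {U : Set E} {f g : E → ℂ} (hf : Hol U f) (hg : Hol U g) :
    Hol U (fun p => f p * g p) := ⟨hf.1.mul hg.1, fun p hp v => (hf.2 p hp v).mul (hg.2 p hp v)⟩
theorem Hol.const {U : Set E} (c : ℂ) : Hol U (fun _ => c) :=
  ⟨continuousOn_const, fun p hp v => differentiableAt_const c⟩
theorem Hol.pow {U : Set E} {f : E → ℂ} (hf : Hol U f) (n : ℕ) :
    Hol U (fun p => f p ^ n) := ⟨hf.1.pow n, fun p hp v => (hf.2 p hp v).pow n⟩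
theorem Hol.sum {U : Set E} {ι : Type*} (s : Finset ι) {f : ι → E → ℂ} (hf : ∀ i ∈ s, Hol U (f i)) :
    Hol U (fun p => ∑ i ∈ s, f i p) := by
  classical
  induction s using Finset.induction_on with
  | empty => simpa using Hol.const 0
  | insert a s ha ih =>
    simp only [Finset.sum_insert ha]
    exact (hf a (by simp)).add (ih fun i hi => hf i (by simp [hi]))
theorem Hol.prod {U : Set E} {ι : Type*} (s : Finset ι) {f : ι → E → ℂ} (hf : ∀ i ∈ s, Hol U (f i)) :
    Hol U (fun p => ∏ i ∈ s, f i p) := by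
  classical
  induction s using Finset.induction_on with
  | empty => simpa using Hol.const 1
  | insert a s ha ih =>
    simp only [Finset.prod_insert ha]
    exact (hf a (by simp)).mul (ih fun i hi => hf i (by simp [hi]))
theorem Hol.div {U : Set E} {f g : E → ℂ} (hf : Hol U f) (hg : Hol U g) (h0 : ∀ p ∈ U, g p ≠ 0) :
    Hol U (fun p => f p / g p) :=
  ⟨hf.1.div hg.1 h0, fun p hp v => (hf.2 p hp v).div (hg.2 p hp v) (by simpa using h0 p hp)⟩
theorem Hol.congr {U : Set E} (hU : IsOpen U) {f g : E → ℂ} (hf : Hol U f) (h : ∀ p ∈ U, g p = f p) :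
    Hol U g := by
  refine ⟨hf.1.congr h, fun p hp v => (hf.2 p hp v).congr_of_eventuallyEq ?_⟩
  have : ∀ᶠ w : ℂ in nhds 0, p + w • v ∈ U :=
    (lineCont p v).continuousAt.eventually (hU.mem_nhds (by simpa using hp))
  filter_upwards [this] with w hw using h _ hw
theorem holLocal {U : Set E} (hU : IsOpen U) {f : E → ℂ}
    (h : ∀ p ∈ U, ∃ V, IsOpen V ∧ p ∈ V ∧ Hol V f) : Hol U f := by
  refine ⟨fun p hp => ?_, fun p hp v => ?_⟩
  · obtain ⟨V, hV, hpV, hh⟩ := h p hp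
    exact (hh.1.continuousAt (hV.mem_nhds hpV)).continuousWithinAt
  · obtain ⟨V, hV, hpV, hh⟩ := h p hp
    exact hh.2 p hpV v

/-- composition with a Hol-compatible affine map -/
theorem Hol.compAffine {E' : Type*} [NormedAddCommGroup E'] [NormedSpace ℂ E'] {U : Set E} {V : Set E'}
    {f : E → ℂ} (hf : Hol U f)
    (A : E' →L[ℂ] E) (b : E) (h : ∀ p ∈ V, A p + b ∈ U) : Hol V (fun p => f (A p + b)) := by
  refine ⟨hf.1.comp (by fun_prop) h, fun p hp v => ?_⟩
  have := hf.2 _ (h p hp) (A v)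
  convert this using 3 with w
  simp; abel

/-- outer composition with one-variable holomorphic functions -/
theorem Hol.compOuter {U : Set E} {f : E → ℂ} (hf : Hol U f) {h : ℂ → ℂ} {W : Set ℂ} (hW : IsOpen W)
    (hh : DifferentiableOn ℂ h W) (hm : ∀ p ∈ U, f p ∈ W) : Hol U (fun p => h (f p)) := by
  refine ⟨hh.continuousOn.comp hf.1 hm, fun p hp v => ?_⟩
  have h1 : DifferentiableAt ℂ h (f (p + (0:ℂ) • v)) := by
    simpa using (hh _ (hm p hp)).differentiableAt (hW.mem_nhds (hm p hp))
  exact DifferentiableAt.comp (f := fun w : ℂ => f (p + w • v)) (0:ℂ) h1 (hf.2 p hp v)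

theorem Hol.cexp {U : Set E} {f : E → ℂ} (hf : Hol U f) : Hol U (fun p => Complex.exp (f p)) :=
  hf.compOuter isOpen_univ Complex.differentiable_exp.differentiableOn (fun _ _ => trivial)

theorem contParam {U V : Set E} {G : E → ℂ} (hG : ContinuousOn G U) {γ c : ℝ → ℂ}
    (hγ : Continuous γ) (hc : Continuous c) (v : E) (hV : ∀ p ∈ V, ∀ t, p + γ t • v ∈ U) (a b : ℝ) :
    ContinuousOn (fun p => ∫ t in a..b, c t * G (p + γ t • v)) V := by
  rw [continuousOn_iff_continuous_domRestrict]
  apply intervalIntegral.continuous_parametric_intervalIntegral_of_continuous'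
  have : Continuous (fun x : V × ℝ => G (x.1.1 + γ x.2 • v)) :=
    hG.comp_continuous (by fun_prop) (fun x => hV _ x.1.2 _)
  exact (hc.comp continuous_snd).mul this

theorem cauchyDD {U : Set E} (hU : IsOpen U) {f : E → ℂ} (hf : Hol U f) (p v : E) {r : ℝ} (hr : 0 < r)
    (h : ∀ w : ℂ, ‖w‖ ≤ r → p + w • v ∈ U) :
    dd v f p = (2 * Real.pi * I)⁻¹ * ∮ w in C(0, r), (w ^ 2)⁻¹ * f (p + w • v) := by
  have h1 := two_pi_I_inv_smul_circleIntegral_sub_sq_inv_smul_of_differentiable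
    (U := {w : ℂ | p + w • v ∈ U}) (hU.preimage (lineCont p v)) (c := 0) (w₀ := 0) (R := r)
    (f := fun w : ℂ => f (p + w • v)) (fun w hw => h w (by simpa using hw)) (hf.lineOn p v) (by simpa using hr)
  simp only [sub_zero, smul_eq_mul] at h1
  rw [dd, ← h1]

theorem tubeExists {U : Set E} (hU : IsOpen U) {K : Set ℂ} (hK : IsCompact K) (p0 v : E)
    (h : ∀ w ∈ K, p0 + w • v ∈ U) : ∃ V, IsOpen V ∧ p0 ∈ V ∧ ∀ p ∈ V, ∀ w ∈ K, p + w • v ∈ U := by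
  have hn : IsOpen ((fun x : E × ℂ => x.1 + x.2 • v) ⁻¹' U) := hU.preimage (by fun_prop)
  obtain ⟨V, W, hV, hW, h1, h2, h3⟩ := generalized_tube_lemma (isCompact_singleton (x := p0)) hK hn
    (by rintro ⟨a, b⟩ ⟨ha, hb⟩; simp at ha; subst ha; exact h b hb)
  exact ⟨V, hV, h1 rfl, fun p hp w hw => @h3 (p, w) ⟨hp, h2 hw⟩⟩

theorem tubeSmall {U : Set E} (hU : IsOpen U) (p0 v : E) (h : p0 ∈ U) :
    ∃ r : ℝ, 0 < r ∧ ∃ V, IsOpen V ∧ p0 ∈ V ∧ ∀ p ∈ V, ∀ w : ℂ, ‖w‖ ≤ r → p + w • v ∈ U := by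
  have : ∀ᶠ w : ℂ in nhds 0, p0 + w • v ∈ U :=
    (lineCont p0 v).continuousAt.eventually (hU.mem_nhds (by simpa using h))
  obtain ⟨r, hr, h1⟩ := Metric.eventually_nhds_iff_ball.1 this
  obtain ⟨V, hV, h2, h3⟩ := tubeExists hU (isCompact_closedBall (0:ℂ) (r/2)) p0 v (fun w hw => h1 w (by
    simp at hw ⊢; linarith))
  exact ⟨r/2, by positivity, V, hV, h2, fun p hp w hw => h3 p hp w (by simpa using hw)⟩

theorem circleAsInterval (n : ℤ) (r : ℝ) (v p : E) (f : E → ℂ) :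
    (∮ w in C(0, r), w ^ n * f (p + w • v)) =
      ∫ t in (0:ℝ)..2 * Real.pi, (deriv (circleMap 0 r) t * (circleMap 0 r t) ^ n) * f (p + circleMap 0 r t • v) := by
  simp only [circleIntegral, smul_eq_mul]
  congr 1; funext t; ring

theorem circleCoefCont (n : ℤ) {r : ℝ} (hr : 0 < r) :
    Continuous (fun t => deriv (circleMap 0 r) t * (circleMap 0 r t) ^ n) := by
  simp only [deriv_circleMap]
  refine Continuous.mul (by fun_prop) ?_
  refine Continuous.zpow₀ (by fun_prop) n (fun t => Or.inl ?_)
  simp [circleMap, hr.ne']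

theorem contCircle {U V : Set E} {G : E → ℂ} (hG : ContinuousOn G U) (n : ℤ) {r : ℝ} (hr : 0 < r) (v : E)
    (hV : ∀ p ∈ V, ∀ w : ℂ, ‖w‖ = r → p + w • v ∈ U) :
    ContinuousOn (fun p => ∮ w in C(0, r), w ^ n * G (p + w • v)) V := by
  simp only [circleAsInterval]
  exact contParam hG (by fun_prop) (circleCoefCont n hr) v (fun p hp t => hV p hp _ (by simp [hr.le, abs_of_pos hr])) _ _

theorem Hol.contDD {U : Set E} (hU : IsOpen U) {f : E → ℂ} (hf : Hol U f) (v : E) : ContinuousOn (dd v f) U := by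
  intro p hp
  obtain ⟨r, hr, V, hV, hpV, h⟩ := tubeSmall hU p v hp
  have h1 : ContinuousOn (dd v f) V := by
    have := (contCircle hf.1 (-2) hr v (V := V) (fun p hp w hw => h p hp w hw.le))
    refine (this.const_mul ((2 * Real.pi * I)⁻¹)).congr (fun q hq => ?_)
    simp only [cauchyDD hU hf q v hr (h q hq)]
    rfl
  exact (h1.continuousAt (hV.mem_nhds hpV)).continuousWithinAt

theorem holParam {U V : Set E} (hU : IsOpen U) (hVo : IsOpen V) {G : E → ℂ} (hG : Hol U G) {γ c : ℝ → ℂ}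
    (hγ : Continuous γ) (hc : Continuous c) (v : E) (hV : ∀ p ∈ V, ∀ t, p + γ t • v ∈ U) (a b : ℝ) :
    Hol V (fun p => ∫ t in a..b, c t * G (p + γ t • v)) := by
  refine ⟨contParam hG.1 hγ hc v hV a b, fun p hp u => ?_⟩
  have : ∀ᶠ w : ℂ in nhds 0, p + w • u ∈ V :=
    (lineCont p u).continuousAt.eventually (hVo.mem_nhds (by simpa using hp))
  obtain ⟨r, hr, h1⟩ := Metric.nhds_basis_closedBall.eventually_iff.1 this
  have hmem : ∀ x ∈ Metric.closedBall (0:ℂ) r, ∀ t : ℝ, p + x • u + γ t • v ∈ U := fun x hx t => hV _ (h1 hx) t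
  have hcontF : ∀ x ∈ Metric.closedBall (0:ℂ) r, Continuous (fun t => c t * G (p + x • u + γ t • v)) := fun x hx =>
    hc.mul (hG.1.comp_continuous (by fun_prop) (hmem x hx))
  have hcontF' : ContinuousOn (fun y : ℂ × ℝ => c y.2 * dd u G (p + y.1 • u + γ y.2 • v))
      (Metric.closedBall (0:ℂ) r ×ˢ Set.uIcc a b) := by
    refine ContinuousOn.mul (by fun_prop) ?_
    exact (hG.contDD hU u).comp (by fun_prop) (fun y hy => hmem _ hy.1 _)
  obtain ⟨C, hC⟩ := ((isCompact_closedBall (0:ℂ) r).prod isCompact_uIcc).exists_bound_of_continuousOn hcontF'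
  have h0 : (0:ℂ) ∈ Metric.closedBall (0:ℂ) r := by simp [hr.le]
  have key := intervalIntegral.hasDerivAt_integral_of_dominated_loc_of_deriv_le (μ := MeasureTheory.volume)
    (a := a) (b := b) (F := fun x t => c t * G (p + x • u + γ t • v))
    (F' := fun x t => c t * dd u G (p + x • u + γ t • v)) (x₀ := (0:ℂ)) (s := Metric.closedBall 0 r)
    (bound := fun _ => C) (Metric.closedBall_mem_nhds _ hr)
    (by
      filter_upwards [Metric.closedBall_mem_nhds (0:ℂ) hr] with x hx
      exact (hcontF x hx).aestronglyMeasurable)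
    ((hcontF 0 h0).intervalIntegrable _ _)
    (by
      refine Continuous.aestronglyMeasurable (hc.mul ?_)
      exact (hG.contDD hU u).comp_continuous (by fun_prop) (hmem _ h0))
    (Filter.Eventually.of_forall fun t ht x hx => hC (x, t) ⟨hx, Set.uIoc_subset_uIcc ht⟩)
    (by simp)
    (Filter.Eventually.of_forall fun t ht x hx => by
      have := hG.hasDerivLine (p + γ t • v) u x (by convert hmem x hx t using 1; abel)
      have e : ∀ y : ℂ, p + y • u + γ t • v = p + γ t • v + y • u := fun y => by abel
      simp only [e]
      exact this.const_mul (c t))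
  exact key.2.differentiableAt

theorem holCircle {U V : Set E} (hU : IsOpen U) (hVo : IsOpen V) {G : E → ℂ} (hG : Hol U G)
    (n : ℤ) {r : ℝ} (hr : 0 < r) (v : E)
    (hV : ∀ p ∈ V, ∀ w : ℂ, ‖w‖ = r → p + w • v ∈ U) :
    Hol V (fun p => ∮ w in C(0, r), w ^ n * G (p + w • v)) := by
  simp only [circleAsInterval]
  exact holParam hU hVo hG (by fun_prop) (circleCoefCont n hr) v
    (fun p hp t => hV p hp _ (by simp [hr.le, abs_of_pos hr])) _ _

theorem Hol.dd {U : Set E} (hU : IsOpen U) {f : E → ℂ} (hf : Hol U f) (v : E) : Hol U (dd v f) := by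
  refine holLocal hU fun p hp => ?_
  obtain ⟨r, hr, V, hV, hpV, h⟩ := tubeSmall hU p v hp
  refine ⟨V, hV, hpV, ?_⟩
  refine Hol.congr hV ((Hol.const ((2 * Real.pi * I)⁻¹)).mul
    (holCircle hU hV hf (-2) hr v (fun p hp w hw => h p hp w hw.le))) fun q hq => ?_
  rw [cauchyDD hU hf q v hr (h q hq)]
  rfl
end HolBasic
end E8J
end ModA

section ModB
set_option linter.unusedVariables false
set_option linter.unusedSimpArgs false
namespace E8J

section HolTwo
variable {E : Type*} [NormedAddCommGroup E] [NormedSpace ℂ E]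

theorem dd_smul (f : E → ℂ) (p v : E) (c : ℂ) : dd (c • v) f p = c * dd v f p := by
  by_cases hc : c = 0
  · subst hc; simp [dd]
  · have h2 : (fun w : ℂ => f (p + w • c • v)) = (fun w => (fun s : ℂ => f (p + s • v)) (c * w)) := by
      funext w; simp [smul_smul, mul_comm]
    rw [dd, h2]
    have := deriv_comp_mul_left c (fun s : ℂ => f (p + s • v)) (0:ℂ)
    rw [this]; simp [dd]

theorem Hol.dd_add {U : Set E} (hU : IsOpen U) {f : E → ℂ} (hf : Hol U f) (u v : E) {p : E} (hp : p ∈ U) :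
    E8J.dd (u + v) f p = E8J.dd u f p + E8J.dd v f p := by
  have h1 := (hf.hasDeriv p u hp)
  have h2 := (hf.hasDeriv p (u+v) hp)
  suffices h3 : HasDerivAt (fun w : ℂ => f (p + w • (u + v)) - f (p + w • u)) (E8J.dd v f p) 0 by
    have h4 := h3.add h1
    have h5 : HasDerivAt (fun w : ℂ => f (p + w • (u + v))) (E8J.dd v f p + E8J.dd u f p) 0 := by
      refine h4.congr_of_eventuallyEq (Filter.Eventually.of_forall fun w => ?_)
      simp
    rw [h2.unique h5, add_comm]
  rw [hasDerivAt_iff_isLittleO_nhds_zero, Asymptotics.isLittleO_iff]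
  intro ε hε
  have hcont : ContinuousAt (E8J.dd v f) p := (hf.contDD hU v).continuousAt (hU.mem_nhds hp)
  obtain ⟨δ, hδ, hb⟩ := Metric.nhds_basis_ball.eventually_iff.1
    ((hcont.eventually (Metric.closedBall_mem_nhds _ hε)).and (hU.mem_nhds hp))
  have hpos : 0 < ‖u‖ + ‖v‖ + 1 := by positivity
  filter_upwards [Metric.ball_mem_nhds (0:ℂ) (div_pos hδ hpos)] with w hw
  have hw' : ‖w‖ * (‖u‖ + ‖v‖ + 1) < δ := by
    rw [← lt_div_iff₀ hpos]; simpa using hw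
  have hin : ∀ s ∈ Metric.closedBall (0:ℂ) ‖w‖, p + w • u + s • v ∈ Metric.ball p δ := by
    intro s hs
    have hs' : ‖s‖ ≤ ‖w‖ := by simpa using hs
    rw [mem_ball_iff_norm]
    have : p + w • u + s • v - p = w • u + s • v := by abel
    rw [this]
    calc ‖w • u + s • v‖ ≤ ‖w‖ * ‖u‖ + ‖s‖ * ‖v‖ := by
          refine (norm_add_le _ _).trans ?_
          rw [norm_smul, norm_smul]
      _ ≤ ‖w‖ * ‖u‖ + ‖w‖ * ‖v‖ := by gcongr
      _ ≤ ‖w‖ * (‖u‖ + ‖v‖ + 1) := by nlinarith [norm_nonneg w]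
      _ < δ := hw'
  have key := (convex_closedBall (0:ℂ) ‖w‖).norm_image_sub_le_of_norm_hasDerivWithin_le
    (f := fun s : ℂ => f (p + w • u + s • v) - s * E8J.dd v f p)
    (f' := fun s => E8J.dd v f (p + w • u + s • v) - 1 * E8J.dd v f p) (C := ε) (x := 0) (y := w)
    (fun s hs => ((hf.hasDerivLine _ v s (hb (hin s hs)).2).sub ((hasDerivAt_id s).mul_const _)).hasDerivWithinAt)
    (fun s hs => by
      have := (hb (hin s hs)).1
      rw [dist_eq_norm] at this
      simpa using this) (by simp) (by simp)
  simp only [zero_smul, add_zero, zero_mul, sub_zero] at key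
  convert key using 2
  simp only [zero_add, zero_smul, add_zero, smul_add, smul_eq_mul, add_assoc, sub_self]
  ring

theorem eqZeroOfOpen {U : Set E} (hU : IsOpen U) (hc : Convex ℝ U) {f : E → ℂ} (hf : Hol U f) {q : E} (hq : q ∈ U)
    (h0 : ∀ᶠ x in nhds q, f x = 0) : ∀ p ∈ U, f p = 0 := by
  intro p hp
  have ho : IsOpen {w : ℂ | q + w • (p - q) ∈ U} := hU.preimage (lineCont q (p - q))
  have h1 := (hf.lineOn q (p - q)).analyticOnNhd ho
  have hcv : Convex ℝ {w : ℂ | q + w • (p - q) ∈ U} := by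
    intro x hx y hy a b ha hb hab
    have := hc hx hy ha hb hab
    simp only [Set.mem_ofPred_eq] at *
    convert this using 1
    have : q = (a + b) • q := by rw [hab, one_smul]
    rw [add_smul] at this
    rw [smul_add, smul_add, add_smul, smul_assoc, smul_assoc]
    nth_rewrite 1 [this]
    abel
  have h2 := h1.eqOn_zero_of_preconnected_of_eventuallyEq_zero hcv.isPreconnected (z₀ := 0) (by simpa using hq)
    (by
      have h3 : Filter.Tendsto (fun w : ℂ => q + w • (p - q)) (nhds 0) (nhds q) := by
        have := (lineCont q (p - q)).tendsto 0
        simpa using this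
      exact h3.eventually h0)
  have := h2 (x := 1) (by simpa using hp)
  simpa using this

theorem noZeroDiv {U : Set E} (hU : IsOpen U) (hc : Convex ℝ U) {f h : E → ℂ} (hf : Hol U f) (hh : Hol U h)
    (h0 : ∀ p ∈ U, f p * h p = 0) {q : E} (hq : q ∈ U) (hq0 : f q ≠ 0) : ∀ p ∈ U, h p = 0 := by
  refine eqZeroOfOpen hU hc hh hq ?_
  have h1 : ∀ᶠ x in nhds q, f x ≠ 0 := (hf.1.continuousAt (hU.mem_nhds hq)).eventually_ne hq0
  filter_upwards [h1, hU.mem_nhds hq] with x hx hxU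
  exact (mul_eq_zero.1 (h0 x hxU)).resolve_left hx

theorem commonNonzero {U : Set E} (hU : IsOpen U) (hc : Convex ℝ U) {ι : Type*} (s : Finset ι) {f : ι → E → ℂ}
    (hf : ∀ i ∈ s, Hol U (f i)) (hn : U.Nonempty) (h : ∀ i ∈ s, ∃ p ∈ U, f i p ≠ 0) :
    ∃ p ∈ U, ∀ i ∈ s, f i p ≠ 0 := by
  classical
  induction s using Finset.induction_on with
  | empty => obtain ⟨p, hp⟩ := hn; exact ⟨p, hp, by simp⟩
  | insert a s ha ih =>
    obtain ⟨p, hp, hps⟩ := ih (fun i hi => hf i (by simp [hi])) (fun i hi => h i (by simp [hi]))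
    by_contra hcon
    push Not at hcon
    obtain ⟨q, hq, hqa⟩ := h a (by simp)
    have := noZeroDiv hU hc (hf a (by simp)) (Hol.prod s (fun i hi => hf i (by simp [hi]))) (by
      intro x hx
      obtain ⟨i, hi, hi0⟩ := hcon x hx
      rcases Finset.mem_insert.1 hi with rfl | hi
      · simp [hi0]
      · rw [Finset.prod_eq_zero hi hi0, mul_zero]) hq hqa p hp
    rw [Finset.prod_eq_zero_iff] at this
    obtain ⟨i, hi, hi0⟩ := this
    exact hps i hi hi0
end HolTwo
end E8J
end ModB

section ModC
set_option linter.unusedVariables false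
set_option linter.unusedSimpArgs false
namespace E8J

abbrev V8 := Fin 8 → ℂ
abbrev Fn := ℂ → V8 → ℂ
def unc (f : Fn) : ℂ × V8 → ℂ := fun p => f p.1 p.2
def D : Set (ℂ × V8) := {p | 0 < p.1.im}
theorem D_open : IsOpen D := isOpen_lt continuous_const (by fun_prop)
theorem D_convex : Convex ℝ D := by
  have : D = (LinearMap.fst ℝ ℂ V8) ⁻¹' {c : ℂ | 0 < c.im} := rfl
  rw [this]
  exact (convex_halfSpace_im_gt 0).linear_preimage _
theorem memD {τ : ℂ} {z : V8} : (τ, z) ∈ D ↔ 0 < τ.im := Iff.rfl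
theorem D_nonempty : D.Nonempty := ⟨(I, 0), by simp [D]⟩
theorem H_open : IsOpen {τ : ℂ | 0 < τ.im} := isOpen_lt continuous_const (by fun_prop)

def Iinf : Filter ℂ := Filter.comap Complex.im Filter.atTop
theorem Iinf_basis : Iinf.HasBasis (fun _ : ℝ => True) (fun Y => {τ | Y ≤ τ.im}) :=
  Filter.atTop_basis.comap _
instance : Iinf.NeBot := by
  rw [Iinf_basis.neBot_iff]
  intro Y _
  exact ⟨Y * I, by simp⟩
theorem Iinf_pos : ∀ᶠ τ in Iinf, 0 < τ.im :=
  Iinf_basis.eventually_iff.2 ⟨1, trivial, fun τ hτ => lt_of_lt_of_le one_pos hτ⟩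

def Bd (f : Fn) : Prop := ∀ z0 : V8, (unc f) =O[Iinf ×ˢ nhds z0] (fun _ => (1:ℝ))

theorem Bd_iff {f : Fn} : Bd f ↔ ∀ z0 : V8, ∃ C Y ε : ℝ, 0 < Y ∧ 0 < ε ∧ ∀ τ : ℂ, Y ≤ τ.im → ∀ z : V8,
    ‖z - z0‖ < ε → ‖f τ z‖ ≤ C := by
  refine forall_congr' fun z0 => ?_
  rw [Asymptotics.isBigO_iff]
  constructor
  · rintro ⟨C, hC⟩
    obtain ⟨⟨Y, ε⟩, ⟨_, hε⟩, h⟩ := (Iinf_basis.prod Metric.nhds_basis_ball).eventually_iff.1 hC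
    refine ⟨C, max Y 1, ε, by positivity, hε, fun τ hτ z hz => ?_⟩
    have := @h (τ, z) ⟨(le_max_left _ _).trans hτ, by rwa [mem_ball_iff_norm]⟩
    simpa [unc] using this
  · rintro ⟨C, Y, ε, hY, hε, h⟩
    refine ⟨C, (Iinf_basis.prod Metric.nhds_basis_ball).eventually_iff.2 ⟨⟨Y, ε⟩, ⟨trivial, hε⟩, ?_⟩⟩
    rintro ⟨τ, z⟩ ⟨h1, h2⟩
    have := h τ h1 z (by rwa [← mem_ball_iff_norm])
    simpa [unc] using this

theorem Bd.add {f g : Fn} (hf : Bd f) (hg : Bd g) : Bd (fun τ z => f τ z + g τ z) := fun z0 =>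
  (hf z0).add (hg z0)
theorem Bd.sub {f g : Fn} (hf : Bd f) (hg : Bd g) : Bd (fun τ z => f τ z - g τ z) := fun z0 =>
  (hf z0).sub (hg z0)
theorem Bd.mul {f g : Fn} (hf : Bd f) (hg : Bd g) : Bd (fun τ z => f τ z * g τ z) := fun z0 => by
  have := (hf z0).mul (hg z0)
  simp only [mul_one] at this
  exact this
theorem Bd.const (c : ℂ) : Bd (fun _ _ => c) := fun z0 => Asymptotics.isBigO_const_const _ one_ne_zero _
theorem Bd.pow {f : Fn} (hf : Bd f) (n : ℕ) : Bd (fun τ z => f τ z ^ n) := fun z0 => by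
  have := (hf z0).pow n
  simp only [one_pow] at this
  exact this
theorem Bd.sum {ι : Type*} (s : Finset ι) {f : ι → Fn} (hf : ∀ i ∈ s, Bd (f i)) :
    Bd (fun τ z => ∑ i ∈ s, f i τ z) := by
  classical
  induction s using Finset.induction_on with
  | empty => simpa using Bd.const 0
  | insert a s ha ih =>
    simp only [Finset.sum_insert ha]
    exact (hf a (by simp)).add (ih fun i hi => hf i (by simp [hi]))
theorem Bd.prod {ι : Type*} (s : Finset ι) {f : ι → Fn} (hf : ∀ i ∈ s, Bd (f i)) :
    Bd (fun τ z => ∏ i ∈ s, f i τ z) := by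
  classical
  induction s using Finset.induction_on with
  | empty => simpa using Bd.const 1
  | insert a s ha ih =>
    simp only [Finset.prod_insert ha]
    exact (hf a (by simp)).mul (ih fun i hi => hf i (by simp [hi]))

/-- derivative in the lattice variable -/
def zdd (v : V8) (f : Fn) : Fn := fun τ z => deriv (fun w : ℂ => f τ (z + w • v)) 0
theorem unc_zdd (v : V8) (f : Fn) : unc (zdd v f) = dd ((0:ℂ), v) (unc f) := by
  funext p
  simp [unc, zdd, dd]
theorem pderiv_eq (i : Fin 8) (f : Fn) : pderiv' i f = zdd (Pi.single i 1) f := by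
  funext τ z
  unfold pderiv' zdd
  have h : (fun w : ℂ => f τ (Function.update z i w)) =
      fun w => (fun s : ℂ => f τ (z + s • (Pi.single i 1 : V8))) (w - z i) := by
    funext w
    congr 1
    funext j
    by_cases hj : j = i
    · subst hj; simp
    · simp [hj]
  rw [h]
  have := deriv_comp_sub_const (f := (fun s : ℂ => f τ (z + s • (Pi.single i 1 : V8)))) (a := z i) (x := z i)
  rw [this]
  simp

def HolD (f : Fn) : Prop := Hol D (unc f)
theorem HolD.zdd {f : Fn} (hf : HolD f) (v : V8) : HolD (zdd v f) := by
  unfold HolD; rw [unc_zdd]; exact Hol.dd D_open hf _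
theorem HolD.congr {f g : Fn} (hf : HolD f) (h : ∀ τ, 0 < τ.im → ∀ z, g τ z = f τ z) : HolD g :=
  Hol.congr D_open hf fun p hp => h p.1 hp p.2
theorem Bd.congr {f g : Fn} (hf : Bd f) (h : ∀ τ, 0 < τ.im → ∀ z, g τ z = f τ z) : Bd g := fun z0 => by
  refine (hf z0).congr' ?_ Filter.EventuallyEq.rfl
  have := Filter.Eventually.prod_inl Iinf_pos (nhds z0)
  filter_upwards [this] with p hp
  exact (h p.1 hp p.2).symm

theorem HolD.zline {f : Fn} (hf : HolD f) {τ : ℂ} (hτ : 0 < τ.im) (z v : V8) :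
    Differentiable ℂ (fun w : ℂ => f τ (z + w • v)) := by
  intro w
  have := Hol.line (U := D) hf (τ, z) ((0:ℂ), v) w (by simpa [D] using hτ)
  simpa [unc] using this
theorem HolD.hasDeriv {f : Fn} (hf : HolD f) {τ : ℂ} (hτ : 0 < τ.im) (z v : V8) (w : ℂ) :
    HasDerivAt (fun w : ℂ => f τ (z + w • v)) (E8J.zdd v f τ (z + w • v)) w := by
  have := Hol.hasDerivLine (U := D) hf (τ, z) ((0:ℂ), v) w (by simpa [D] using hτ)
  rw [← unc_zdd] at this
  simpa [unc] using this
theorem HolD.hasDeriv0 {f : Fn} (hf : HolD f) {τ : ℂ} (hτ : 0 < τ.im) (z v : V8) :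
    HasDerivAt (fun w : ℂ => f τ (z + w • v)) (E8J.zdd v f τ z) 0 := by
  simpa using hf.hasDeriv hτ z v 0
theorem HolD.tau {f : Fn} (hf : HolD f) (z : V8) :
    DifferentiableOn ℂ (fun τ => f τ z) {τ : ℂ | 0 < τ.im} := by
  intro τ hτ
  have := Hol.line (U := D) hf (0, z) ((1:ℂ), 0) τ (by simpa [D] using hτ)
  exact DifferentiableAt.differentiableWithinAt (by simpa [unc] using this)

theorem Bd.zdd {f : Fn} (hf : Bd f) (h : HolD f) (v : V8) : Bd (zdd v f) := by
  rw [Bd_iff] at *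
  intro z0
  obtain ⟨C, Y, ε, hY, hε, hb⟩ := hf z0
  have hpos : 0 < ‖v‖ + 1 := by positivity
  refine ⟨C / (ε / 2 / (‖v‖ + 1)), Y, ε / 2, hY, by positivity, fun τ hτ z hz => ?_⟩
  have hτ0 : 0 < τ.im := hY.trans_le hτ
  refine Complex.norm_deriv_le_of_forall_mem_sphere_norm_le (by positivity)
    (h.zline hτ0 z v).diffContOnCl fun w hw => hb τ hτ _ ?_
  have hw' : ‖w‖ = ε / 2 / (‖v‖ + 1) := by simpa using hw
  have : z + w • v - z0 = (z - z0) + w • v := by abel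
  rw [this]
  have h2 : ‖w • v‖ ≤ ε / 2 := by
    rw [norm_smul, hw', div_mul_eq_mul_div, div_le_iff₀ hpos]
    nlinarith [norm_nonneg v]
  linarith [norm_add_le (z - z0) (w • v)]

theorem zdd_smul (f : Fn) (v : V8) (c : ℂ) (τ : ℂ) (z : V8) : zdd (c • v) f τ z = c * zdd v f τ z := by
  have := dd_smul (unc f) (τ, z) ((0:ℂ), v) c
  simp only [← unc_zdd, Prod.smul_mk, smul_zero] at this
  exact this
theorem zdd_add {f : Fn} (hf : HolD f) (u v : V8) {τ : ℂ} (hτ : 0 < τ.im) (z : V8) :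
    zdd (u + v) f τ z = zdd u f τ z + zdd v f τ z := by
  have := Hol.dd_add D_open hf ((0:ℂ), u) ((0:ℂ), v) (p := (τ, z)) hτ
  simp only [← unc_zdd, Prod.mk_add_mk, add_zero] at this
  exact this
theorem zdd_lin {f : Fn} (hf : HolD f) (v : V8) {τ : ℂ} (hτ : 0 < τ.im) (z : V8) :
    zdd v f τ z = ∑ i, v i * zdd (Pi.single i 1) f τ z := by
  have key : ∀ s : Finset (Fin 8), zdd (∑ i ∈ s, v i • (Pi.single i 1 : V8)) f τ z =
      ∑ i ∈ s, v i * zdd (Pi.single i 1) f τ z := by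
    intro s
    induction s using Finset.induction_on with
    | empty => simp [zdd]
    | insert a s ha ih => rw [Finset.sum_insert ha, Finset.sum_insert ha, zdd_add hf _ _ hτ, ih, zdd_smul]
  have e : v = ∑ i, v i • (Pi.single i 1 : V8) := by
    funext j; simp [Finset.sum_apply, Pi.single_apply]
  conv_lhs => rw [e]
  exact key _

/-- modular forms with growth condition -/
structure MF (k : ℤ) (f : ℂ → ℂ) : Prop where
  diff : DifferentiableOn ℂ f {τ : ℂ | 0 < τ.im}
  law : ∀ a b c d : ℤ, a * d - b * c = 1 → ∀ τ : ℂ, 0 < τ.im →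
    f (((a : ℂ) * τ + (b : ℂ)) / ((c : ℂ) * τ + (d : ℂ))) = ((c : ℂ) * τ + (d : ℂ)) ^ k * f τ
  bd : f =O[Iinf] (fun _ => (1:ℝ))

structure JF (k : ℤ) (t : ℤ) (f : Fn) : Prop where
  hol : HolD f
  bd : Bd f
  mod : ∀ a b c d : ℤ, a * d - b * c = 1 → ∀ τ : ℂ, 0 < τ.im → ∀ z : V8,
    f (((a : ℂ) * τ + (b : ℂ)) / ((c : ℂ) * τ + (d : ℂ))) (fun i => z i / ((c : ℂ) * τ + (d : ℂ))) =
      ((c : ℂ) * τ + (d : ℂ)) ^ k *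
        Complex.exp ((t : ℂ) * (Real.pi : ℂ) * Complex.I * (c : ℂ) *
          pairC E8Gram z z / ((c : ℂ) * τ + (d : ℂ))) * f τ z
  ell : ∀ x y : Fin 8 → ℤ, ∀ τ : ℂ, 0 < τ.im → ∀ z : V8,
    f τ (fun i => z i + (x i : ℂ) * τ + (y i : ℂ)) =
      Complex.exp (-(t : ℂ) * (Real.pi : ℂ) * Complex.I *
        (pairC E8Gram (zc x) (zc x) * τ + 2 * pairC E8Gram (zc x) z)) * f τ z

theorem den_ne {c d : ℤ} {a b : ℤ} (h : a * d - b * c = 1) {τ : ℂ} (hτ : 0 < τ.im) : (c : ℂ) * τ + (d : ℂ) ≠ 0 := by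
  intro h0
  have him := congrArg Complex.im h0
  have hre := congrArg Complex.re h0
  simp at him hre
  rcases him with h1 | h1
  · subst h1; simp at hre; subst hre; simp at h
  · linarith
theorem im_mob {c d : ℤ} {a b : ℤ} (h : a * d - b * c = 1) {τ : ℂ} (hτ : 0 < τ.im) :
    0 < (((a : ℂ) * τ + (b : ℂ)) / ((c : ℂ) * τ + (d : ℂ))).im := by
  have hne := den_ne h hτ
  have hn : 0 < Complex.normSq ((c : ℂ) * τ + (d : ℂ)) := Complex.normSq_pos.2 hne
  have : (((a : ℂ) * τ + (b : ℂ)) / ((c : ℂ) * τ + (d : ℂ))).im = τ.im / Complex.normSq ((c : ℂ) * τ + (d : ℂ)) := by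
    rw [Complex.div_im]
    have hr : (a:ℝ) * d - b * c = 1 := by exact_mod_cast h
    simp
    field_simp
    linear_combination hr
  rw [this]; positivity

theorem MF.mul {k l : ℤ} {f g : ℂ → ℂ} (hf : MF k f) (hg : MF l g) : MF (k + l) (fun τ => f τ * g τ) := by
  refine ⟨hf.diff.mul hg.diff, fun a b c d h τ hτ => ?_, by simpa using hf.bd.mul hg.bd⟩
  rw [hf.law a b c d h τ hτ, hg.law a b c d h τ hτ, zpow_add₀ (den_ne h hτ)]; ring
theorem MF.add {k : ℤ} {f g : ℂ → ℂ} (hf : MF k f) (hg : MF k g) : MF k (fun τ => f τ + g τ) := by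
  refine ⟨hf.diff.add hg.diff, fun a b c d h τ hτ => ?_, hf.bd.add hg.bd⟩
  simp only [hf.law a b c d h τ hτ, hg.law a b c d h τ hτ]; ring
theorem MF.const (x : ℂ) : MF 0 (fun _ => x) :=
  ⟨differentiableOn_const _, fun a b c d h τ hτ => by simp, Asymptotics.isBigO_const_const _ one_ne_zero _⟩
theorem MF.zero (k : ℤ) : MF k (fun _ => 0) :=
  ⟨differentiableOn_const _, fun a b c d h τ hτ => by simp, Asymptotics.isBigO_const_const _ one_ne_zero _⟩
theorem MF.cmul {k : ℤ} {f : ℂ → ℂ} (x : ℂ) (hf : MF k f) : MF k (fun τ => x * f τ) := by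
  simpa using (MF.const x).mul hf
theorem MF.pow {k : ℤ} {f : ℂ → ℂ} (hf : MF k f) (n : ℕ) : MF (n * k) (fun τ => f τ ^ n) := by
  induction n with
  | zero => simpa using MF.const 1
  | succ n ih =>
    have := ih.mul hf
    simp only [pow_succ]
    convert this using 1
    push_cast; ring
theorem MF.congr {k : ℤ} {f g : ℂ → ℂ} (hf : MF k f) (h : ∀ τ, 0 < τ.im → g τ = f τ) : MF k g := by
  refine ⟨hf.diff.congr h, fun a b c d h' τ hτ => ?_, ?_⟩
  · rw [h _ (im_mob h' hτ), h _ hτ, hf.law a b c d h' τ hτ]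
  · refine hf.bd.congr' ?_ Filter.EventuallyEq.rfl
    filter_upwards [Iinf_pos] with τ hτ using (h τ hτ).symm

theorem JF.mul {k l t s : ℤ} {f g : Fn} (hf : JF k t f) (hg : JF l s g) :
    JF (k + l) (t + s) (fun τ z => f τ z * g τ z) := by
  refine ⟨Hol.mul hf.hol hg.hol, hf.bd.mul hg.bd, fun a b c d h τ hτ z => ?_, fun x y τ hτ z => ?_⟩
  · simp only [hf.mod a b c d h τ hτ z, hg.mod a b c d h τ hτ z, zpow_add₀ (den_ne h hτ)]
    push_cast
    rw [show ((t:ℂ) + s) * (Real.pi : ℂ) * Complex.I * (c : ℂ) * pairC E8Gram z z / ((c : ℂ) * τ + (d : ℂ)) =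
      (t : ℂ) * (Real.pi : ℂ) * Complex.I * (c : ℂ) * pairC E8Gram z z / ((c : ℂ) * τ + (d : ℂ)) +
      (s : ℂ) * (Real.pi : ℂ) * Complex.I * (c : ℂ) * pairC E8Gram z z / ((c : ℂ) * τ + (d : ℂ)) by ring, Complex.exp_add]
    ring
  · simp only [hf.ell x y τ hτ z, hg.ell x y τ hτ z]
    push_cast
    rw [show -((t:ℂ) + s) * (Real.pi : ℂ) * Complex.I *
        (pairC E8Gram (zc x) (zc x) * τ + 2 * pairC E8Gram (zc x) z) = -(t:ℂ) * (Real.pi : ℂ) * Complex.I *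
        (pairC E8Gram (zc x) (zc x) * τ + 2 * pairC E8Gram (zc x) z) + -(s:ℂ) * (Real.pi : ℂ) * Complex.I *
        (pairC E8Gram (zc x) (zc x) * τ + 2 * pairC E8Gram (zc x) z) by ring, Complex.exp_add]
    ring
theorem JF.add {k t : ℤ} {f g : Fn} (hf : JF k t f) (hg : JF k t g) :
    JF k t (fun τ z => f τ z + g τ z) := by
  refine ⟨Hol.add hf.hol hg.hol, hf.bd.add hg.bd, fun a b c d h τ hτ z => ?_, fun x y τ hτ z => ?_⟩
  · simp only [hf.mod a b c d h τ hτ z, hg.mod a b c d h τ hτ z]; ring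
  · simp only [hf.ell x y τ hτ z, hg.ell x y τ hτ z]; ring
theorem JF.sub {k t : ℤ} {f g : Fn} (hf : JF k t f) (hg : JF k t g) :
    JF k t (fun τ z => f τ z - g τ z) := by
  refine ⟨Hol.sub hf.hol hg.hol, hf.bd.sub hg.bd, fun a b c d h τ hτ z => ?_, fun x y τ hτ z => ?_⟩
  · simp only [hf.mod a b c d h τ hτ z, hg.mod a b c d h τ hτ z]; ring
  · simp only [hf.ell x y τ hτ z, hg.ell x y τ hτ z]; ring
theorem JF.congr {k t : ℤ} {f g : Fn} (hf : JF k t f) (h : ∀ τ, 0 < τ.im → ∀ z, g τ z = f τ z) : JF k t g := by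
  refine ⟨hf.hol.congr h, hf.bd.congr h, fun a b c d h' τ hτ z => ?_, fun x y τ hτ z => ?_⟩
  · rw [h _ (im_mob h' hτ), h _ hτ, hf.mod a b c d h' τ hτ]
  · rw [h _ hτ, h _ hτ, hf.ell x y τ hτ z]
theorem JF.ofMF {k : ℤ} {f : ℂ → ℂ} (hf : MF k f) : JF k 0 (fun τ _ => f τ) := by
  refine ⟨?_, ?_, fun a b c d h τ hτ z => ?_, fun x y τ hτ z => ?_⟩
  · refine holOfDiff D_open ?_
    exact hf.diff.comp differentiableOn_fst (fun p hp => hp)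
  · intro z0
    exact hf.bd.comp_tendsto Filter.tendsto_fst
  · simpa using hf.law a b c d h τ hτ
  · simp
theorem JF.one : JF 0 0 (fun _ _ => 1) := JF.ofMF (MF.const 1)
theorem JF.zero (k t : ℤ) : JF k t (fun _ _ => 0) :=
  ⟨Hol.const 0, Bd.const 0, fun a b c d h τ hτ z => by simp, fun x y τ hτ z => by simp⟩
theorem JF.smulMF {k l t : ℤ} {h : ℂ → ℂ} {f : Fn} (hh : MF l h) (hf : JF k t f) :
    JF (l + k) t (fun τ z => h τ * f τ z) := by
  simpa using (JF.ofMF hh).mul hf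
theorem JF.pow {k t : ℤ} {f : Fn} (hf : JF k t f) (n : ℕ) : JF (n * k) (n * t) (fun τ z => f τ z ^ n) := by
  induction n with
  | zero => simpa using JF.one
  | succ n ih =>
    have := ih.mul hf
    simp only [pow_succ]
    convert this using 1 <;> (push_cast; ring)
theorem JF.prod {ι : Type*} (s : Finset ι) {k t : ι → ℤ} {f : ι → Fn} (hf : ∀ i ∈ s, JF (k i) (t i) (f i)) :
    JF (∑ i ∈ s, k i) (∑ i ∈ s, t i) (fun τ z => ∏ i ∈ s, f i τ z) := by
  classical
  induction s using Finset.induction_on with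
  | empty => simpa using JF.one
  | insert a s ha ih =>
    simp only [Finset.sum_insert ha, Finset.prod_insert ha]
    exact (hf a (by simp)).mul (ih fun i hi => hf i (by simp [hi]))
theorem JF.sum {ι : Type*} (s : Finset ι) {k t : ℤ} {f : ι → Fn} (hf : ∀ i ∈ s, JF k t (f i)) :
    JF k t (fun τ z => ∑ i ∈ s, f i τ z) := by
  classical
  induction s using Finset.induction_on with
  | empty => simpa using JF.zero k t
  | insert a s ha ih =>
    simp only [Finset.sum_insert ha]
    exact (hf a (by simp)).add (ih fun i hi => hf i (by simp [hi]))
end E8J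
end ModC

section ModM
open scoped Manifold
set_option linter.unusedVariables false
set_option linter.unusedSimpArgs false
namespace E8J

theorem IsModularForm.toMF {k : ℤ} {f : ℂ → ℂ} (h : IsModularForm k f) : MF k f := by
  obtain ⟨h1, h2, cf, hcf⟩ := h
  refine ⟨h1, h2, ?_⟩
  have hs := (hcf I (by simp)).summable.norm
  rw [Asymptotics.isBigO_iff]
  refine ⟨∑' n : ℕ, ‖cf n * Complex.exp (2 * (Real.pi : ℂ) * Complex.I * (n : ℂ) * I)‖, ?_⟩
  refine Iinf_basis.eventually_iff.2 ⟨1, trivial, fun τ hτ => ?_⟩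
  have hτ' : 1 ≤ τ.im := hτ
  rw [← (hcf τ (by linarith)).tsum_eq]
  simp only [norm_one, mul_one]
  refine tsum_of_norm_bounded hs.hasSum fun n => ?_
  rw [norm_mul, norm_mul, Complex.norm_exp, Complex.norm_exp]
  refine mul_le_mul_of_nonneg_left (Real.exp_le_exp.2 ?_) (norm_nonneg _)
  simp
  nlinarith [Real.pi_pos, mul_nonneg Real.pi_pos.le (Nat.cast_nonneg (α := ℝ) n)]

theorem MF.toIs {k : ℤ} {f : ℂ → ℂ} (h : MF k f) : IsModularForm k f := by
  refine ⟨h.diff, h.law, fun n => (UpperHalfPlane.qExpansion 1 (fun τ : UpperHalfPlane => f τ)).coeff n, fun τ hτ => ?_⟩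
  have hper : Function.Periodic ((fun τ : UpperHalfPlane => f τ) ∘ UpperHalfPlane.ofComplex) ((1:ℝ):ℂ) := by
    intro w
    by_cases hw : 0 < w.im
    · have hw' : 0 < (w + ((1:ℝ):ℂ)).im := by simpa using hw
      simp only [Function.comp, UpperHalfPlane.ofComplex_apply_of_im_pos hw, UpperHalfPlane.ofComplex_apply_of_im_pos hw']
      have := h.law 1 1 0 1 (by norm_num) w hw
      simpa using this
    · have hw' : ¬ 0 < (w + ((1:ℝ):ℂ)).im := by simpa using hw
      simp only [Function.comp, UpperHalfPlane.ofComplex_apply_of_im_nonpos (not_lt.1 hw), UpperHalfPlane.ofComplex_apply_of_im_nonpos (not_lt.1 hw')]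
  have hhol : MDiff (fun τ : UpperHalfPlane => f τ) := by
    rw [UpperHalfPlane.mdifferentiable_iff]
    refine h.diff.congr fun w hw => ?_
    simp only [Function.comp, UpperHalfPlane.ofComplex_apply_of_im_pos hw]
  have hbdd : UpperHalfPlane.IsBoundedAtImInfty (fun τ : UpperHalfPlane => f τ) := by
    obtain ⟨C, hC⟩ := Asymptotics.isBigO_iff.1 h.bd
    obtain ⟨Y, _, hY⟩ := Iinf_basis.eventually_iff.1 hC
    rw [UpperHalfPlane.isBoundedAtImInfty_iff]
    exact ⟨C, Y, fun z hz => by simpa using hY (show Y ≤ (z:ℂ).im from hz)⟩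
  have := UpperHalfPlane.hasSum_qExpansion one_pos hper hhol hbdd ⟨τ, hτ⟩
  convert this using 2 with n
  rw [smul_eq_mul, Function.Periodic.qParam, ← Complex.exp_nat_mul]
  congr 2
  simp
  ring

/-- Uniform majorant for Fourier expansions. -/
theorem fourierMajorant {φ : Fn} {c : ℕ → (Fin 8 → ℚ) → ℂ} (h : FourierRep E8Gram φ c) (z0 : V8) :
    ∃ B : ℕ × (Fin 8 → ℚ) → ℝ, Summable B ∧ (∀ p, 0 ≤ B p) ∧ ∀ τ : ℂ, 1 ≤ τ.im → ∀ z : V8, ‖z - z0‖ ≤ 1 →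
      ∀ p, ‖c p.1 p.2 * Complex.exp (2 * (Real.pi : ℂ) * Complex.I *
        ((p.1 : ℂ) * τ + pairC E8Gram (qc p.2) z))‖ ≤ B p * Real.exp (-(2 * Real.pi * p.1 * (τ.im - 1))) := by
  let zs : (Fin 8 → Bool) → V8 := fun s j => z0 j + (if s j then I else -I)
  have hs : ∀ s, Summable fun p : ℕ × (Fin 8 → ℚ) => ‖c p.1 p.2 * Complex.exp (2 * (Real.pi : ℂ) * Complex.I *
        ((p.1 : ℂ) * I + pairC E8Gram (qc p.2) (zs s)))‖ := fun s => (h.2 I (by simp) (zs s)).summable.norm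
  refine ⟨fun p => ∑ s, ‖c p.1 p.2 * Complex.exp (2 * (Real.pi : ℂ) * Complex.I *
        ((p.1 : ℂ) * I + pairC E8Gram (qc p.2) (zs s)))‖, summable_sum fun s _ => hs s,
        fun p => Finset.sum_nonneg fun s _ => norm_nonneg _, fun τ hτ z hz p => ?_⟩
  obtain ⟨n, ℓ⟩ := p
  let L : Fin 8 → ℝ := fun j => ∑ i, (ℓ i : ℝ) * (E8Gram i j : ℝ)
  have hL : ∀ w : V8, (pairC E8Gram (qc ℓ) w).im = ∑ j, L j * (w j).im := by
    intro w
    have : pairC E8Gram (qc ℓ) w = ∑ j, ((L j : ℝ) : ℂ) * w j := by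
      unfold pairC
      rw [Finset.sum_comm]
      refine Finset.sum_congr rfl fun j _ => ?_
      simp only [L]
      push_cast
      rw [Finset.sum_mul]
      simp [qc]
    rw [this, Complex.im_sum]
    simp
  have hn : ∀ (w : V8) (σ : ℂ), ‖c n ℓ * Complex.exp (2 * (Real.pi : ℂ) * Complex.I *
        ((n : ℂ) * σ + pairC E8Gram (qc ℓ) w))‖ = ‖c n ℓ‖ * Real.exp (-(2 * Real.pi * (n * σ.im + ∑ j, L j * (w j).im))) := by
    intro w σ
    rw [norm_mul, Complex.norm_exp]
    congr 2
    rw [show 2 * (Real.pi : ℂ) * Complex.I *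
        ((n : ℂ) * σ + pairC E8Gram (qc ℓ) w) = ((2 * Real.pi : ℝ) : ℂ) * (I * ((n : ℂ) * σ + pairC E8Gram (qc ℓ) w)) by push_cast; ring,
        Complex.re_ofReal_mul, Complex.I_mul_re, Complex.add_im, hL]
    simp
    ring
  let s : Fin 8 → Bool := fun j => decide (L j < 0)
  calc _ = ‖c n ℓ‖ * Real.exp (-(2 * Real.pi * (n * τ.im + ∑ j, L j * (z j).im))) := hn _ _
    _ ≤ ‖c n ℓ‖ * Real.exp (-(2 * Real.pi * (n * (I:ℂ).im + ∑ j, L j * (zs s j).im))) * Real.exp (-(2 * Real.pi * n * (τ.im - 1))) := by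
      rw [mul_assoc ‖c n ℓ‖, ← Real.exp_add]
      refine mul_le_mul_of_nonneg_left (Real.exp_le_exp.2 ?_) (norm_nonneg _)
      have : ∑ j, L j * (zs s j).im ≤ ∑ j, L j * (z j).im := by
        refine Finset.sum_le_sum fun j _ => ?_
        have h1 : |(z j).im - (z0 j).im| ≤ 1 := by
          have := (Complex.abs_im_le_norm (z j - z0 j)).trans ((norm_le_pi_norm (z - z0) j).trans hz)
          simpa using this
        rw [abs_le] at h1
        by_cases hj : L j < 0
        · simp [zs, s, hj]; nlinarith
        · simp [zs, s, hj]; nlinarith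
      simp
      nlinarith [Real.pi_pos]
    _ = ‖c n ℓ * Complex.exp (2 * (Real.pi : ℂ) * Complex.I *
        ((n : ℂ) * I + pairC E8Gram (qc ℓ) (zs s)))‖ * Real.exp (-(2 * Real.pi * n * (τ.im - 1))) := by
      rw [hn]
    _ ≤ _ := by
      gcongr
      exact Finset.single_le_sum (f := fun s => ‖c n ℓ * Complex.exp (2 * (Real.pi : ℂ) * Complex.I *
        ((n : ℂ) * I + pairC E8Gram (qc ℓ) (zs s)))‖) (fun s _ => norm_nonneg _) (Finset.mem_univ s)

theorem JF.ofWeak {k : ℤ} {m : ℕ} {f : Fn} (h : IsWeakJacobiForm E8Gram k m f) : JF k m f := by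
  obtain ⟨h1, h2, h3, c, hc⟩ := h
  refine ⟨holOfDiff D_open ?_, ?_, by simpa using h2, by simpa using h3⟩
  · have : D = ({τ : ℂ | 0 < τ.im} ×ˢ (Set.univ : Set (Fin 8 → ℂ))) := by ext p; simp [D]
    rw [this]; exact h1
  · rw [Bd_iff]
    intro z0
    obtain ⟨B, hB, hB0, hb⟩ := fourierMajorant hc z0
    refine ⟨∑' p, B p, 1, 1, one_pos, one_pos, fun τ hτ z hz => ?_⟩
    rw [← (hc.2 τ (by linarith) z).tsum_eq]
    refine tsum_of_norm_bounded hB.hasSum fun p => (hb τ hτ z hz.le p).trans ?_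
    refine mul_le_of_le_one_right (hB0 p) (Real.exp_le_one_iff.2 ?_)
    have : 0 ≤ 2 * Real.pi * p.1 * (τ.im - 1) := by
      have := Real.pi_pos
      have : 0 ≤ τ.im - 1 := by linarith
      positivity
    linarith

/-- limit at the cusp -/
theorem fourierLimit {f : Fn} {c : ℕ → (Fin 8 → ℚ) → ℂ} (hc : FourierRep E8Gram f c)
    (h0 : ∀ ℓ : Fin 8 → ℚ, c 0 ℓ = if ℓ = 0 then 1 else 0) (z0 : V8) :
    ∃ C : ℝ, ∀ τ : ℂ, 1 ≤ τ.im → ∀ z : V8, ‖z - z0‖ ≤ 1 → ‖f τ z - 1‖ ≤ C * Real.exp (-(2 * Real.pi * (τ.im - 1))) := by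
  obtain ⟨B, hB, hB0, hb⟩ := fourierMajorant hc z0
  refine ⟨∑' p, B p, fun τ hτ z hz => ?_⟩
  have hs := hc.2 τ (by linarith) z
  have h1 : HasSum (fun p : ℕ × (Fin 8 → ℚ) => if p = (0, 0) then (1:ℂ) else 0) 1 := hasSum_ite_eq _ _
  have hd := hs.sub h1
  rw [← hd.tsum_eq, ← tsum_mul_right]
  refine tsum_of_norm_bounded (hB.mul_right _).hasSum fun p => ?_
  by_cases hp : p.1 = 0
  · obtain ⟨n, ℓ⟩ := p
    simp only at hp
    subst hp
    have : 0 ≤ B (0, ℓ) * Real.exp (-(2 * Real.pi * (τ.im - 1))) := mul_nonneg (hB0 _) (Real.exp_pos _).le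
    by_cases hl : ℓ = 0
    · subst hl; simpa [h0, pairC, qc] using this
    · simpa [h0, hl] using this
  · have : p ≠ (0, 0) := fun h => hp (by rw [h])
    rw [if_neg this, sub_zero]
    refine (hb τ hτ z hz p).trans ?_
    have : (1:ℝ) ≤ p.1 := by exact_mod_cast Nat.one_le_iff_ne_zero.2 hp
    refine mul_le_mul_of_nonneg_left (Real.exp_le_exp.2 ?_) (hB0 p)
    have h2 : 0 ≤ τ.im - 1 := by linarith
    nlinarith [mul_nonneg (mul_nonneg Real.pi_pos.le h2) (sub_nonneg.2 this)]
end E8J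
end ModM

section ModN
open scoped Manifold
set_option linter.unusedVariables false
set_option linter.unusedSimpArgs false
namespace E8J
open UpperHalfPlane in
def MF.toMod {k : ℤ} {f : ℂ → ℂ} (h : MF k f) : ModularForm (MonoidHom.range (Matrix.SpecialLinearGroup.mapGL ℝ : SpecialLinearGroup (Fin 2) ℤ →* _)) k :=
  have hsl : ∀ γ : SpecialLinearGroup (Fin 2) ℤ, SlashAction.map k γ (fun τ : UpperHalfPlane => f τ) = (fun τ : UpperHalfPlane => f τ) := by
    intro γ
    ext τ
    rw [ModularForm.SL_slash_apply]
    have := h.law (γ 0 0) (γ 0 1) (γ 1 0) (γ 1 1) (by have := γ.det_coe; rw [Matrix.det_fin_two] at this; linarith) τ τ.2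
    have e1 : ((γ • τ : UpperHalfPlane) : ℂ) = ((γ 0 0 : ℂ) * τ + (γ 0 1 : ℂ)) / ((γ 1 0 : ℂ) * τ + (γ 1 1 : ℂ)) := by
      rw [UpperHalfPlane.specialLinearGroup_apply]; simp
    rw [e1, this]
    have e2 : denom γ τ = ((γ 1 0 : ℂ) * τ + (γ 1 1 : ℂ)) := by
      simp [UpperHalfPlane.denom]
    rw [e2]
    have hne : ((γ 1 0 : ℂ) * τ + (γ 1 1 : ℂ)) ≠ 0 := by rw [← e2]; exact denom_ne_zero _ _
    rw [_root_.zpow_neg]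
    field_simp
  { toFun := fun τ : UpperHalfPlane => f τ
    slash_action_eq' := fun A hA => by
      obtain ⟨A, rfl⟩ := hA
      exact hsl A
    holo' := by
      rw [UpperHalfPlane.mdifferentiable_iff]
      refine h.diff.congr fun w hw => ?_
      change f (ofComplex w) = f w
      simp only [Function.comp, UpperHalfPlane.ofComplex_apply_of_im_pos hw]
    bdd_at_cusps' := fun hc => by
      rw [Subgroup.IsArithmetic.isCusp_iff_isCusp_SL2Z] at hc
      rw [OnePoint.isBoundedAt_iff_forall_SL2Z hc]
      intro γ _
      rw [hsl γ]
      obtain ⟨C, hC⟩ := Asymptotics.isBigO_iff.1 h.bd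
      obtain ⟨Y, _, hY⟩ := Iinf_basis.eventually_iff.1 hC
      rw [UpperHalfPlane.isBoundedAtImInfty_iff]
      exact ⟨C, Y, fun z hz => by simpa using hY (show Y ≤ (z:ℂ).im from hz)⟩ }

theorem mf4 {f : ℂ → ℂ} (h : MF 4 f) : ∃ c : ℂ, ∀ τ : UpperHalfPlane, f τ = c * ModularForm.E₄ τ := by
  have := (finrank_eq_one_iff_of_nonzero' ModularForm.E₄ (EisensteinSeries.E_ne_zero _ ⟨2, rfl⟩)).1 (Module.rank_eq_one_iff_finrank_eq_one.1 ModularForm.levelOne_weight_four_rank_one) h.toMod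
  obtain ⟨c, hc⟩ := this
  refine ⟨c, fun τ => ?_⟩
  have := DFunLike.congr_fun hc τ
  exact this.symm
theorem mf6 {f : ℂ → ℂ} (h : MF 6 f) : ∃ c : ℂ, ∀ τ : UpperHalfPlane, f τ = c * ModularForm.E₆ τ := by
  have := (finrank_eq_one_iff_of_nonzero' ModularForm.E₆ (EisensteinSeries.E_ne_zero _ ⟨3, rfl⟩)).1 (Module.rank_eq_one_iff_finrank_eq_one.1 ModularForm.levelOne_weight_six_rank_one) h.toMod
  obtain ⟨c, hc⟩ := this
  refine ⟨c, fun τ => ?_⟩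
  have := DFunLike.congr_fun hc τ
  exact this.symm

theorem limitQ {f : ℂ → ℂ} {cf : ℕ → ℂ} (h : ∀ τ : ℂ, 0 < τ.im →
    HasSum (fun n : ℕ => cf n * Complex.exp (2 * (Real.pi : ℂ) * Complex.I * (n : ℂ) * τ)) (f τ)) :
    Filter.Tendsto f Iinf (nhds (cf 0)) := by
  have hs := (h I (by simp)).summable.norm
  rw [tendsto_iff_norm_sub_tendsto_zero]
  have hlim : Filter.Tendsto (fun τ : ℂ => (∑' n : ℕ, ‖cf n * Complex.exp (2 * (Real.pi : ℂ) * Complex.I * (n : ℂ) * I)‖) * Real.exp (-(2 * Real.pi * (τ.im - 1)))) Iinf (nhds 0) := by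
    rw [← mul_zero (∑' n : ℕ, ‖cf n * Complex.exp (2 * (Real.pi : ℂ) * Complex.I * (n : ℂ) * I)‖)]
    refine Filter.Tendsto.const_mul _ ?_
    refine Real.tendsto_exp_atBot.comp ?_
    refine Filter.tendsto_neg_atTop_atBot.comp ?_
    refine Filter.Tendsto.const_mul_atTop (by positivity) ?_
    exact Filter.tendsto_atTop_add_const_right _ _ Filter.tendsto_comap
  refine squeeze_zero' (Filter.Eventually.of_forall fun _ => norm_nonneg _) ?_ hlim
  refine Iinf_basis.eventually_iff.2 ⟨1, trivial, fun τ hτ => ?_⟩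
  have hτ' : 1 ≤ τ.im := hτ
  have h1 : HasSum (fun p : ℕ => if p = 0 then cf 0 else 0) (cf 0) := hasSum_ite_eq _ _
  have hd := (h τ (by linarith)).sub h1
  rw [← hd.tsum_eq, ← tsum_mul_right]
  refine tsum_of_norm_bounded (hs.mul_right _).hasSum fun n => ?_
  by_cases hn : n = 0
  · subst hn; simp; positivity
  · rw [if_neg hn, sub_zero, norm_mul, norm_mul, Complex.norm_exp, Complex.norm_exp, mul_assoc ‖cf n‖, ← Real.exp_add]
    refine mul_le_mul_of_nonneg_left (Real.exp_le_exp.2 ?_) (norm_nonneg _)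
    have : (1:ℝ) ≤ n := by exact_mod_cast Nat.one_le_iff_ne_zero.2 hn
    simp
    have h2 : 0 ≤ τ.im - 1 := by linarith
    nlinarith [mul_nonneg (mul_nonneg Real.pi_pos.le h2) (sub_nonneg.2 this)]

def E2c (τ : ℂ) : ℂ := EisensteinSeries.E2 (UpperHalfPlane.ofComplex τ)
theorem E2c_law (a b c d : ℤ) (h : a * d - b * c = 1) (τ : ℂ) (hτ : 0 < τ.im) :
    E2c (((a : ℂ) * τ + (b : ℂ)) / ((c : ℂ) * τ + (d : ℂ))) = ((c : ℂ) * τ + (d : ℂ)) ^ 2 * E2c τ -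
      6 * I / Real.pi * c * ((c : ℂ) * τ + (d : ℂ)) := by
  let γ : SpecialLinearGroup (Fin 2) ℤ := ⟨!![a, b; c, d], by simp [Matrix.det_fin_two]; linarith⟩
  have hE := congrFun (EisensteinSeries.E2_slash_action γ) ⟨τ, hτ⟩
  rw [ModularForm.SL_slash_apply] at hE
  have e1 : ((γ • (⟨τ, hτ⟩ : UpperHalfPlane) : UpperHalfPlane) : ℂ) = ((a : ℂ) * τ + (b : ℂ)) / ((c : ℂ) * τ + (d : ℂ)) := by
    rw [UpperHalfPlane.specialLinearGroup_apply]; simp [γ]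
  have e2 : UpperHalfPlane.denom γ (⟨τ, hτ⟩ : UpperHalfPlane) = ((c : ℂ) * τ + (d : ℂ)) := by
    rw [UpperHalfPlane.denom]; simp; simp [γ]
  have hne := den_ne h hτ
  have hpi : (Real.pi : ℂ) ≠ 0 := by exact_mod_cast Real.pi_ne_zero
  unfold E2c
  rw [← e1, UpperHalfPlane.ofComplex_apply, UpperHalfPlane.ofComplex_apply_of_im_pos hτ]
  simp only [Pi.sub_apply, Pi.smul_apply, EisensteinSeries.D2, e2, riemannZeta_two, smul_eq_mul] at hE
  have hc : ((γ 1 0 : ℤ) : ℂ) = c := by simp [γ]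
  rw [hc, _root_.zpow_neg] at hE
  have : EisensteinSeries.E2 (γ • (⟨τ, hτ⟩ : UpperHalfPlane)) = ((c : ℂ) * τ + (d : ℂ)) ^ 2 * (EisensteinSeries.E2 (γ • (⟨τ, hτ⟩ : UpperHalfPlane)) * (((c : ℂ) * τ + (d : ℂ)) ^ (2:ℤ))⁻¹) := by
    rw [zpow_ofNat]
    field_simp
  rw [this, hE]
  field_simp
theorem E2c_diff : DifferentiableOn ℂ E2c {τ : ℂ | 0 < τ.im} := UpperHalfPlane.mdifferentiable_iff.1 E2_mdifferentiable

theorem E2c_lim : Filter.Tendsto E2c Iinf (nhds 1) := by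
  have := limitQ (f := E2c) (cf := fun n => if n = 0 then 1 else -24 * ArithmeticFunction.sigma 1 n) ?_
  · simpa using this
  intro τ hτ
  have := EisensteinSeries.hasSum_qExpansion_E2 ⟨τ, hτ⟩
  unfold E2c
  rw [UpperHalfPlane.ofComplex_apply_of_im_pos hτ]
  have e : (fun n : ℕ => (if n = 0 then (1:ℂ) else -24 * ArithmeticFunction.sigma 1 n) * Complex.exp (2 * (Real.pi : ℂ) * Complex.I * (n : ℂ) * τ)) =
      (fun m : ℕ => (if m = 0 then 1 else -24 * (ArithmeticFunction.sigma 1 m : ℂ)) • cexp (2 * ↑Real.pi * I * τ) ^ m) := by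
    funext n
    rw [smul_eq_mul, ← Complex.exp_nat_mul]
    congr 2
    ring
  rw [e]
  exact this

/-- the two lowest Taylor coefficients of an index one form have no common zero -/
theorem noCommonZero {e a : ℂ → ℂ} {Q : ℂ} (hQ : Q ≠ 0) (he : MF 4 e) (ha : DifferentiableOn ℂ a {τ : ℂ | 0 < τ.im})
    (hlaw : ∀ x b c d : ℤ, x * d - b * c = 1 → ∀ τ : ℂ, 0 < τ.im →
      a (((x : ℂ) * τ + (b : ℂ)) / ((c : ℂ) * τ + (d : ℂ))) = ((c : ℂ) * τ + (d : ℂ)) ^ 6 * a τ +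
        2 * Real.pi * I * Q * c * ((c : ℂ) * τ + (d : ℂ)) ^ 5 * e τ)
    (hel : Filter.Tendsto e Iinf (nhds 1)) (hal : Filter.Tendsto a Iinf (nhds 0)) {τ : ℂ} (hτ : 0 < τ.im) :
    ¬ (e τ = 0 ∧ a τ = 0) := by
  have hpi : (Real.pi : ℂ) ≠ 0 := by exact_mod_cast Real.pi_ne_zero
  let C : ℂ := - Real.pi ^ 2 * Q / 3
  have hC : C ≠ 0 := by simp [C, hQ, hpi]
  let κ : ℂ → ℂ := fun τ => a τ - C * E2c τ * e τ
  have hκl : Filter.Tendsto κ Iinf (nhds (-C)) := by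
    have := hal.sub (((tendsto_const_nhds (x := C)).mul E2c_lim).mul hel)
    simpa using this
  have hκ : MF 6 κ := by
    refine ⟨ha.sub ((E2c_diff.const_mul C).mul he.diff), fun x b c d h σ hσ => ?_, hκl.isBigO_one ℝ⟩
    have hne := den_ne h hσ
    simp only [κ, hlaw x b c d h σ hσ, E2c_law x b c d h σ hσ, he.law x b c d h σ hσ, C]
    rw [show ((c:ℂ) * σ + d) ^ (4:ℤ) = ((c:ℂ) * σ + d) ^ 4 by norm_cast, show ((c:ℂ) * σ + d) ^ (6:ℤ) = ((c:ℂ) * σ + d) ^ 6 by norm_cast]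
    field_simp
    ring
  obtain ⟨c4, h4⟩ := mf4 he
  obtain ⟨c6, h6⟩ := mf6 hκ
  have n4 : c4 ≠ 0 := by
    rintro rfl
    have : (fun _ => (0:ℂ)) =ᶠ[Iinf] e := by
      filter_upwards [Iinf_pos] with σ hσ
      simpa using (h4 ⟨σ, hσ⟩).symm
    exact one_ne_zero (tendsto_nhds_unique (hel.congr' this.symm) tendsto_const_nhds)
  have n6 : c6 ≠ 0 := by
    rintro rfl
    have : (fun _ => (0:ℂ)) =ᶠ[Iinf] κ := by
      filter_upwards [Iinf_pos] with σ hσ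
      simpa using (h6 ⟨σ, hσ⟩).symm
    exact hC (neg_eq_zero.1 (tendsto_nhds_unique (hκl.congr' this.symm) tendsto_const_nhds))
  rintro ⟨z1, z2⟩
  have e4 := h4 ⟨τ, hτ⟩
  have e6 := h6 ⟨τ, hτ⟩
  have k0 : κ τ = 0 := by simp [κ, z1, z2]
  change e τ = _ at e4
  change κ τ = _ at e6
  rw [z1] at e4
  rw [k0] at e6
  have f4 := (mul_eq_zero.1 e4.symm).resolve_left n4
  have f6 := (mul_eq_zero.1 e6.symm).resolve_left n6
  have := ModularForm.discriminant_eq_E₄_cube_sub_E₆_sq ⟨τ, hτ⟩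
  rw [f4, f6] at this
  exact ModularForm.discriminant_ne_zero ⟨τ, hτ⟩ (by rw [this]; norm_num)
end E8J
end ModN

section ModD
open scoped Manifold
set_option linter.unusedVariables false
set_option linter.unusedSimpArgs false
namespace E8J

/-- the basic q-product -/
def Aq (p : ℂ × ℂ) : ℂ := ∏' n : ℕ, (1 + -(p.1 ^ (n + 1) * p.2))
def Uq : Set (ℂ × ℂ) := {p | ‖p.1‖ < 1}
theorem Uq_open : IsOpen Uq := isOpen_lt (by fun_prop) continuous_const

theorem Aq_summable {q x : ℂ} (hq : ‖q‖ < 1) : Summable (fun n : ℕ => ‖-(q ^ (n + 1) * x)‖) := by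
  have : Summable (fun n : ℕ => ‖q‖ ^ n * (‖q‖ * ‖x‖)) :=
    (summable_geometric_of_lt_one (norm_nonneg _) hq).mul_right _
  refine this.congr fun n => ?_
  simp [pow_succ, mul_assoc]

theorem Aq_mult {q x : ℂ} (hq : ‖q‖ < 1) : Multipliable (fun n : ℕ => 1 + -(q ^ (n + 1) * x)) :=
  multipliable_one_add_of_summable (Aq_summable hq)

theorem Aq_ne {q x : ℂ} (hq : ‖q‖ < 1) (h : ∀ n : ℕ, q ^ (n + 1) * x ≠ 1) : Aq (q, x) ≠ 0 := by
  refine tprod_one_add_ne_zero_of_summable (fun n h0 => h n ?_) (Aq_summable hq)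
  linear_combination -h0

theorem Aq_step {q x : ℂ} (hq : ‖q‖ < 1) : Aq (q, x) = (1 - q * x) * Aq (q, q * x) := by
  unfold Aq
  have h1 : (fun n : ℕ => 1 + -(q ^ (n + 1) * (q * x))) = (fun n : ℕ => 1 + -(q ^ (n + 1 + 1) * x)) := by
    funext n; ring
  have h2 := Aq_mult (x := q * x) hq
  rw [h1] at h2
  rw [tprod_eq_zero_mul' (f := fun n : ℕ => 1 + -(q ^ (n + 1) * x)) h2]
  simp only [h1]
  simp; ring_nf; simp

theorem Aq_zero (x : ℂ) : Aq (0, x) = 1 := by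
  simp [Aq]

theorem holLimit {E : Type*} [NormedAddCommGroup E] [NormedSpace ℂ E] {U : Set E} (hU : IsOpen U)
    {f : ℕ → E → ℂ} {g : E → ℂ} (hf : ∀ n, Hol U (f n))
    (h : TendstoLocallyUniformlyOn f g Filter.atTop U) : Hol U g := by
  refine ⟨h.continuousOn (Filter.Frequently.of_forall fun n => (hf n).1), fun p hp v => ?_⟩
  have ho : IsOpen {w : ℂ | p + w • v ∈ U} := hU.preimage (lineCont p v)
  have h2 : TendstoLocallyUniformlyOn (fun n (w : ℂ) => f n (p + w • v)) (fun w : ℂ => g (p + w • v)) Filter.atTop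
      {w : ℂ | p + w • v ∈ U} :=
    h.comp (fun w : ℂ => p + w • v) (fun w hw => hw) (lineCont p v).continuousOn
  have h3 := h2.differentiableOn (Filter.Eventually.of_forall fun n => (hf n).lineOn p v) ho
  exact (h3 0 (by simpa using hp)).differentiableAt (ho.mem_nhds (by simpa using hp))

theorem Aq_lu : TendstoLocallyUniformlyOn (fun (N : ℕ) (p : ℂ × ℂ) => ∏ n ∈ Finset.range N, (1 + -(p.1 ^ (n + 1) * p.2)))
    Aq Filter.atTop Uq := by
  suffices h : ∀ p ∈ Uq, ∃ V, IsOpen V ∧ p ∈ V ∧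
      TendstoLocallyUniformlyOn (fun (N : ℕ) (p : ℂ × ℂ) => ∏ n ∈ Finset.range N, (1 + -(p.1 ^ (n + 1) * p.2)))
        Aq Filter.atTop V by
    intro u hu p hp
    obtain ⟨V, hV, hpV, h⟩ := h p hp
    obtain ⟨t, ht, h2⟩ := h u hu p hpV
    exact ⟨t, mem_nhdsWithin_of_mem_nhds (by rwa [hV.nhdsWithin_eq hpV] at ht), h2⟩
  intro p hp
  obtain ⟨r, hr1, hr2⟩ := exists_between (show ‖p.1‖ < 1 from hp)
  have hr0 : 0 ≤ r := (norm_nonneg _).trans hr1.le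
  let V : Set (ℂ × ℂ) := {p' | ‖p'.1‖ < r} ∩ {p' | ‖p'.2‖ < ‖p.2‖ + 1}
  have hV : IsOpen V := by
    refine IsOpen.inter ?_ ?_
    · exact isOpen_lt (by fun_prop) continuous_const
    · exact isOpen_lt (by fun_prop) continuous_const
  refine ⟨V, hV, ⟨hr1, by simp⟩, ?_⟩
  have hs : Summable (fun n : ℕ => r ^ n * (r * (‖p.2‖ + 1))) :=
    (summable_geometric_of_lt_one hr0 hr2).mul_right _
  have := Summable.hasProdLocallyUniformlyOn_nat_one_add (f := fun (n : ℕ) (p : ℂ × ℂ) => -(p.1 ^ (n + 1) * p.2)) hV hs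
    (Filter.Eventually.of_forall fun n x hx => by
      have : ‖x.1‖ ^ n * (‖x.1‖ * ‖x.2‖) ≤ r ^ n * (r * (‖p.2‖ + 1)) := by
        have h1 : ‖x.1‖ ≤ r := le_of_lt hx.1
        have h2 : ‖x.2‖ ≤ _ := le_of_lt hx.2
        gcongr
      simpa [pow_succ, mul_assoc] using this) (fun n => by fun_prop)
  exact this.tendstoLocallyUniformlyOn_finsetRange

theorem Aq_cont : ContinuousOn Aq Uq :=
  Aq_lu.continuousOn (Filter.Frequently.of_forall fun n => by fun_prop)

theorem Aq_comp {E : Type*} [NormedAddCommGroup E] [NormedSpace ℂ E] {V : Set E} (hV : IsOpen V) {a b : E → ℂ}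
    (ha : Hol V a) (hb : Hol V b) (h : ∀ p ∈ V, ‖a p‖ < 1) : Hol V (fun p => Aq (a p, b p)) := by
  have h2 := Aq_lu.comp (fun p => (a p, b p)) (t := V) (fun p hp => h p hp) (ha.1.prodMk hb.1)
  refine holLimit hV (fun n => ?_) h2
  exact Hol.prod _ fun i _ => (Hol.const 1).add ((ha.pow _).mul hb).neg

/-- the normalized theta function -/
def th (τ u : ℂ) : ℂ := jtheta τ u / dedekindEta τ ^ 3
def qx (τ : ℂ) : ℂ := Complex.exp (2 * Real.pi * I * τ)

theorem qx_lt {τ : ℂ} (h : 0 < τ.im) : ‖qx τ‖ < 1 := by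
  rw [qx, Complex.norm_exp]
  rw [Real.exp_lt_one_iff]
  simp
  positivity

theorem qx_ne (τ : ℂ) : qx τ ≠ 0 := Complex.exp_ne_zero _

theorem qx_pow (τ : ℂ) (n : ℕ) : Complex.exp (2 * (Real.pi : ℂ) * Complex.I * ((n : ℂ) + 1) * τ) = qx τ ^ (n + 1) := by
  rw [qx, ← Complex.exp_nat_mul]; congr 1; push_cast; ring

theorem qx_inv (u : ℂ) : qx (-u) = (qx u)⁻¹ := by
  rw [qx, qx, ← Complex.exp_neg]; congr 1; ring
theorem qx_add (u v : ℂ) : qx (u + v) = qx u * qx v := by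
  rw [qx, qx, qx, ← Complex.exp_add]; congr 1; ring

def E1 (u : ℂ) : ℂ := Complex.exp (Real.pi * I * u) - Complex.exp (-(Real.pi * I * u))

theorem th_eq {τ : ℂ} (hτ : 0 < τ.im) (u : ℂ) :
    th τ u = E1 u * Aq (qx τ, qx u) * Aq (qx τ, qx (-u)) / Aq (qx τ, 1) ^ 2 := by
  have hq := qx_lt hτ
  have hA : Aq (qx τ, 1) ≠ 0 := by
    refine Aq_ne hq fun n h => ?_
    have := congrArg norm h
    simp only [mul_one, norm_pow, norm_one] at this
    exact absurd this (pow_lt_one₀ (norm_nonneg _) hq (by omega)).ne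
  have h1 : dedekindEta τ = Complex.exp ((Real.pi : ℂ) * Complex.I * τ / 12) * Aq (qx τ, 1) := by
    unfold dedekindEta Aq
    simp only [qx_pow]
    congr 2; funext n; simp; ring
  have h2 : jtheta τ u = Complex.exp ((Real.pi : ℂ) * Complex.I * τ / 4) * E1 u *
      (Aq (qx τ, qx u) * Aq (qx τ, qx (-u)) * Aq (qx τ, 1)) := by
    unfold jtheta Aq E1
    rw [← (Aq_mult hq).tprod_mul (Aq_mult hq), ← ((Aq_mult hq).mul (Aq_mult hq)).tprod_mul (Aq_mult hq)]
    congr 2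
    funext n
    rw [qx_pow, qx_inv, Complex.exp_neg]
    simp only [qx]; ring
  rw [th, h1, h2, mul_pow, ← Complex.exp_nat_mul,
    show ((3:ℕ):ℂ) * ((Real.pi : ℂ) * Complex.I * τ / 12) = (Real.pi : ℂ) * Complex.I * τ / 4 by push_cast; ring]
  have := Complex.exp_ne_zero ((Real.pi : ℂ) * Complex.I * τ / 4)
  field_simp

theorem Aq1_ne {q : ℂ} (hq : ‖q‖ < 1) : Aq (q, 1) ≠ 0 := by
  refine Aq_ne hq fun n h => ?_
  have := congrArg norm h
  simp only [mul_one, norm_pow, norm_one] at this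
  exact absurd this (pow_lt_one₀ (norm_nonneg _) hq (by omega)).ne

/-- two-variable domain -/
def D1 : Set (ℂ × ℂ) := {p | 0 < p.1.im}
theorem D1_open : IsOpen D1 := isOpen_lt continuous_const (by fun_prop)

theorem th_hol : Hol D1 (fun p => th p.1 p.2) := by
  have hE : ∀ {f : ℂ × ℂ → ℂ}, Differentiable ℂ f → Hol D1 f := fun h => holOfDiff D1_open h.differentiableOn
  have hq : ∀ p ∈ D1, ‖qx p.1‖ < 1 := fun p hp => qx_lt hp
  have h1 : Hol D1 (fun p : ℂ × ℂ => qx p.1) := hE (by unfold qx; fun_prop)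
  refine Hol.congr D1_open (Hol.div (((hE (f := fun p => E1 p.2) (by unfold E1; fun_prop)).mul
    (Aq_comp D1_open h1 (hE (f := fun p => qx p.2) (by unfold qx; fun_prop)) hq)).mul
    (Aq_comp D1_open h1 (hE (f := fun p => qx (-p.2)) (by unfold qx; fun_prop)) hq))
    ((Aq_comp D1_open h1 (Hol.const 1) hq).pow 2) ?_) fun p hp => th_eq hp p.2
  exact fun p hp => pow_ne_zero 2 (Aq1_ne (hq p hp))

theorem th_diff {τ : ℂ} (hτ : 0 < τ.im) : Differentiable ℂ (th τ) := by
  intro u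
  have := th_hol.line (τ, 0) (0, 1) u (by simpa [D1] using hτ)
  simpa using this

theorem th_lim (u0 : ℂ) : Filter.Tendsto (fun p : ℂ × ℂ => th p.1 p.2) (Iinf ×ˢ nhds u0) (nhds (E1 u0)) := by
  have hq : Filter.Tendsto (fun p : ℂ × ℂ => qx p.1) (Iinf ×ˢ nhds u0) (nhds 0) := by
    refine Filter.Tendsto.comp (g := qx) (y := Iinf) ?_ Filter.tendsto_fst
    rw [tendsto_zero_iff_norm_tendsto_zero]
    have : (fun τ => ‖qx τ‖) = (fun y => Real.exp (-(2 * Real.pi * y))) ∘ Complex.im := by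
      funext τ; simp [qx, Complex.norm_exp]
    rw [this]
    refine Filter.Tendsto.comp ?_ Filter.tendsto_comap
    exact Real.tendsto_exp_neg_atTop_nhds_zero.comp (Filter.tendsto_id.const_mul_atTop (by positivity))
  have h2 : Filter.Tendsto (fun p : ℂ × ℂ => p.2) (Iinf ×ˢ nhds u0) (nhds u0) := Filter.tendsto_snd
  have hA : ∀ {b : ℂ → ℂ}, Continuous b → Filter.Tendsto (fun p : ℂ × ℂ => Aq (qx p.1, b p.2)) (Iinf ×ˢ nhds u0) (nhds 1) := by
    intro b hb
    have h3 : ContinuousAt Aq (0, b u0) := Aq_cont.continuousAt (Uq_open.mem_nhds (by simp [Uq]))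
    have h4 := h3.tendsto.comp (hq.prodMk_nhds ((hb.tendsto u0).comp h2))
    rw [Aq_zero] at h4
    exact h4
  have hE : Filter.Tendsto (fun p : ℂ × ℂ => E1 p.2) (Iinf ×ˢ nhds u0) (nhds (E1 u0)) :=
    ((show Continuous E1 by unfold E1; fun_prop).tendsto u0).comp h2
  have := ((hE.mul (hA (b := qx) (by unfold qx; fun_prop))).mul (hA (b := fun u => qx (-u)) (by unfold qx; fun_prop))).div
    ((hA (b := fun _ => 1) continuous_const).pow 2) (by simp)
  simp only [mul_one, one_pow, div_one] at this
  refine this.congr' ?_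
  filter_upwards [Filter.Eventually.prod_inl Iinf_pos (nhds u0)] with p hp
  exact (th_eq hp p.2).symm

theorem E1_eq (u : ℂ) : E1 u = Complex.exp (Real.pi * I * u) * (1 - qx (-u)) := by
  rw [E1, qx, mul_sub, ← Complex.exp_add, mul_one]; congr 2; ring

theorem E1_eq' (u : ℂ) : E1 u = -(Complex.exp (-(Real.pi * I * u)) * (1 - qx u)) := by
  rw [E1, qx, mul_sub, ← Complex.exp_add, mul_one, neg_sub]; congr 2; ring

theorem qx_one : qx 1 = 1 := by rw [qx]; simp [Complex.exp_two_pi_mul_I]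

theorem th_add_one {τ : ℂ} (hτ : 0 < τ.im) (u : ℂ) : th τ (u + 1) = - th τ u := by
  rw [th_eq hτ, th_eq hτ, qx_add, qx_one, mul_one, qx_inv (u+1), qx_add, qx_one, mul_one, ← qx_inv]
  have : E1 (u + 1) = - E1 u := by
    rw [E1, E1, mul_add, mul_one, neg_add, Complex.exp_add, Complex.exp_add, Complex.exp_neg (Real.pi * I),
      Complex.exp_pi_mul_I]; ring
  rw [this]; ring

theorem th_add_tau {τ : ℂ} (hτ : 0 < τ.im) (u : ℂ) :
    th τ (u + τ) = - Complex.exp (-(Real.pi * I * (τ + 2 * u))) * th τ u := by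
  have hq := qx_lt hτ
  rw [th_eq hτ, th_eq hτ]
  have h1 : Aq (qx τ, qx u) = (1 - qx τ * qx u) * Aq (qx τ, qx (u + τ)) := by
    rw [Aq_step hq, qx_add, mul_comm (qx u)]
  have h2 : Aq (qx τ, qx (-(u + τ))) = (1 - qx (-u)) * Aq (qx τ, qx (-u)) := by
    rw [Aq_step hq, ← qx_add]; congr 3 <;> ring_nf
  have h3 : Complex.exp (-(Real.pi * I * (τ + 2 * u))) * Complex.exp (Real.pi * I * u) = Complex.exp (-(Real.pi * I * (u + τ))) := by
    rw [← Complex.exp_add]; congr 1; ring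
  rw [h1, h2, E1_eq', E1_eq u, ← h3, qx_add]
  ring

theorem th_neg {τ : ℂ} (hτ : 0 < τ.im) (u : ℂ) : th τ (-u) = - th τ u := by
  rw [th_eq hτ, th_eq hτ, neg_neg]
  have : E1 (-u) = - E1 u := by simp [E1]
  rw [this]; ring

theorem th_zero {τ : ℂ} (hτ : 0 < τ.im) : th τ 0 = 0 := by
  rw [th_eq hτ]; simp [E1]

theorem th_add_int {τ : ℂ} (hτ : 0 < τ.im) (u : ℂ) (b : ℤ) : th τ (u + b) = (-1) ^ b * th τ u := by
  induction b using Int.induction_on with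
  | zero => simp
  | succ b ih =>
    push_cast at ih ⊢
    rw [← add_assoc, th_add_one hτ, ih, zpow_add_one₀ (by norm_num)]; ring
  | pred b ih =>
    push_cast at ih ⊢
    have := th_add_one hτ (u + (-b - 1))
    rw [show u + (-(b:ℂ) - 1) + 1 = u + -b by ring, ih] at this
    rw [zpow_sub_one₀ (by norm_num)]
    rw [eq_neg_iff_add_eq_zero] at this
    rw [show ((-1:ℂ))⁻¹ = -1 by norm_num]; linear_combination this

theorem th_add_tauInt {τ : ℂ} (hτ : 0 < τ.im) (u : ℂ) (a : ℤ) :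
    th τ (u + a * τ) = (-1) ^ a * Complex.exp (-(Real.pi * I * (a ^ 2 * τ + 2 * a * u))) * th τ u := by
  induction a using Int.induction_on with
  | zero => simp
  | succ a ih =>
    push_cast at ih ⊢
    rw [show u + ((a:ℂ) + 1) * τ = u + a * τ + τ by ring, th_add_tau hτ, ih, zpow_add_one₀ (by norm_num)]
    rw [show -(Real.pi * I * (((a:ℂ) + 1) ^ 2 * τ + 2 * (a + 1) * u)) =
      -(Real.pi * I * (τ + 2 * (u + a * τ))) + -(Real.pi * I * ((a:ℂ) ^ 2 * τ + 2 * a * u)) by ring, Complex.exp_add]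
    ring
  | pred a ih =>
    push_cast at ih ⊢
    have := th_add_tau hτ (u + (-a - 1) * τ)
    rw [show u + (-(a:ℂ) - 1) * τ + τ = u + -a * τ by ring, ih] at this
    rw [zpow_sub_one₀ (by norm_num)]
    rw [show -(Real.pi * I * ((-(a:ℂ)) ^ 2 * τ + 2 * -a * u)) =
      -(Real.pi * I * (τ + 2 * (u + (-a - 1) * τ))) + -(Real.pi * I * ((-(a:ℂ) - 1) ^ 2 * τ + 2 * (-a - 1) * u)) by ring, Complex.exp_add] at this
    have hne := Complex.exp_ne_zero (-(Real.pi * I * (τ + 2 * (u + (-(a:ℂ) - 1) * τ))))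
    apply mul_left_cancel₀ hne
    rw [show ((-1:ℂ))⁻¹ = -1 by norm_num]; linear_combination this

theorem th_ell {τ : ℂ} (hτ : 0 < τ.im) (u : ℂ) (a b : ℤ) :
    th τ (u + a * τ + b) = (-1) ^ a * (-1) ^ b * Complex.exp (-(Real.pi * I * (a ^ 2 * τ + 2 * a * u))) * th τ u := by
  rw [th_add_int hτ, th_add_tauInt hτ]; ring

theorem qx_eq_one {u : ℂ} (h : qx u = 1) : ∃ n : ℤ, u = n := by
  rw [qx, Complex.exp_eq_one_iff] at h
  obtain ⟨n, hn⟩ := h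
  refine ⟨n, ?_⟩
  have : (2 * Real.pi * I : ℂ) ≠ 0 := Complex.two_pi_I_ne_zero
  apply mul_left_cancel₀ this
  linear_combination hn

theorem th_zeros {τ : ℂ} (hτ : 0 < τ.im) {u : ℂ} (h : th τ u = 0) : ∃ a b : ℤ, u = a * τ + b := by
  rw [th_eq hτ] at h
  have hq := qx_lt hτ
  have key : ∀ (u : ℂ) (n : ℕ), qx τ ^ (n+1) * qx u = 1 → ∃ b : ℤ, u = -((n:ℂ)+1) * τ + b := by
    intro u n hn
    rw [← qx_pow, show (2 * (Real.pi : ℂ) * Complex.I * ((n : ℂ) + 1) * τ) = 2 * Real.pi * I * (((n:ℂ)+1)*τ) by ring] at hn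
    have hn' : qx (((n:ℂ)+1)*τ + u) = 1 := by rw [qx_add]; exact hn
    obtain ⟨b, hb⟩ := qx_eq_one hn'
    exact ⟨b, by linear_combination hb⟩
  rw [div_eq_zero_iff] at h
  rcases h with h | h
  · rcases mul_eq_zero.1 h with h | h
    · rcases mul_eq_zero.1 h with h | h
      · rw [E1_eq'] at h
        have := sub_eq_zero.1 ((mul_eq_zero.1 (neg_eq_zero.1 h)).resolve_left (Complex.exp_ne_zero _))
        obtain ⟨b, hb⟩ := qx_eq_one this.symm
        exact ⟨0, b, by simp [hb]⟩
      · by_contra hcon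
        refine Aq_ne hq (fun n hn => hcon ?_) h
        obtain ⟨b, hb⟩ := key _ n hn
        exact ⟨-((n:ℤ)+1), b, by rw [hb]; push_cast; ring⟩
    · by_contra hcon
      refine Aq_ne hq (fun n hn => hcon ?_) h
      obtain ⟨b, hb⟩ := key _ n hn
      exact ⟨((n:ℤ)+1), -b, by push_cast; linear_combination -hb⟩
  · exact absurd h (pow_ne_zero 2 (Aq1_ne hq))

theorem th_latt {τ : ℂ} (hτ : 0 < τ.im) (a b : ℤ) : th τ (a * τ + b) = 0 := by
  have := th_ell hτ 0 a b
  simpa [th_zero hτ] using this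

theorem th_deriv0 {τ : ℂ} (hτ : 0 < τ.im) : HasDerivAt (th τ) (2 * Real.pi * I) 0 := by
  have hq := qx_lt hτ
  have hqd : ∀ p ∈ (Set.univ : Set ℂ), ‖(fun _ : ℂ => qx τ) p‖ < 1 := fun _ _ => hq
  have h1 : Hol Set.univ (fun u : ℂ => Aq (qx τ, qx u) * Aq (qx τ, qx (-u)) / Aq (qx τ, 1) ^ 2) := by
    refine Hol.div (Hol.mul ?_ ?_) (Hol.const _) (fun _ _ => pow_ne_zero 2 (Aq1_ne hq))
    · exact Aq_comp isOpen_univ (Hol.const (qx τ)) (holOfDiff isOpen_univ (by unfold qx; fun_prop)) hqd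
    · exact Aq_comp isOpen_univ (Hol.const (qx τ)) (holOfDiff isOpen_univ (by unfold qx; fun_prop)) hqd
  have h2 := h1.2 0 trivial 1
  simp only [smul_eq_mul, mul_one, zero_add] at h2
  have h3 : HasDerivAt E1 (2 * Real.pi * I) 0 := by
    have ha : HasDerivAt (fun u : ℂ => (Real.pi * I * u : ℂ)) (Real.pi * I) 0 := by
      simpa using (hasDerivAt_id (0:ℂ)).const_mul (Real.pi * I : ℂ)
    have := ha.cexp.sub ha.neg.cexp
    exact this.congr_deriv (by simp; ring)
  have h4 := h3.mul h2.hasDerivAt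
  have h5 : HasDerivAt (fun u => E1 u * (Aq (qx τ, qx u) * Aq (qx τ, qx (-u)) / Aq (qx τ, 1) ^ 2)) (2 * Real.pi * I) 0 := by
    have hE : E1 0 = 0 := by simp [E1]
    have hq0 : qx 0 = 1 := by simp [qx]
    have hA := Aq1_ne hq
    refine HasDerivAt.congr_deriv h4 ?_
    rw [hE, neg_zero, hq0]
    field_simp
    simp
  refine h5.congr_of_eventuallyEq (Filter.Eventually.of_forall fun u => ?_)
  rw [th_eq hτ]; ring

/-- simple zeros -/
theorem th_simple {τ : ℂ} (hτ : 0 < τ.im) {u : ℂ} (h : th τ u = 0) : deriv (th τ) u ≠ 0 := by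
  obtain ⟨a, b, rfl⟩ := th_zeros hτ h
  have h0 := th_deriv0 hτ
  have h1 : HasDerivAt (fun v => th τ (v + a * τ + b))
      ((-1) ^ a * (-1) ^ b * Complex.exp (-(Real.pi * I * (a ^ 2 * τ + 2 * a * 0))) * (2 * Real.pi * I)) 0 := by
    simp only [th_ell hτ]
    have hd : DifferentiableAt ℂ (fun u : ℂ => ((-1) ^ a * (-1) ^ b * Complex.exp (-(Real.pi * I * (a ^ 2 * τ + 2 * a * u))) : ℂ)) 0 := by
      fun_prop
    have := hd.hasDerivAt.mul h0
    refine HasDerivAt.congr_deriv this ?_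
    rw [th_zero hτ]
    simp
  have h2 : HasDerivAt (fun v => th τ (v + a * τ + b)) (deriv (th τ) (a * τ + b)) 0 := by
    have h3 := ((th_diff hτ) (0 + (a * τ + b))).hasDerivAt.comp_add_const (0:ℂ) (a * τ + b)
    simpa [add_assoc] using h3
  rw [h2.unique h1]
  have := Complex.two_pi_I_ne_zero
  have h4 : ∀ n : ℤ, ((-1:ℂ)) ^ n ≠ 0 := fun n => zpow_ne_zero _ (by norm_num)
  have := Complex.exp_ne_zero (-(Real.pi * I * (a ^ 2 * τ + 2 * a * 0)))
  simp [h4, this, Real.pi_ne_zero]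

/-- quotient of functions, with the limit value at zeros of the denominator -/
def quo (f g : ℂ → ℂ) (u : ℂ) : ℂ := if g u = 0 then deriv f u / deriv g u else f u / g u

theorem quo_mul {f g : ℂ → ℂ} (h0 : ∀ u, g u = 0 → f u = 0) (u : ℂ) : f u = quo f g u * g u := by
  unfold quo
  split_ifs with h
  · simp [h, h0 u h]
  · field_simp

theorem quo_diff {f g : ℂ → ℂ} (hf : Differentiable ℂ f) (hg : Differentiable ℂ g)
    (h0 : ∀ u, g u = 0 → f u = 0) (h1 : ∀ u, g u = 0 → deriv g u ≠ 0) : Differentiable ℂ (quo f g) := by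
  intro u0
  by_cases hu : g u0 = 0
  · have hF : Differentiable ℂ (dslope f u0) := by
      have := (Complex.differentiableOn_dslope (s := Set.univ) (c := u0) (f := f) Filter.univ_mem).2 hf.differentiableOn
      exact fun x => (this x trivial).differentiableAt Filter.univ_mem
    have hG : Differentiable ℂ (dslope g u0) := by
      have := (Complex.differentiableOn_dslope (s := Set.univ) (c := u0) (f := g) Filter.univ_mem).2 hg.differentiableOn
      exact fun x => (this x trivial).differentiableAt Filter.univ_mem
    have hne : dslope g u0 u0 ≠ 0 := by rw [dslope_same]; exact h1 u0 hu
    refine ((hF u0).div (hG u0) hne).congr_of_eventuallyEq ?_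
    filter_upwards [hG.continuous.continuousAt.eventually_ne hne] with u h3
    have e1 : f u = (u - u0) * dslope f u0 u := by
      have := sub_smul_dslope f u0 u
      rw [h0 u0 hu, sub_zero] at this
      simpa using this.symm
    have e2 : g u = (u - u0) * dslope g u0 u := by
      have := sub_smul_dslope g u0 u
      rw [hu, sub_zero] at this
      simpa using this.symm
    by_cases h4 : u = u0
    · subst h4
      simp [quo, hu, dslope_same]
    · have h5 : u - u0 ≠ 0 := sub_ne_zero.2 h4
      have h6 : g u ≠ 0 := by rw [e2]; exact mul_ne_zero h5 h3
      simp only [quo, h6, if_false, Pi.div_apply]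
      rw [e1, e2]; field_simp
  · refine ((hf u0).div (hg u0) hu).congr_of_eventuallyEq ?_
    filter_upwards [hg.continuous.continuousAt.eventually_ne hu] with u h3
    simp [quo, h3]

theorem entire_noZeroDiv {f g : ℂ → ℂ} (hf : Differentiable ℂ f) (hg : Differentiable ℂ g)
    (h : ∀ u, f u * g u = 0) {q : ℂ} (hq : f q ≠ 0) : ∀ u, g u = 0 := fun u =>
  noZeroDiv isOpen_univ convex_univ (holOfDiff isOpen_univ hf.differentiableOn)
    (holOfDiff isOpen_univ hg.differentiableOn) (fun p _ => h p) (Set.mem_univ q) hq u trivial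

theorem periodic_int {f : ℂ → ℂ} {p : ℂ} (h : ∀ u, f (u + p) = f u) (n : ℤ) (u : ℂ) : f (u + n * p) = f u := by
  have : Function.Periodic f p := h
  simpa [mul_comm] using this.int_mul n u

theorem lattice_coords {τ : ℂ} (hτ : 0 < τ.im) (u : ℂ) : ∃ s t : ℝ, u = s + t * τ := by
  refine ⟨u.re - u.im / τ.im * τ.re, u.im / τ.im, ?_⟩
  apply Complex.ext
  · simp
  · simp; field_simp

theorem doubly_const {τ : ℂ} (hτ : 0 < τ.im) {h : ℂ → ℂ} (hd : Differentiable ℂ h) (h1 : ∀ u, h (u + 1) = h u)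
    (h2 : ∀ u, h (u + τ) = h u) (u v : ℂ) : h u = h v := by
  apply hd.apply_eq_apply_of_bounded
  have hc : IsCompact (Set.image (fun x : ℝ × ℝ => (x.1 : ℂ) + x.2 * τ) (Set.Icc 0 1 ×ˢ Set.Icc 0 1)) :=
    (isCompact_Icc.prod isCompact_Icc).image (by fun_prop)
  have hb := (hc.image hd.continuous).isBounded
  refine hb.subset ?_
  rintro _ ⟨u, rfl⟩
  obtain ⟨s, t, rfl⟩ := lattice_coords hτ u
  refine ⟨(Int.fract s : ℝ) + (Int.fract t : ℝ) * τ, ⟨(Int.fract s, Int.fract t), ⟨⟨Int.fract_nonneg _, (Int.fract_lt_one _).le⟩,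
    ⟨Int.fract_nonneg _, (Int.fract_lt_one _).le⟩⟩, rfl⟩, ?_⟩
  rw [← periodic_int h1 ⌊s⌋, ← periodic_int h2 ⌊t⌋]
  congr 1
  have e1 : (s : ℂ) = (⌊s⌋ : ℤ) + ((Int.fract s : ℝ) : ℂ) := by exact_mod_cast (Int.floor_add_fract s).symm
  have e2 : (t : ℂ) = (⌊t⌋ : ℤ) + ((Int.fract t : ℝ) : ℂ) := by exact_mod_cast (Int.floor_add_fract t).symm
  linear_combination -e1 - τ * e2

theorem sign_exp (n : ℤ) : Complex.exp (-(Real.pi * I * n)) = (-1) ^ n := by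
  rw [← Complex.exp_pi_mul_I, ← Complex.exp_int_mul, ← Complex.exp_periodic.int_mul n]
  congr 1
  ring

theorem odd_sign {a c : ℤ} (h : Odd (a + c + a * c)) : ((-1:ℂ)) ^ a * (-1) ^ c * (-1) ^ (a * c) = -1 := by
  rw [← zpow_add₀ (by norm_num), ← zpow_add₀ (by norm_num), h.neg_one_zpow]

theorem th_mod {a b c d : ℤ} (h : a * d - b * c = 1) {τ : ℂ} (hτ : 0 < τ.im) (u : ℂ) :
    th (((a : ℂ) * τ + b) / ((c : ℂ) * τ + d)) (u / ((c : ℂ) * τ + d)) =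
      ((c : ℂ) * τ + d)⁻¹ * Complex.exp (Real.pi * I * c * u ^ 2 / ((c : ℂ) * τ + d)) * th τ u := by
  have hj := den_ne h hτ
  have hτ' := im_mob h hτ
  set j := (c : ℂ) * τ + d with hjd
  set τ' := ((a : ℂ) * τ + b) / j with hτd
  have hdet : (a : ℂ) * d - b * c = 1 := by exact_mod_cast h
  have e1 : 1 / j = a - c * τ' := by rw [hτd]; field_simp; rw [hjd]; linear_combination -hdet
  have e2 : τ / j = d * τ' - b := by rw [hτd]; field_simp; rw [hjd]; linear_combination (-τ) * hdet
  have e3 : j * τ' = a * τ + b := by rw [hτd]; field_simp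
  have odd1 : Odd (a + c + a * c) := by
    have : Odd (a * d - b * c) := by rw [h]; exact odd_one
    simp only [← Int.not_even_iff_odd, Int.even_add, Int.even_mul, Int.even_sub] at this ⊢
    tauto
  have odd2 : Odd (d + b + d * b) := by
    have : Odd (a * d - b * c) := by rw [h]; exact odd_one
    simp only [← Int.not_even_iff_odd, Int.even_add, Int.even_mul, Int.even_sub] at this ⊢
    tauto
  let G : ℂ → ℂ := fun u => th τ' (u / j) * Complex.exp (-(Real.pi * I * c * u ^ 2 / j))
  have hG : Differentiable ℂ G := by
    refine Differentiable.mul ?_ (by fun_prop)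
    exact (th_diff hτ').comp (f := fun u => u / j) (by fun_prop)
  have hG1 : ∀ u, G (u + 1) = - G u := by
    intro u
    simp only [G]
    rw [show (u + 1) / j = u / j + ((-c : ℤ) : ℂ) * τ' + (a : ℤ) by push_cast; linear_combination e1, th_ell hτ']
    have hs := odd_sign odd1
    rw [← sign_exp (a * c)] at hs
    have : Complex.exp (-(Real.pi * I * (((-c:ℤ):ℂ) ^ 2 * τ' + 2 * ((-c : ℤ):ℂ) * (u / j)))) * Complex.exp (-(Real.pi * I * c * (u + 1) ^ 2 / j))
        = Complex.exp (-(Real.pi * I * ((a * c : ℤ) : ℂ))) * Complex.exp (-(Real.pi * I * c * u ^ 2 / j)) := by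
      rw [← Complex.exp_add, ← Complex.exp_add]
      congr 1
      push_cast
      linear_combination (-(Real.pi * I * c)) * e1
    have h3 : ((-1:ℂ)) ^ (-c) = (-1) ^ c := by
      rw [← _root_.inv_zpow', show ((-1:ℂ))⁻¹ = -1 by norm_num]
    rw [h3]
    linear_combination ((-1)^c * (-1)^a * th τ' (u/j)) * this + th τ' (u/j) * Complex.exp (-(Real.pi * I * c * u ^ 2 / j)) * hs
  have hG2 : ∀ u, G (u + τ) = - Complex.exp (-(Real.pi * I * (τ + 2 * u))) * G u := by
    intro u
    simp only [G]
    rw [show (u + τ) / j = u / j + ((d : ℤ) : ℂ) * τ' + (-b : ℤ) by push_cast; linear_combination e2, th_ell hτ']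
    have hs := odd_sign odd2
    rw [← sign_exp (d * b)] at hs
    have : Complex.exp (-(Real.pi * I * (((d:ℤ):ℂ) ^ 2 * τ' + 2 * ((d : ℤ):ℂ) * (u / j)))) * Complex.exp (-(Real.pi * I * c * (u + τ) ^ 2 / j))
        = Complex.exp (-(Real.pi * I * ((d * b : ℤ) : ℂ))) * Complex.exp (-(Real.pi * I * (τ + 2 * u))) * Complex.exp (-(Real.pi * I * c * u ^ 2 / j)) := by
      rw [← Complex.exp_add, ← Complex.exp_add, ← Complex.exp_add]
      congr 1
      push_cast
      have e4 : d * (u / j) + c * τ * (u / j) = u := by field_simp; rw [hjd]; ring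
      have e5 : (d:ℂ)^2 * τ' + c * τ * (τ / j) = τ + d * b := by
        rw [e2]
        linear_combination (d:ℂ) * e3 + τ * hdet + (d * τ') * hjd * (-1)
      linear_combination (-(Real.pi * I)) * e5 - 2 * Real.pi * I * e4
    have h3 : ((-1:ℂ)) ^ (-b) = (-1) ^ b := by
      rw [← _root_.inv_zpow', show ((-1:ℂ))⁻¹ = -1 by norm_num]
    rw [h3]
    linear_combination ((-1)^d * (-1)^b * th τ' (u/j)) * this + th τ' (u/j) * Complex.exp (-(Real.pi * I * (τ + 2 * u))) * Complex.exp (-(Real.pi * I * c * u ^ 2 / j)) * hs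
  have hv : ∀ u, th τ u = 0 → G u = 0 := by
    intro u hu
    obtain ⟨m, n, rfl⟩ := th_zeros hτ hu
    simp only [G]
    rw [show ((m:ℂ) * τ + n) / j = ((m * d - n * c : ℤ) : ℂ) * τ' + ((n * a - m * b : ℤ) : ℂ) by
      push_cast; linear_combination m * e2 + n * e1, th_latt hτ', zero_mul]
  let H := quo G (th τ)
  have hH : Differentiable ℂ H := quo_diff hG (th_diff hτ) hv (fun u hu => th_simple hτ hu)
  have hGH : ∀ u, G u = H u * th τ u := quo_mul hv
  obtain ⟨u0, hu0⟩ : ∃ u0, th τ u0 ≠ 0 := by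
    by_contra hc
    push Not at hc
    have := (th_deriv0 hτ).deriv
    rw [show th τ = fun _ => 0 from funext hc] at this
    simp at this
  have p1 : ∀ u, H (u + 1) = H u := by
    intro u
    have := entire_noZeroDiv (th_diff hτ) (g := fun u => H (u + 1) - H u)
      ((hH.comp (f := fun u => u + 1) (by fun_prop)).sub hH) (fun u => by
        have h1 := hGH (u + 1)
        rw [hG1, hGH u, th_add_one hτ] at h1
        linear_combination h1) hu0 u
    exact sub_eq_zero.1 this
  have p2 : ∀ u, H (u + τ) = H u := by
    intro u
    have := entire_noZeroDiv (th_diff hτ) (g := fun u => H (u + τ) - H u)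
      ((hH.comp (f := fun u => u + τ) (by fun_prop)).sub hH) (fun u => by
        have h1 := hGH (u + τ)
        rw [hG2, hGH u, th_add_tau hτ] at h1
        apply mul_left_cancel₀ (Complex.exp_ne_zero (-(Real.pi * I * (τ + 2 * u))))
        linear_combination h1) hu0 u
    exact sub_eq_zero.1 this
  have hc : ∀ u, H u = H 0 := fun u => doubly_const hτ hH p1 p2 u 0
  have d1 : HasDerivAt G (2 * Real.pi * I / j) 0 := by
    have a1 : HasDerivAt (fun u => th τ' (u / j)) (2 * Real.pi * I / j) 0 := by
      have := HasDerivAt.comp (h := fun u : ℂ => u / j) (h₂ := th τ') (0:ℂ) (h' := 1 / j) (by simpa using th_deriv0 hτ') ((hasDerivAt_id (0:ℂ)).div_const j)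
      refine HasDerivAt.congr_deriv this ?_
      ring
    have a2 : DifferentiableAt ℂ (fun u : ℂ => Complex.exp (-(Real.pi * I * c * u ^ 2 / j))) 0 := by fun_prop
    refine HasDerivAt.congr_deriv (a1.mul a2.hasDerivAt) ?_
    simp [th_zero hτ']
  have d2 : HasDerivAt G (H 0 * (2 * Real.pi * I)) 0 := by
    refine ((th_deriv0 hτ).const_mul (H 0)).congr_of_eventuallyEq (Filter.Eventually.of_forall fun u => ?_)
    rw [hGH u, hc u]
  have hH0 : H 0 = j⁻¹ := by
    have := d1.unique d2
    apply mul_right_cancel₀ Complex.two_pi_I_ne_zero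
    rw [← this]; field_simp
  have fin := hGH u
  rw [hc u, hH0] at fin
  simp only [G] at fin
  rw [mul_right_comm, ← fin, mul_assoc, ← Complex.exp_add]
  simp

end E8J
end ModD

section ModEe
open scoped Manifold
set_option linter.unusedVariables false
set_option linter.unusedSimpArgs false
namespace E8J

abbrev L8 := Fin 8 → ℤ
def pc (v w : V8) : ℂ := pairC E8Gram v w

theorem pc_def (v w : V8) : pc v w = ∑ i, ∑ j, v i * (E8Gram i j : ℂ) * w j := rfl
theorem pc_add_right (v w w' : V8) : pc v (w + w') = pc v w + pc v w' := by
  simp only [pc_def, Pi.add_apply, mul_add, Finset.sum_add_distrib]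
theorem pc_smul_right (v w : V8) (c : ℂ) : pc v (c • w) = c * pc v w := by
  simp only [pc_def, Pi.smul_apply, smul_eq_mul, Finset.mul_sum]
  exact Finset.sum_congr rfl fun i _ => Finset.sum_congr rfl fun j _ => by ring
theorem E8Gram_symm (i j : Fin 8) : E8Gram i j = E8Gram j i := by
  fin_cases i <;> fin_cases j <;> rfl
theorem pc_symm (v w : V8) : pc v w = pc w v := by
  simp only [pc_def]
  rw [Finset.sum_comm]
  exact Finset.sum_congr rfl fun i _ => Finset.sum_congr rfl fun j _ => by rw [E8Gram_symm]; ring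
theorem pc_add_left (v v' w : V8) : pc (v + v') w = pc v w + pc v' w := by
  rw [pc_symm, pc_add_right, pc_symm w, pc_symm w]
theorem pc_smul_left (v w : V8) (c : ℂ) : pc (c • v) w = c * pc v w := by
  rw [pc_symm, pc_smul_right, pc_symm w]
theorem pc_neg_right (v w : V8) : pc v (-w) = - pc v w := by
  rw [← neg_one_smul ℂ w, pc_smul_right]; ring
theorem pc_sub_right (v w w' : V8) : pc v (w - w') = pc v w - pc v w' := by
  rw [sub_eq_add_neg, pc_add_right, pc_neg_right]; ring
theorem pc_int (x y : L8) : pc (zc x) (zc y) = (pairE8 x y : ℂ) := by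
  simp only [pc_def, pairE8, zc]; push_cast; rfl
theorem pc_zero_right (v : V8) : pc v 0 = 0 := by simp [pc_def]

def pcL (v : V8) : V8 →L[ℂ] ℂ := LinearMap.toContinuousLinearMap
  { toFun := pc v, map_add' := pc_add_right v, map_smul' := fun c w => pc_smul_right v w c }
theorem pcL_apply (v w : V8) : pcL v w = pc v w := rfl

theorem shift_eq (z : V8) (x y : L8) (τ : ℂ) : (fun i => z i + (x i : ℂ) * τ + (y i : ℂ)) = z + τ • zc x + zc y := by
  funext i; simp [zc, mul_comm]
theorem div_eq_smul (z : V8) (j : ℂ) : (fun i => z i / j) = j⁻¹ • z := by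
  funext i; simp [div_eq_inv_mul]

theorem HolD.fix {f : Fn} (hf : HolD f) {τ : ℂ} (hτ : 0 < τ.im) : Hol Set.univ (f τ) := by
  have := Hol.compAffine (V := Set.univ) hf (ContinuousLinearMap.inr ℂ ℂ V8) (τ, 0) (by
    intro p _; simpa [D] using hτ)
  simpa [unc] using this
theorem HolD.cont {f : Fn} (hf : HolD f) {τ : ℂ} (hτ : 0 < τ.im) : Continuous (f τ) :=
  continuousOn_univ.1 (hf.fix hτ).1

theorem pc_hol : Hol (Set.univ : Set V8) (fun z => pc z z) := by
  refine holOfDiff isOpen_univ ?_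
  simp only [pc_def]
  fun_prop

/-- theta function attached to a lattice vector -/
def thr (r : L8) : Fn := fun τ z => th τ (pc (zc r) z)

theorem thr_hol (r : L8) : HolD (thr r) := by
  have := Hol.compAffine (V := D) th_hol ((ContinuousLinearMap.fst ℂ ℂ V8).prod ((pcL (zc r)).comp (ContinuousLinearMap.snd ℂ ℂ V8))) 0
    (by intro p hp; simpa [D1, D] using hp)
  simp only [add_zero] at this
  exact this

theorem thr_lim (r : L8) (z0 : V8) : Filter.Tendsto (unc (thr r)) (Iinf ×ˢ nhds z0) (nhds (E1 (pc (zc r) z0))) := by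
  refine (th_lim (pc (zc r) z0)).comp (g := fun p : ℂ × ℂ => th p.1 p.2) (f := fun p : ℂ × V8 => (p.1, pc (zc r) p.2)) ?_
  exact Filter.tendsto_id.prodMap ((pcL (zc r)).continuous.tendsto z0)

theorem thr_bd (r : L8) : Bd (thr r) := fun z0 => ((thr_lim r z0).isBigO_one ℝ)

theorem thr_ell (r x y : L8) {τ : ℂ} (hτ : 0 < τ.im) (z : V8) :
    thr r τ (z + τ • zc x + zc y) = (-1) ^ (pairE8 r x) * (-1) ^ (pairE8 r y) *
      Complex.exp (-(Real.pi * I * ((pc (zc r) (zc x)) ^ 2 * τ + 2 * (pc (zc r) (zc x)) * (pc (zc r) z)))) * thr r τ z := by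
  unfold thr
  rw [pc_add_right, pc_add_right, pc_smul_right, pc_int, pc_int, mul_comm τ, th_ell hτ]

theorem neg_one_even_prod {ι : Type*} (s : Finset ι) (n : ι → ℤ) (h : Even (∑ i ∈ s, n i)) : ∏ i ∈ s, ((-1:ℂ)) ^ (n i) = 1 := by
  have key : ∏ i ∈ s, ((-1:ℂ)) ^ (n i) = (-1) ^ (∑ i ∈ s, n i) := by
    classical
    clear h
    induction s using Finset.induction_on with
    | empty => simp
    | insert a s ha ih => rw [Finset.prod_insert ha, Finset.sum_insert ha, zpow_add₀ (by norm_num), ih]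
  rw [key, h.neg_one_zpow]

theorem even_E8 (x : L8) : Even (pairE8 x x) := by
  refine ⟨x 0 ^2 + x 1 ^2 + x 2 ^2 + x 3 ^2+ x 4 ^2+ x 5 ^2+ x 6 ^2+ x 7 ^2 - x 0 * x 1 - x 1 * x 2 - x 2 * x 3 - x 3 * x 4
    - x 4 * x 5 - x 5 * x 6 - x 4 * x 7, ?_⟩
  simp [pairE8, E8Gram, Fin.sum_univ_eight]
  ring

theorem thetaBlock {ι : Type*} (s : Finset ι) (r : ι → L8) (e : ι → ℕ) (T : ℤ)
    (h : ∀ z w : V8, ∑ i ∈ s, (e i : ℂ) * (pc (zc (r i)) z * pc (zc (r i)) w) = T * pc z w) :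
    JF (-(∑ i ∈ s, (e i : ℤ))) T (fun τ z => ∏ i ∈ s, thr (r i) τ z ^ e i) := by
  have hpar : ∀ x : L8, Even (∑ i ∈ s, pairE8 (r i) x * e i) := by
    intro x
    have h1 : ∑ i ∈ s, (e i : ℤ) * (pairE8 (r i) x * pairE8 (r i) x) = T * pairE8 x x := by
      have := h (zc x) (zc x)
      simp only [pc_int] at this
      exact_mod_cast this
    have h2 : Even (∑ i ∈ s, (e i : ℤ) * (pairE8 (r i) x * pairE8 (r i) x)) := by
      rw [h1]; exact (even_E8 x).mul_left T
    have h3 : Even (∑ i ∈ s, (e i : ℤ) * (pairE8 (r i) x * pairE8 (r i) x) - ∑ i ∈ s, pairE8 (r i) x * e i) := by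
      rw [← Finset.sum_sub_distrib]
      refine Finset.even_sum _ fun i _ => ?_
      have : Even (pairE8 (r i) x * (pairE8 (r i) x - 1)) := Int.even_mul_pred_self _
      have h5 := this.mul_left (e i : ℤ)
      rwa [show (e i : ℤ) * (pairE8 (r i) x * (pairE8 (r i) x - 1)) = (e i : ℤ) * (pairE8 (r i) x * pairE8 (r i) x) - pairE8 (r i) x * e i by ring] at h5
    have := h2.sub h3
    simpa using this
  refine ⟨Hol.prod _ fun i _ => (thr_hol (r i)).pow _, Bd.prod _ fun i _ => (thr_bd (r i)).pow _, ?_, ?_⟩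
  · intro a b c d hd τ hτ z
    have hj := den_ne hd hτ
    rw [div_eq_smul]
    have h1 : ∀ i ∈ s, thr (r i) (((a : ℂ) * τ + (b : ℂ)) / ((c : ℂ) * τ + (d : ℂ))) (((c : ℂ) * τ + (d : ℂ))⁻¹ • z) ^ e i =
        (((c : ℂ) * τ + (d : ℂ)) ^ (e i))⁻¹ * Complex.exp (Real.pi * I * c * (e i * (pc (zc (r i)) z * pc (zc (r i)) z)) / ((c : ℂ) * τ + (d : ℂ)))
          * thr (r i) τ z ^ e i := by
      intro i _
      unfold thr
      rw [pc_smul_right, ← div_eq_inv_mul, th_mod hd hτ, mul_pow, mul_pow, ← Complex.exp_nat_mul, inv_pow]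
      congr 3; ring
    rw [Finset.prod_congr rfl h1, Finset.prod_mul_distrib, Finset.prod_mul_distrib, ← Complex.exp_sum,
      ← Finset.sum_div, ← Finset.mul_sum, h z z, Finset.prod_inv_distrib, Finset.prod_pow_eq_pow_sum]
    rw [_root_.zpow_neg, ← Nat.cast_sum, zpow_natCast]
    congr 3
    simp only [pc]; ring
  · intro x y τ hτ z
    rw [shift_eq]
    have hs : ∀ (n : ℤ) (e : ℕ), (((-1:ℂ)) ^ n) ^ e = (-1) ^ (n * e) := by
      intro n e; rw [_root_.zpow_mul, zpow_natCast]
    simp only [thr_ell _ _ _ hτ]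
    simp only [mul_pow _ _ (e _), Finset.prod_mul_distrib, hs]
    rw [neg_one_even_prod s _ (hpar x), neg_one_even_prod s _ (hpar y)]
    simp only [← Complex.exp_nat_mul, ← Complex.exp_sum]
    rw [one_mul, one_mul]
    congr 2
    have e1 := h (zc x) (zc x)
    have e2 := h (zc x) z
    have : ∑ i ∈ s, ((e i : ℂ)) * -(Real.pi * I * ((pc (zc (r i)) (zc x)) ^ 2 * τ + 2 * (pc (zc (r i)) (zc x)) * (pc (zc (r i)) z)))
       = -(Real.pi * I * (τ * (∑ i ∈ s, (e i : ℂ) * (pc (zc (r i)) (zc x) * pc (zc (r i)) (zc x))) +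
        2 * ∑ i ∈ s, (e i : ℂ) * (pc (zc (r i)) (zc x) * pc (zc (r i)) z))) := by
      simp only [Finset.mul_sum, ← Finset.sum_add_distrib, ← Finset.sum_neg_distrib]
      exact Finset.sum_congr rfl fun i _ => by ring
    rw [this, e1, e2]
    simp only [pc]
    ring

theorem nonzero_circle {g : ℂ → ℂ} (hg : Differentiable ℂ g) {q : ℂ} (hq : g q ≠ 0) (u : ℂ) :
    ∃ ρ : ℝ, 0 < ρ ∧ ∀ w : ℂ, ‖w‖ = ρ → g (u + w) ≠ 0 := by
  have ha : AnalyticAt ℂ g u := hg.analyticAt u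
  rcases ha.eventually_eq_zero_or_eventually_ne_zero with h | h
  · exact absurd (eqZeroOfOpen isOpen_univ convex_univ (holOfDiff isOpen_univ hg.differentiableOn) (Set.mem_univ u) h q trivial) hq
  · rw [eventually_nhdsWithin_iff, Metric.eventually_nhds_iff] at h
    obtain ⟨ε, hε, h⟩ := h
    refine ⟨ε / 2, by positivity, fun w hw => h ?_ ?_⟩
    · simp [hw]; linarith
    · intro h0
      simp at h0
      subst h0
      simp at hw; linarith

theorem th_nonzero {τ : ℂ} (hτ : 0 < τ.im) : ∃ u0, th τ u0 ≠ 0 := by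
  by_contra hc
  push Not at hc
  have := (th_deriv0 hτ).deriv
  rw [show th τ = fun _ => 0 from funext hc] at this
  simp at this

theorem E1_nonzero : E1 (1/2) ≠ 0 := by
  rw [E1_eq']
  have : qx (1/2) = -1 := by
    rw [qx, ← Complex.exp_pi_mul_I]; congr 1; ring
  rw [this]
  simp [Complex.exp_ne_zero]

end E8J
end ModEe

section ModFf
open scoped Manifold
set_option linter.unusedVariables false
set_option linter.unusedSimpArgs false
namespace E8J

theorem quo_shift (F G : ℂ → ℂ) (w : ℂ) : quo (fun s => F (w + s)) (fun s => G (w + s)) 0 = quo F G w := by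
  simp [quo, deriv_comp_const_add]

theorem maxmod {H : ℂ → ℂ} (hH : Differentiable ℂ H) {ρ C : ℝ} (hρ : 0 < ρ) (h : ∀ w, ‖w‖ = ρ → ‖H w‖ ≤ C) (w : ℂ) (hw : ‖w‖ ≤ ρ) : ‖H w‖ ≤ C := by
  refine Complex.norm_le_of_forall_mem_frontier_norm_le (U := Metric.ball 0 ρ) Metric.isBounded_ball
    hH.diffContOnCl (fun z hz => ?_) ?_
  · rw [frontier_ball _ hρ.ne'] at hz
    exact h z (by simpa using hz)
  · rw [closure_ball _ hρ.ne']; simpa using hw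

theorem E1_diff : Differentiable ℂ E1 := by
  unfold E1; fun_prop

theorem thr_line (r : L8) (v z : V8) (hv : pc (zc r) v = 1) (τ w : ℂ) : thr r τ (z + w • v) = th τ (pc (zc r) z + w) := by
  simp [thr, pc_add_right, pc_smul_right, hv]

def hquo (f : Fn) (r : L8) (v : V8) : Fn := fun τ z => quo (fun w => f τ (z + w • v)) (fun w => th τ (pc (zc r) z + w)) 0

theorem hquo_line {f : Fn} {r : L8} {v : V8} (hv : pc (zc r) v = 1) (τ : ℂ) (z : V8) : (fun w : ℂ => hquo f r v τ (z + w • v)) =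
    quo (fun w => f τ (z + w • v)) (fun w => th τ (pc (zc r) z + w)) := by
  funext w
  rw [← quo_shift, hquo]
  congr 1
  · funext s; rw [add_smul, add_assoc]
  · funext s; rw [pc_add_right, pc_smul_right, hv]; congr 1; ring

theorem hquo_diff {f : Fn} (hf : HolD f) {r : L8} {v : V8} (hv : pc (zc r) v = 1)
    (h0 : ∀ τ : ℂ, 0 < τ.im → ∀ z, thr r τ z = 0 → f τ z = 0) {τ : ℂ} (hτ : 0 < τ.im) (z : V8) : Differentiable ℂ (fun w : ℂ => hquo f r v τ (z + w • v)) := by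
  rw [hquo_line hv]
  refine quo_diff (hf.zline hτ z v) ((th_diff hτ).comp (by fun_prop)) ?_ ?_
  · intro u hu
    exact h0 τ hτ _ (by rw [thr_line r v z hv]; exact hu)
  · intro u hu
    rw [deriv_comp_const_add]
    exact th_simple hτ hu

theorem hquo_mul {f : Fn} {r : L8} {v : V8} (hv : pc (zc r) v = 1)
    (h0 : ∀ τ : ℂ, 0 < τ.im → ∀ z, thr r τ z = 0 → f τ z = 0) {τ : ℂ} (hτ : 0 < τ.im) (z : V8) : f τ z = hquo f r v τ z * thr r τ z := by
  have := quo_mul (f := fun w => f τ (z + w • v)) (g := fun w => th τ (pc (zc r) z + w)) (by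
    intro u hu
    exact h0 τ hτ _ (by rw [thr_line r v z hv]; exact hu)) 0
  simpa [hquo, thr] using this

theorem hquo_eq {f : Fn} {r : L8} {v : V8} (hv : pc (zc r) v = 1)
    (h0 : ∀ τ : ℂ, 0 < τ.im → ∀ z, thr r τ z = 0 → f τ z = 0) {τ : ℂ} (hτ : 0 < τ.im) (z : V8) (hz : thr r τ z ≠ 0) : hquo f r v τ z = f τ z / thr r τ z := by
  rw [eq_div_iff hz, ← hquo_mul hv h0 hτ]

theorem hquo_hol {f : Fn} (hf : HolD f) {r : L8} {v : V8} (hv : pc (zc r) v = 1)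
    (h0 : ∀ τ : ℂ, 0 < τ.im → ∀ z, thr r τ z = 0 → f τ z = 0) : HolD (hquo f r v) := by
  refine holLocal D_open fun p0 hp0 => ?_
  obtain ⟨τ0, z0⟩ := p0
  have hτ0 : 0 < τ0.im := hp0
  obtain ⟨q, hq⟩ := th_nonzero hτ0
  obtain ⟨ρ, hρ, hc⟩ := nonzero_circle (th_diff hτ0) hq (pc (zc r) z0)
  have hU : IsOpen (D ∩ (unc (thr r)) ⁻¹' {0}ᶜ) := (thr_hol r).1.isOpen_inter_preimage D_open isOpen_compl_singleton
  obtain ⟨V, hV, hpV, hVU⟩ := tubeExists hU (isCompact_sphere (0:ℂ) ρ) (τ0, z0) ((0:ℂ), v) (by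
    intro w hw
    refine ⟨by simpa [D] using hτ0, ?_⟩
    have := hc w (by simpa using hw)
    simpa [unc, thr_line r v z0 hv] using this)
  refine ⟨V ∩ D, hV.inter D_open, ⟨hpV, hp0⟩, ?_⟩
  have hG : Hol (D ∩ (unc (thr r)) ⁻¹' {0}ᶜ) (fun p => unc f p / unc (thr r) p) :=
    Hol.div (hf.mono Set.inter_subset_left) ((thr_hol r).mono Set.inter_subset_left) (fun p hp => hp.2)
  have h1 := (Hol.const ((2 * Real.pi * I)⁻¹)).mul (holCircle hU (hV.inter D_open) hG (-1) hρ ((0:ℂ), v) (fun p hp w hw => hVU p hp.1 w (by simpa using hw)))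
  refine Hol.congr (hV.inter D_open) h1 ?_
  rintro ⟨τ, z⟩ ⟨hpv, hpd⟩
  have hτ : 0 < τ.im := hpd
  have h2 := (hquo_diff hf hv h0 hτ z).diffContOnCl (s := Metric.ball 0 ρ)
  have h3 := h2.two_pi_i_inv_smul_circleIntegral_sub_inv_smul (w := 0) (by simpa using hρ)
  simp only [sub_zero, smul_eq_mul, zero_smul, add_zero] at h3
  show hquo f r v τ z = _
  rw [← h3]
  congr 1
  refine circleIntegral.integral_congr hρ.le fun w hw => ?_
  have h4 := (hVU _ hpv w hw).2
  simp only [Prod.mk_add_mk, Prod.smul_mk, smul_zero, add_zero, unc, Set.mem_preimage, Set.mem_compl_iff, Set.mem_singleton_iff] at h4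
  simp only [Prod.mk_add_mk, Prod.smul_mk, smul_zero, add_zero, unc, _root_.zpow_neg_one]
  rw [hquo_eq hv h0 hτ _ h4]

def PB (f : Fn) (r : L8) (v z0 : V8) (s : Set ℂ) : Prop := ∃ C : ℝ, ∀ᶠ p in Iinf ×ˢ nhds z0, ∀ w ∈ s,
      thr r p.1 (p.2 + w • v) ≠ 0 ∧ ‖f p.1 (p.2 + w • v) / thr r p.1 (p.2 + w • v)‖ ≤ C

theorem hquo_bd {f : Fn} (hf : HolD f) {r : L8} {v : V8} (hv : pc (zc r) v = 1)
    (h0 : ∀ τ : ℂ, 0 < τ.im → ∀ z, thr r τ z = 0 → f τ z = 0) (hb : Bd f) : Bd (hquo f r v) := by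
  intro z0
  obtain ⟨ρ, hρ, hc⟩ := nonzero_circle E1_diff E1_nonzero (pc (zc r) z0)
  have key : PB f r v z0 (Metric.sphere (0:ℂ) ρ) := by
    refine IsCompact.induction_on (isCompact_sphere (0:ℂ) ρ) (p := PB f r v z0) ?_ ?_ ?_ ?_
    · exact ⟨0, by simp⟩
    · rintro s t hst ⟨C, hC⟩
      exact ⟨C, hC.mono fun p hp w hw => hp w (hst hw)⟩
    · rintro s t ⟨C, hC⟩ ⟨C', hC'⟩
      refine ⟨max C C', ?_⟩
      filter_upwards [hC, hC'] with p h1 h2 w hw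
      rcases hw with hw | hw
      · exact ⟨(h1 w hw).1, (h1 w hw).2.trans (le_max_left _ _)⟩
      · exact ⟨(h2 w hw).1, (h2 w hw).2.trans (le_max_right _ _)⟩
    · intro x hx
      have hx0 := hc x (by simpa using hx)
      have hlim := thr_lim r (z0 + x • v)
      rw [pc_add_right, pc_smul_right, hv, mul_one] at hlim
      have hne := hlim.eventually_ne hx0
      have hO := (hb (z0 + x • v)).mul ((hlim.inv₀ hx0).isBigO_one ℝ)
      obtain ⟨C, hC⟩ := hO.bound
      have hmap : Filter.Tendsto (fun y : (ℂ × V8) × ℂ => (y.1.1, y.1.2 + y.2 • v)) ((Iinf ×ˢ nhds z0) ×ˢ nhds x)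
          (Iinf ×ˢ nhds (z0 + x • v)) := by
        refine Filter.Tendsto.prodMk (Filter.tendsto_fst.comp Filter.tendsto_fst) ?_
        exact (Filter.tendsto_snd.comp Filter.tendsto_fst).add (Filter.tendsto_snd.smul tendsto_const_nhds)
      obtain ⟨pa, ha, pb, hpb, hab⟩ := Filter.eventually_prod_iff.1 (hmap.eventually (hne.and hC))
      refine ⟨{w | pb w}, mem_nhdsWithin_of_mem_nhds hpb, C, ?_⟩
      filter_upwards [ha] with p hp w hw
      have := hab hp hw
      refine ⟨this.1, ?_⟩
      have h2 := this.2
      simpa [unc, div_eq_mul_inv] using h2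
  obtain ⟨C, hC⟩ := key
  refine Asymptotics.IsBigO.of_bound C ?_
  filter_upwards [hC, Filter.Eventually.prod_inl Iinf_pos (nhds z0)] with p h1 hτ
  have := maxmod (C := C) (hquo_diff hf hv h0 hτ p.2) hρ (by
    intro w hw
    have := h1 w (by simpa using hw)
    rw [hquo_eq hv h0 hτ _ this.1]
    exact this.2) 0 (by simpa using hρ.le)
  simpa [unc] using this

/-- quotients of Jacobi forms -/
theorem JF.quot {k k' t t' : ℤ} {f P h : Fn} (hf : JF k t f) (hP : JF k' t' P) (hh : HolD h) (hb : Bd h)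
    (e : ∀ τ : ℂ, 0 < τ.im → ∀ z, f τ z = h τ z * P τ z) (hn : ∀ τ : ℂ, 0 < τ.im → ∃ z, P τ z ≠ 0) :
    JF (k - k') (t - t') h := by
  have canc : ∀ τ : ℂ, 0 < τ.im → ∀ G : V8 → ℂ, Hol Set.univ G → (∀ z, P τ z * G z = 0) → ∀ z, G z = 0 := by
    intro τ hτ G hG h1 z
    obtain ⟨q, hq⟩ := hn τ hτ
    exact noZeroDiv isOpen_univ convex_univ (hP.hol.fix hτ) hG (fun p _ => h1 p) (Set.mem_univ q) hq z trivial
  refine ⟨hh, hb, fun a b c d hd τ hτ z => ?_, fun x y τ hτ z => ?_⟩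
  · have hj := den_ne hd hτ
    set j := (c : ℂ) * τ + (d : ℂ) with hjd
    set τ' := ((a : ℂ) * τ + (b : ℂ)) / j with hτd
    have hτ' : 0 < τ'.im := im_mob hd hτ
    have := canc τ hτ (fun z => h τ' (j⁻¹ • z) - j ^ (k - k') *
        Complex.exp (((t - t' : ℤ) : ℂ) * (Real.pi : ℂ) * Complex.I * (c : ℂ) * pairC E8Gram z z / j) * h τ z) ?_ ?_ z
    · simpa [div_eq_smul, sub_eq_zero] using this
    · refine Hol.sub ?_ (Hol.mul (Hol.mul (Hol.const _) (Hol.cexp ?_)) (hh.fix hτ))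
      · have := Hol.compAffine (V := Set.univ) (hh.fix hτ') ((j⁻¹ : ℂ) • ContinuousLinearMap.id ℂ V8) 0 (by simp)
        simpa using this
      · have := Hol.mul (Hol.const (((t - t' : ℤ) : ℂ) * (Real.pi : ℂ) * Complex.I * (c : ℂ) * j⁻¹)) pc_hol
        convert this using 2
        simp only [pc]; ring
    · intro z
      have h1 := hf.mod a b c d hd τ hτ z
      have h2 := hP.mod a b c d hd τ hτ z
      rw [← hjd, ← hτd, div_eq_smul] at h1 h2
      rw [e _ hτ', h2, e _ hτ] at h1
      set X := pairC E8Gram z z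
      have e1 : Complex.exp ((t : ℂ) * (Real.pi : ℂ) * Complex.I * (c : ℂ) * X / j) =
        Complex.exp (((t - t' : ℤ) : ℂ) * (Real.pi : ℂ) * Complex.I * (c : ℂ) * X / j) *
          Complex.exp ((t' : ℂ) * (Real.pi : ℂ) * Complex.I * (c : ℂ) * X / j) := by
        rw [← Complex.exp_add]; congr 1; push_cast; ring
      have e2 : j ^ k = j ^ (k - k') * j ^ k' := by rw [← zpow_add₀ hj]; congr 1; ring
      rw [e1, e2] at h1
      have n1 := Complex.exp_ne_zero ((t' : ℂ) * (Real.pi : ℂ) * Complex.I * (c : ℂ) * X / j)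
      have n2 : j ^ k' ≠ 0 := zpow_ne_zero _ hj
      apply mul_left_cancel₀ (mul_ne_zero n1 n2)
      linear_combination h1
  · rw [shift_eq]
    have := canc τ hτ (fun z => h τ (z + τ • zc x + zc y) -
        Complex.exp (-((t - t' : ℤ) : ℂ) * (Real.pi : ℂ) * Complex.I * (pairC E8Gram (zc x) (zc x) * τ + 2 * pairC E8Gram (zc x) z)) * h τ z) ?_ ?_ z
    · simpa [sub_eq_zero] using this
    · refine Hol.sub ?_ (Hol.mul (Hol.cexp ?_) (hh.fix hτ))
      · have := Hol.compAffine (V := Set.univ) (hh.fix hτ) (ContinuousLinearMap.id ℂ V8) (τ • zc x + zc y) (by simp)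
        simpa [add_assoc] using this
      · refine holOfDiff isOpen_univ ?_
        simp only [pairC]
        fun_prop
    · intro z
      have h1 := hf.ell x y τ hτ z
      have h2 := hP.ell x y τ hτ z
      rw [shift_eq] at h1 h2
      rw [e _ hτ, h2, e _ hτ] at h1
      set X := (pairC E8Gram (zc x) (zc x) * τ + 2 * pairC E8Gram (zc x) z)
      have e1 : Complex.exp (-(t : ℂ) * (Real.pi : ℂ) * Complex.I * X) =
        Complex.exp (-((t - t' : ℤ) : ℂ) * (Real.pi : ℂ) * Complex.I * X) *
          Complex.exp (-(t' : ℂ) * (Real.pi : ℂ) * Complex.I * X) := by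
        rw [← Complex.exp_add]; congr 1; push_cast; ring
      rw [e1] at h1
      have n1 := Complex.exp_ne_zero (-(t' : ℂ) * (Real.pi : ℂ) * Complex.I * X)
      apply mul_left_cancel₀ n1
      linear_combination h1

end E8J
end ModFf

section ModFg
open scoped Manifold
set_option linter.unusedVariables false
set_option linter.unusedSimpArgs false
namespace E8J

def refl (r : L8) (z : V8) : V8 := z - pc (zc r) z • zc r
def Anti (f : Fn) : Prop := ∀ r : L8, pairE8 r r = 2 → ∀ τ : ℂ, 0 < τ.im → ∀ z, f τ (refl r z) = - f τ z
def Inv (f : Fn) : Prop := ∀ r : L8, pairE8 r r = 2 → ∀ τ : ℂ, 0 < τ.im → ∀ z, f τ (refl r z) = f τ z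
/-- `f` vanishes on the mirrors of `r` -/
def Van (f : Fn) (r : L8) : Prop := ∀ τ : ℂ, 0 < τ.im → ∀ z, thr r τ z = 0 → f τ z = 0

theorem zc_smul (n : ℤ) (r : L8) : zc (n • r) = (n : ℂ) • zc r := by
  funext i; simp [zc]

theorem JF.van {k t : ℤ} {f : Fn} (hf : JF k t f) (ha : Anti f) {r : L8} (hr : pairE8 r r = 2) : Van f r := by
  intro τ hτ z h
  obtain ⟨a, b, hab⟩ := th_zeros hτ h
  have h1 := hf.ell ((-a) • r) ((-b) • r) τ hτ z
  have h2 := ha r hr τ hτ z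
  rw [shift_eq] at h1
  have e1 : z + τ • zc ((-a) • r) + zc ((-b) • r) = refl r z := by
    rw [refl, hab, zc_smul, zc_smul]; push_cast; module
  have e2 : pairC E8Gram (zc ((-a) • r)) (zc ((-a) • r)) = 2 * (a:ℂ) ^ 2 := by
    change pc _ _ = _
    rw [zc_smul, pc_smul_left, pc_smul_right, pc_int, hr]; push_cast; ring
  have e3 : pairC E8Gram (zc ((-a) • r)) z = - a * (a * τ + b) := by
    change pc _ _ = _
    rw [zc_smul, pc_smul_left, hab]; push_cast; ring
  rw [e1, e2, e3, h2] at h1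
  have e4 : Complex.exp (-(t : ℂ) * Real.pi * I * (2 * (a:ℂ) ^ 2 * τ + 2 * (-a * (a * τ + b)))) = 1 := by
    rw [Complex.exp_eq_one_iff]
    exact ⟨t * a * b, by push_cast; ring⟩
  rw [e4, one_mul] at h1
  linear_combination (-1/2) * h1

theorem strip1 {h : Fn} (hh : HolD h) {a r : L8} (ha : pairE8 a a = 2) (hr : pairE8 r r = 2) (har : (pairE8 a r) ^ 2 ≠ 4)
    (hv : Van (fun τ z => h τ z * thr r τ z) a) : Van h a := by
  intro τ hτ z hz
  set n : ℤ := pairE8 a r with hn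
  let u : V8 := (2:ℂ) • zc r - (n:ℂ) • zc a
  have h1 : pc (zc a) u = 0 := by
    simp only [u]; rw [pc_sub_right, pc_smul_right, pc_smul_right, pc_int, pc_int, ha, ← hn]; push_cast; ring
  have h2 : pc (zc r) u = 4 - (n:ℂ)^2 := by
    simp only [u]; rw [pc_sub_right, pc_smul_right, pc_smul_right, pc_symm (zc r) (zc a), pc_int, pc_int, hr, ← hn]; push_cast; ring
  have h3 : pc (zc r) u ≠ 0 := by
    rw [h2, sub_ne_zero]; intro h; exact har (by exact_mod_cast h.symm)
  obtain ⟨u0, hu0⟩ := th_nonzero hτ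
  have := entire_noZeroDiv (thr_hol r |>.zline hτ z u) (hh.zline hτ z u) (fun w => by
      have := hv τ hτ (z + w • u) (by
        unfold thr at hz ⊢
        rw [pc_add_right, pc_smul_right, h1, mul_zero, add_zero, hz])
      simp only at this
      rw [mul_comm]; exact this) (q := (u0 - pc (zc r) z) / pc (zc r) u) (by
        unfold thr
        rw [pc_add_right, pc_smul_right, div_mul_cancel₀ _ h3]
        simpa using hu0) 0
  simpa using this

theorem strip (t : Finset L8) {a : L8} (ha : pairE8 a a = 2) (ht : ∀ r ∈ t, pairE8 r r = 2 ∧ (pairE8 a r) ^ 2 ≠ 4) :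
    ∀ h : Fn, HolD h → Van (fun τ z => h τ z * ∏ r ∈ t, thr r τ z) a → Van h a := by
  induction t using Finset.induction_on with
  | empty => intro h hh hv; simpa using hv
  | insert r t hrt ih =>
    intro h hh hv
    refine strip1 hh ha (ht r (by simp)).1 (ht r (by simp)).2 ?_
    refine ih (fun r hr => ht r (by simp [hr])) _ (Hol.mul hh (thr_hol r)) ?_
    intro τ hτ z hz
    have := hv τ hτ z hz
    simp only [Finset.prod_insert hrt] at this
    simp only [mul_assoc]; exact this

theorem divideAll (s : Finset L8) (hs : ∀ r ∈ s, pairE8 r r = 2) (hp : ∀ a ∈ s, ∀ r ∈ s, a ≠ r → (pairE8 a r) ^ 2 ≠ 4)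
    {f : Fn} (hf : HolD f) (hb : Bd f) (h0 : ∀ r ∈ s, Van f r) :
    ∃ h : Fn, HolD h ∧ Bd h ∧ ∀ τ : ℂ, 0 < τ.im → ∀ z, f τ z = h τ z * ∏ r ∈ s, thr r τ z := by
  induction s using Finset.induction_on with
  | empty => exact ⟨f, hf, hb, by simp⟩
  | insert a s has ih =>
    obtain ⟨h, hh, hhb, e⟩ := ih (fun r hr => hs r (by simp [hr])) (fun a ha r hr => hp a (by simp [ha]) r (by simp [hr]))
      (fun r hr => h0 r (by simp [hr]))
    have ha2 := hs a (by simp)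
    have hv : Van h a := by
      refine strip s ha2 (fun r hr => ⟨hs r (by simp [hr]), hp a (by simp) r (by simp [hr]) (by rintro rfl; exact has hr)⟩) h hh ?_
      intro τ hτ z hz
      simp only []
      rw [← e τ hτ z]; exact h0 a (by simp) τ hτ z hz
    have hv1 : pc (zc a) ((1/2 : ℂ) • zc a) = 1 := by
      rw [pc_smul_right, pc_int, ha2]; norm_num
    refine ⟨hquo h a ((1/2 : ℂ) • zc a), hquo_hol hh hv1 hv, hquo_bd hh hv1 hv hhb, fun τ hτ z => ?_⟩
    rw [e τ hτ z, hquo_mul hv1 hv hτ z, Finset.prod_insert has]; ring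

end E8J
end ModFg

section ModFj
open scoped Manifold
set_option linter.unusedVariables false
set_option linter.unusedSimpArgs false
namespace E8J

abbrev e8 (i : Fin 8) : V8 := Pi.single i 1

def jmat (m : Fin 9 → ℕ) (f : Fin 9 → Fn) (τ : ℂ) (z : V8) : Matrix (Fin 9) (Fin 9) ℂ :=
  Matrix.of fun i j => Fin.cases ((m j : ℂ) * f j τ z) (fun i' : Fin 8 => zdd (e8 i') (f j) τ z) i

theorem jac_eq (m : Fin 9 → ℕ) (f : Fin 9 → Fn) (τ : ℂ) (z : V8) : jacJacobian m f τ z = (jmat m f τ z).det := by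
  unfold jacJacobian jmat
  simp only [pderiv_eq]

def blk (a : Fin 8 → ℂ) (B : Matrix (Fin 8) (Fin 8) ℂ) : Matrix (Fin 9) (Fin 9) ℂ :=
  Matrix.of fun i k => Fin.cases (Fin.cases 1 (fun _ => 0) k) (fun i' : Fin 8 => Fin.cases (a i') (fun k' : Fin 8 => B i' k') k) i

theorem sum9 (g : Fin 9 → ℂ) : ∑ i, g i = g 0 + ∑ i : Fin 8, g i.succ := Fin.sum_univ_succ g

theorem blk_det (a : Fin 8 → ℂ) (B : Matrix (Fin 8) (Fin 8) ℂ) : (blk a B).det = B.det := by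
  rw [Matrix.det_succ_row_zero, Fin.sum_univ_succ]
  have : ((blk a B).submatrix Fin.succ (Fin.succAbove 0)) = B := by
    ext i j; simp [blk]
  rw [this]
  simp [blk]

theorem jacTrans (m : Fin 9 → ℕ) (f : Fin 9 → Fn) (hf : ∀ j, HolD (f j)) {τ τ' : ℂ} (hτ : 0 < τ.im) (hτ' : 0 < τ'.im)
    (B : Matrix (Fin 8) (Fin 8) ℂ) (b : V8) (A : V8 → ℂ) (hA : Hol Set.univ A) (c : Fin 9 → ℂ)
    (h : ∀ j z, f j τ' (B *ᵥ z + b) = c j * Complex.exp (m j * A z) * f j τ z) (z : V8) :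
    B.det * jacJacobian m f τ' (B *ᵥ z + b) = (∏ j, c j) * Complex.exp ((∑ j, (m j : ℂ)) * A z) * jacJacobian m f τ z := by
  have key : blk 0 Bᵀ * jmat m f τ' (B *ᵥ z + b) = blk (fun i => dd (e8 i) A z) 1 * (jmat m f τ z * Matrix.diagonal (fun j => c j * Complex.exp (m j * A z))) := by
    ext i j
    rw [Matrix.mul_apply, Matrix.mul_apply, sum9, sum9]
    simp only [Matrix.mul_diagonal]
    refine Fin.cases ?_ (fun i' => ?_) i
    · simp [blk, jmat, h]; ring
    · simp only [blk, jmat, Matrix.of_apply, Fin.cases_zero, Fin.cases_succ, Pi.zero_apply, zero_mul, zero_add, Matrix.transpose_apply]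
      have h1 : HasDerivAt (fun w : ℂ => f j τ' (B *ᵥ (z + w • e8 i') + b)) (zdd (B *ᵥ e8 i') (f j) τ' (B *ᵥ z + b)) 0 := by
        have := (hf j).hasDeriv0 hτ' (B *ᵥ z + b) (B *ᵥ e8 i')
        refine this.congr_of_eventuallyEq (Filter.Eventually.of_forall fun w => ?_)
        simp only [Matrix.mulVec_add, Matrix.mulVec_smul]
        congr 1; abel
      have h2 : HasDerivAt (fun w : ℂ => f j τ' (B *ᵥ (z + w • e8 i') + b))
          (c j * (Complex.exp (m j * A z) * (m j * dd (e8 i') A z)) * f j τ z + c j * Complex.exp (m j * A z) * zdd (e8 i') (f j) τ z) 0 := by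
        simp only [h]
        have hA1 : HasDerivAt (fun w : ℂ => A (z + w • e8 i')) (dd (e8 i') A z) 0 := hA.hasDeriv z (e8 i') trivial
        have := (((hA1.const_mul (m j : ℂ)).cexp).const_mul (c j)).mul ((hf j).hasDeriv0 hτ z (e8 i'))
        refine this.congr_deriv ?_
        simp
      have h3 := h1.unique h2
      rw [zdd_lin (hf j) _ hτ'] at h3
      simp only [Matrix.mulVec_single_one, Matrix.col_apply] at h3
      rw [h3]
      simp [Matrix.one_apply]
      ring
  have := congrArg Matrix.det key
  rw [Matrix.det_mul, Matrix.det_mul, Matrix.det_mul, blk_det, blk_det, Matrix.det_diagonal, Matrix.det_one, Matrix.det_transpose,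
    ← jac_eq, ← jac_eq, Finset.prod_mul_distrib, ← Complex.exp_sum, ← Finset.sum_mul] at this
  rw [this]; ring

theorem jac_hol (m : Fin 9 → ℕ) (f : Fin 9 → Fn) (hf : ∀ j, HolD (f j)) : HolD (jacJacobian m f) := by
  have : jacJacobian m f = fun τ z => (jmat m f τ z).det := by funext τ z; rw [jac_eq]
  rw [this]
  simp only [Matrix.det_apply']
  refine Hol.sum _ fun σ _ => Hol.mul (Hol.const _) (Hol.prod _ fun j _ => ?_)
  generalize σ j = i
  refine Fin.cases ?_ (fun i' => ?_) i
  · exact Hol.mul (Hol.const _) (hf j)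
  · exact (hf j).zdd _

theorem jac_bd (m : Fin 9 → ℕ) (f : Fin 9 → Fn) (hf : ∀ j, HolD (f j)) (hb : ∀ j, Bd (f j)) : Bd (jacJacobian m f) := by
  have : jacJacobian m f = fun τ z => (jmat m f τ z).det := by funext τ z; rw [jac_eq]
  rw [this]
  simp only [Matrix.det_apply']
  refine Bd.sum _ fun σ _ => Bd.mul (Bd.const _) (Bd.prod _ fun j _ => ?_)
  generalize σ j = i
  refine Fin.cases ?_ (fun i' => ?_) i
  · exact Bd.mul (Bd.const _) (hb j)
  · exact (hb j).zdd (hf j) _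

theorem JF.jac {m : Fin 9 → ℕ} {k : Fin 9 → ℤ} {f : Fin 9 → Fn} (hf : ∀ j, JF (k j) (m j) (f j)) :
    JF (∑ j, k j + 8) (∑ j, (m j : ℤ)) (jacJacobian m f) := by
  refine ⟨jac_hol m f fun j => (hf j).hol, jac_bd m f (fun j => (hf j).hol) fun j => (hf j).bd,
    fun a b c d hd τ hτ z => ?_, fun x y τ hτ z => ?_⟩
  · have hj := den_ne hd hτ
    set J := (c : ℂ) * τ + (d : ℂ) with hJ
    have hB : ∀ z : V8, (J⁻¹ • (1 : Matrix (Fin 8) (Fin 8) ℂ)) *ᵥ z + 0 = fun i => z i / J := by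
      intro z; rw [Matrix.smul_mulVec, Matrix.one_mulVec, div_eq_smul, add_zero]
    have := jacTrans m f (fun j => (hf j).hol) hτ (im_mob hd hτ) (J⁻¹ • 1) 0
      (fun z => (Real.pi * I * c / J) * pc z z) (Hol.mul (Hol.const _) pc_hol) (fun j => J ^ (k j)) (by
        intro j z
        rw [hB, hJ, (hf j).mod a b c d hd τ hτ z]
        congr 3
        simp only [pc]; push_cast; ring) z
    rw [hB, Matrix.det_smul, Matrix.det_one, Fintype.card_fin, mul_one, inv_pow] at this
    have e1 : ∏ j, J ^ k j = J ^ ∑ j, k j := by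
      have : ∀ s : Finset (Fin 9), ∏ j ∈ s, J ^ k j = J ^ ∑ j ∈ s, k j := by
        intro s
        induction s using Finset.induction_on with
        | empty => simp
        | insert a s ha ih => rw [Finset.prod_insert ha, Finset.sum_insert ha, zpow_add₀ hj, ih]
      exact this _
    rw [e1] at this
    rw [inv_mul_eq_iff_eq_mul₀ (pow_ne_zero 8 hj)] at this
    rw [this, zpow_add₀ hj]
    have e2 : (J ^ (8:ℤ)) = J ^ 8 := by norm_cast
    rw [e2]
    have e3 : (((∑ j, (m j : ℤ) : ℤ) : ℂ) * Real.pi * I * c * pairC E8Gram z z / J) = (∑ j, (m j : ℂ)) * (Real.pi * I * c / J * pc z z) := by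
      simp only [pc]; push_cast; ring
    rw [e3]; ring
  · have hB : ∀ z : V8, (1 : Matrix (Fin 8) (Fin 8) ℂ) *ᵥ z + (τ • zc x + zc y) = fun i => z i + x i * τ + y i := by
      intro z; rw [Matrix.one_mulVec, shift_eq, add_assoc]
    have := jacTrans m f (fun j => (hf j).hol) hτ hτ 1 (τ • zc x + zc y)
      (fun z => -(Real.pi * I * (pairC E8Gram (zc x) (zc x) * τ + 2 * pairC E8Gram (zc x) z))) (by
        refine holOfDiff isOpen_univ ?_
        simp only [pairC]; fun_prop) (fun j => 1) (by
        intro j z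
        rw [hB, (hf j).ell x y τ hτ z, one_mul]
        congr 2
        push_cast; ring) z
    rw [hB, Matrix.det_one, one_mul, Finset.prod_const_one, one_mul] at this
    rw [this]
    congr 2
    push_cast; ring

theorem jac_anti {m : Fin 9 → ℕ} {f : Fin 9 → Fn} (hf : ∀ j, HolD (f j)) (hi : ∀ j, Inv (f j)) : Anti (jacJacobian m f) := by
  intro r hr τ hτ z
  let B : Matrix (Fin 8) (Fin 8) ℂ := 1 + Matrix.replicateCol Unit (-zc r) * Matrix.replicateRow Unit (fun k => ∑ l, zc r l * (E8Gram l k : ℂ))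
  have hB : ∀ z, B *ᵥ z + 0 = refl r z := by
    intro z
    rw [add_zero, Matrix.add_mulVec, Matrix.one_mulVec, refl, sub_eq_add_neg]
    congr 1
    funext i
    simp only [Matrix.mulVec, dotProduct, Matrix.mul_apply, Matrix.replicateCol_apply, Matrix.replicateRow_apply, pc_def]
    simp only [Finset.univ_unique, Finset.sum_const, Finset.card_singleton, one_smul, Pi.neg_apply, Pi.smul_apply, smul_eq_mul, Finset.sum_mul, Finset.mul_sum]
    rw [Finset.sum_comm, ← Finset.sum_neg_distrib]
    refine Finset.sum_congr rfl fun j _ => ?_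
    rw [← Finset.sum_neg_distrib]
    refine Finset.sum_congr rfl fun k _ => ?_
    ring
  have hd : B.det = -1 := by
    rw [Matrix.det_one_add_replicateCol_mul_replicateRow]
    have h2 := pc_int r r
    rw [hr, pc_def] at h2
    rw [dotProduct_neg]
    have : (fun k => ∑ l, zc r l * (E8Gram l k : ℂ)) ⬝ᵥ zc r = 2 := by
      rw [dotProduct, ← Int.cast_ofNat, ← h2, Finset.sum_comm]
      simp only [Finset.sum_mul]
    rw [this]; norm_num
  have := jacTrans m f hf hτ hτ B 0 (fun _ => 0) (Hol.const _) (fun _ => 1) (by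
    intro j z
    rw [hB, hi j r hr τ hτ z]; simp) z
  rw [hB, hd] at this
  simp at this
  rw [← this]; ring

theorem GInvariant.inv {f : Fn} (h : GInvariant weylE8 f) : Inv f := by
  intro r hr τ hτ z
  let S : Matrix (Fin 8) (Fin 8) ℤ := Matrix.of fun i k => (if i = k then 1 else 0) - r i * ∑ l, r l * E8Gram l k
  have hS : S ∈ weylE8 := by
    refine Submonoid.subset_closure ⟨r, hr, fun v => ?_⟩
    funext i
    simp only [S, Matrix.mulVec, dotProduct, Matrix.of_apply, sub_mul, Finset.sum_sub_distrib, ite_mul, one_mul, zero_mul, Finset.sum_ite_eq, Finset.mem_univ, if_true]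
    congr 1
    simp only [pairE8, Finset.sum_mul, Finset.mul_sum]
    rw [Finset.sum_comm]
    exact Finset.sum_congr rfl fun j _ => Finset.sum_congr rfl fun k _ => by ring
  have := h S hS τ hτ z
  rw [← this]
  congr 1
  funext i
  simp only [S, Matrix.mulVec, dotProduct, Matrix.of_apply, Matrix.map_apply, refl, pc_def, Pi.sub_apply, Pi.smul_apply, smul_eq_mul]
  push_cast
  simp only [sub_mul, Finset.sum_sub_distrib, ite_mul, one_mul, zero_mul, Finset.sum_ite_eq, Finset.mem_univ, if_true]
  congr 1
  simp only [Finset.sum_mul, Finset.mul_sum, zc]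
  rw [Finset.sum_comm]
  exact Finset.sum_congr rfl fun j _ => Finset.sum_congr rfl fun k _ => by ring

end E8J
end ModFj

section ModFk
open scoped Manifold
set_option linter.unusedVariables false
set_option linter.unusedSimpArgs false
namespace E8J

def pr (v w : Fin 8 → ℝ) : ℝ := ∑ i, ∑ j, v i * (E8Gram i j : ℝ) * w j
def rc (v : Fin 8 → ℝ) : V8 := fun i => (v i : ℂ)
theorem pc_rc (v w : Fin 8 → ℝ) : pc (rc v) (rc w) = (pr v w : ℂ) := by
  simp only [pc_def, pr, rc]; push_cast; rfl
theorem pr_expand (x y : Fin 8 → ℝ) : pr x y = 2 * x 0 * y 0 + 2 * x 1 * y 1 + 2 * x 2 * y 2 + 2 * x 3 * y 3 + 2 * x 4 * y 4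
    + 2 * x 5 * y 5 + 2 * x 6 * y 6 + 2 * x 7 * y 7 - x 0 * y 1 - x 1 * y 0 - x 1 * y 2 - x 2 * y 1 - x 2 * y 3 - x 3 * y 2
    - x 3 * y 4 - x 4 * y 3 - x 4 * y 5 - x 5 * y 4 - x 5 * y 6 - x 6 * y 5 - x 4 * y 7 - x 7 * y 4 := by
  simp [pr, E8Gram, Fin.sum_univ_eight]; ring
theorem pr_sos (x : Fin 8 → ℝ) : pr x x = 2 * (x 0 - x 1 / 2) ^ 2 + 3/2 * (x 1 - 2/3 * x 2) ^ 2 + 4/3 * (x 2 - 3/4 * x 3) ^ 2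
    + 5/4 * (x 3 - 4/5 * x 4) ^ 2 + 2 * (x 6 - x 5 / 2) ^ 2 + 3/2 * (x 5 - 2/3 * x 4) ^ 2 + 2 * (x 7 - x 4 / 2) ^ 2 + x 4 ^ 2 / 30 := by
  rw [pr_expand]; ring
theorem pr_nonneg (x : Fin 8 → ℝ) : 0 ≤ pr x x := by rw [pr_sos]; positivity
theorem pr_add (x a : Fin 8 → ℝ) : pr (x + a) (x + a) = pr x x + 2 * pr x a + pr a a := by
  simp only [pr_expand, Pi.add_apply]; ring

theorem JF.constz {k t : ℤ} {f : Fn} (hf : JF k t f) (ht : t ≤ 0) {τ : ℂ} (hτ : 0 < τ.im) (z : V8) : f τ z = f τ 0 := by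
  let K : Set ((Fin 8 → ℝ) × (Fin 8 → ℝ)) := Set.Icc 0 1 ×ˢ Set.Icc 0 1
  have hK : IsCompact K := isCompact_Icc.prod isCompact_Icc
  have hrc : Continuous rc := by unfold rc; fun_prop
  have hpr : Continuous (fun a : Fin 8 → ℝ => pr a a) := by unfold pr; fun_prop
  obtain ⟨C1, hC1⟩ := hK.exists_bound_of_continuousOn (f := fun p => f τ (τ • rc p.1 + rc p.2))
    ((hf.hol.cont hτ).comp (by fun_prop)).continuousOn
  obtain ⟨C2, hC2⟩ := hK.exists_bound_of_continuousOn (f := fun p => Real.exp (-(t * Real.pi * τ.im * pr p.1 p.1)))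
    (Continuous.continuousOn (by
      have : Continuous (fun p : (Fin 8 → ℝ) × (Fin 8 → ℝ) => pr p.1 p.1) := hpr.comp continuous_fst
      fun_prop))
  have bound : ∀ z, ‖f τ z‖ ≤ C2 * C1 := by
    intro z
    choose s u hsu using fun i => lattice_coords hτ (z i)
    let x : L8 := fun i => ⌊u i⌋
    let y : L8 := fun i => ⌊s i⌋
    let a : Fin 8 → ℝ := fun i => Int.fract (u i)
    let b : Fin 8 → ℝ := fun i => Int.fract (s i)
    have hab : (a, b) ∈ K := by
      refine ⟨⟨fun i => Int.fract_nonneg _, fun i => (Int.fract_lt_one _).le⟩, ⟨fun i => Int.fract_nonneg _, fun i => (Int.fract_lt_one _).le⟩⟩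
    have hz : z = (τ • rc a + rc b) + τ • zc x + zc y := by
      funext i
      simp only [Pi.add_apply, Pi.smul_apply, smul_eq_mul, rc, zc, a, b, x, y]
      rw [hsu i]
      have h1 : ((u i : ℝ) : ℂ) = (⌊u i⌋ : ℂ) + ((Int.fract (u i) : ℝ) : ℂ) := by
        exact_mod_cast congrArg (fun r : ℝ => (r:ℂ)) (Int.floor_add_fract (u i)).symm
      have h2 : ((s i : ℝ) : ℂ) = (⌊s i⌋ : ℂ) + ((Int.fract (s i) : ℝ) : ℂ) := by
        exact_mod_cast congrArg (fun r : ℝ => (r:ℂ)) (Int.floor_add_fract (s i)).symm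
      rw [h1, h2]; ring
    have h1 := hf.ell x y τ hτ (τ • rc a + rc b)
    rw [shift_eq, ← hz] at h1
    rw [h1, norm_mul]
    have b1 := hC1 _ hab
    have b2 := hC2 _ hab
    refine mul_le_mul ?_ b1 (norm_nonneg _) ((norm_nonneg _).trans b2)
    refine le_trans ?_ b2
    rw [Complex.norm_exp, Real.norm_eq_abs, abs_of_pos (Real.exp_pos _), Real.exp_le_exp]
    have hxr : zc x = rc (fun i => (x i : ℝ)) := by funext i; simp [zc, rc]
    have e1 : pairC E8Gram (zc x) (zc x) * τ + 2 * pairC E8Gram (zc x) (τ • rc a + rc b) =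
        ((pr (fun i => (x i : ℝ)) (fun i => (x i : ℝ)) + 2 * pr (fun i => (x i : ℝ)) a : ℝ) : ℂ) * τ + ((2 * pr (fun i => (x i : ℝ)) b : ℝ) : ℂ) := by
      change pc _ _ * τ + 2 * pc _ _ = _
      rw [hxr, pc_add_right, pc_smul_right, pc_rc, pc_rc, pc_rc]; push_cast; ring
    rw [e1]
    have e2 := pr_add (fun i => (x i : ℝ)) a
    set Q := pr (fun i => (x i : ℝ)) (fun i => (x i : ℝ)) + 2 * pr (fun i => (x i : ℝ)) a with hQ
    set R := 2 * pr (fun i => (x i : ℝ)) b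
    have e3 : (-(t : ℂ) * Real.pi * I * ((Q : ℂ) * τ + (R : ℂ))).re = t * Real.pi * τ.im * Q := by
      have : -(t : ℂ) * Real.pi * I * ((Q : ℂ) * τ + (R : ℂ)) = ((-(t * Real.pi) : ℝ) : ℂ) * (I * ((Q : ℂ) * τ + (R : ℂ))) := by push_cast; ring
      rw [this, Complex.re_ofReal_mul]
      simp; ring
    rw [e3]
    have hq := pr_nonneg ((fun i => (x i : ℝ)) + a)
    have ht' : (t : ℝ) ≤ 0 := by exact_mod_cast ht
    have hc : (t : ℝ) * Real.pi * τ.im ≤ 0 := by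
      have : 0 < Real.pi * τ.im := by positivity
      nlinarith
    have : 0 ≤ Q + pr a a := by linarith
    simp only
    nlinarith
  have hd : Differentiable ℂ (fun w : ℂ => f τ (0 + w • z)) := hf.hol.zline hτ 0 z
  have := hd.apply_eq_apply_of_bounded (by
    rw [isBounded_iff_forall_norm_le]
    refine ⟨C2 * C1, ?_⟩
    rintro _ ⟨w, rfl⟩
    exact bound _) 1 0
  simpa using this

theorem JF.negIndex {k t : ℤ} {f : Fn} (hf : JF k t f) (ht : t < 0) {τ : ℂ} (hτ : 0 < τ.im) (z : V8) : f τ z = 0 := by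
  rw [hf.constz ht.le hτ]
  let x : L8 := Pi.single 0 1
  have hx : pairE8 x x = 2 := by decide
  have hpi : (Real.pi : ℂ) ≠ 0 := by exact_mod_cast Real.pi_ne_zero
  have ht' : (t : ℂ) ≠ 0 := by exact_mod_cast ht.ne
  let s : ℂ := (-1 / (t * Real.pi * I) - 2 * τ) / 2
  have h1 := hf.ell x 0 τ hτ (s • ((1/2 : ℂ) • zc x))
  rw [hf.constz ht.le hτ, hf.constz ht.le hτ (s • _)] at h1
  have e1 : pairC E8Gram (zc x) (s • ((1/2 : ℂ) • zc x)) = s := by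
    change pc _ _ = _
    rw [pc_smul_right, pc_smul_right, pc_int, hx]; push_cast; ring
  have e2 : pairC E8Gram (zc x) (zc x) = 2 := by
    change pc _ _ = _
    rw [pc_int, hx]; norm_num
  rw [e1, e2] at h1
  have e3 : -(t : ℂ) * Real.pi * I * (2 * τ + 2 * s) = 1 := by
    simp only [s]; field_simp; ring
  rw [e3] at h1
  have h2 : (Complex.exp 1 - 1) * f τ 0 = 0 := by linear_combination -h1
  refine (mul_eq_zero.1 h2).resolve_left ?_
  rw [sub_eq_zero]
  have : Complex.exp 1 = ((Real.exp 1 : ℝ) : ℂ) := by simp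
  rw [this]
  have h3 : (1:ℝ) < Real.exp 1 := Real.one_lt_exp_iff.2 one_pos
  exact_mod_cast h3.ne'

theorem JF.toMF0 {k t : ℤ} {f : Fn} (hf : JF k t f) : MF k (fun τ => f τ 0) := by
  refine ⟨hf.hol.tau 0, fun a b c d h τ hτ => ?_, ?_⟩
  · have := hf.mod a b c d h τ hτ 0
    have e : (fun i => (0 : V8) i / ((c : ℂ) * τ + (d : ℂ))) = 0 := by funext i; simp
    rw [e] at this
    rw [this]
    simp [pairC]
  · exact (hf.bd 0).comp_tendsto (f := unc f) (k := fun τ : ℂ => (τ, (0 : V8)))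
      (Filter.tendsto_id.prodMk tendsto_const_nhds)

end E8J
end ModFk

section ModFl
open scoped Manifold
set_option linter.unusedVariables false
set_option linter.unusedSimpArgs false
namespace E8J

/-- codes of the 120 positive roots: digits in base 8. -/
def RL : List ℕ := [1, 8, 9, 64, 72, 73, 512, 576, 584, 585, 4096, 4608, 4672, 4680, 4681, 32768, 36864, 37376, 37440, 37448,
    37449, 262144, 294912, 299008, 299520, 299584, 299592, 299593, 2097152, 2101248, 2101760, 2101824, 2101832,
    2101833, 2134016, 2134528, 2134592, 2134600, 2134601, 2138624, 2138688, 2138696, 2138697, 2139200, 2139208,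
    2139209, 2139272, 2139273, 2139281, 2396160, 2396672, 2396736, 2396744, 2396745, 2400768, 2400832, 2400840,
    2400841, 2401344, 2401352, 2401353, 2401416, 2401417, 2401425, 2433536, 2433600, 2433608, 2433609, 2434112,
    2434120, 2434121, 2434184, 2434185, 2434193, 2438208, 2438216, 2438217, 2438280, 2438281, 2438289, 2438792,
    2438793, 2438801, 2438865, 4535360, 4535368, 4535369, 4535432, 4535433, 4535441, 4535944, 4535945, 4535953,
    4536017, 4540040, 4540041, 4540049, 4540113, 4540625, 4572808, 4572809, 4572817, 4572881, 4573393, 4577489,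
    4834952, 4834953, 4834961, 4835025, 4835537, 4839633, 4872401, 6674641, 6936785, 6969553, 6973649, 6974161,
    6974225, 6974233, 6974234]
def dn (n : ℕ) (i : ℕ) : ℕ := (n / 8 ^ i) % 8
def dec (n : ℕ) : L8 := fun i => (dn n i.val : ℤ)
def sqd (a b : ℕ) : ℕ := (a - b) * (a - b) + (b - a) * (b - a)
def chkRoots : Bool :=
  (List.range 8).all fun x4 => (List.range 8).all fun x5 =>
    Nat.blt 120 (2 * (x4 * x4) + 10 * sqd (3 * x5) (2 * x4)) || (List.range 8).all fun x6 =>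
    Nat.blt 120 (2 * (x4 * x4) + 10 * sqd (3 * x5) (2 * x4) + 30 * sqd (2 * x6) x5) || (List.range 8).all fun x7 =>
    Nat.blt 120 (2 * (x4 * x4) + 10 * sqd (3 * x5) (2 * x4) + 30 * sqd (2 * x6) x5 + 30 * sqd (2 * x7) x4) || (List.range 8).all fun x3 =>
    Nat.blt 120 (2 * (x4 * x4) + 10 * sqd (3 * x5) (2 * x4) + 30 * sqd (2 * x6) x5 + 30 * sqd (2 * x7) x4 + 3 * sqd (5 * x3) (4 * x4)) ||
      (List.range 8).all fun x2 =>
    Nat.blt 120 (2 * (x4 * x4) + 10 * sqd (3 * x5) (2 * x4) + 30 * sqd (2 * x6) x5 + 30 * sqd (2 * x7) x4 + 3 * sqd (5 * x3) (4 * x4)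
      + 5 * sqd (4 * x2) (3 * x3)) || (List.range 8).all fun x1 =>
    Nat.blt 120 (2 * (x4 * x4) + 10 * sqd (3 * x5) (2 * x4) + 30 * sqd (2 * x6) x5 + 30 * sqd (2 * x7) x4 + 3 * sqd (5 * x3) (4 * x4)
      + 5 * sqd (4 * x2) (3 * x3) + 10 * sqd (3 * x1) (2 * x2)) || (List.range 8).all fun x0 =>
    !Nat.beq 120 (2 * (x4 * x4) + 10 * sqd (3 * x5) (2 * x4) + 30 * sqd (2 * x6) x5 + 30 * sqd (2 * x7) x4 + 3 * sqd (5 * x3) (4 * x4)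
      + 5 * sqd (4 * x2) (3 * x3) + 10 * sqd (3 * x1) (2 * x2) + 30 * sqd (2 * x0) x1) ||
      RL.any fun n => Nat.beq n (x0 + 8 * x1 + 64 * x2 + 512 * x3 + 4096 * x4 + 32768 * x5 + 262144 * x6 + 2097152 * x7)
theorem chkRoots_eq : chkRoots = true := by decide +kernel
theorem sqd_eq (a b : ℕ) : ((sqd a b : ℕ) : ℤ) = ((a : ℤ) - b) ^ 2 := by
  unfold sqd
  rcases le_total a b with h | h
  · rw [Nat.sub_eq_zero_of_le h]; push_cast [h]; ring
  · rw [Nat.sub_eq_zero_of_le h]; push_cast [h]; ring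

theorem pairE8_sos (x : L8) : 60 * pairE8 x x = 2 * (x 4 * x 4) + 10 * (3 * x 5 - 2 * x 4) ^ 2 + 30 * (2 * x 6 - x 5) ^ 2
    + 30 * (2 * x 7 - x 4) ^ 2 + 3 * (5 * x 3 - 4 * x 4) ^ 2 + 5 * (4 * x 2 - 3 * x 3) ^ 2 + 10 * (3 * x 1 - 2 * x 2) ^ 2
    + 30 * (2 * x 0 - x 1) ^ 2 := by
  simp [pairE8, E8Gram, Fin.sum_univ_eight]; ring

theorem dn_zero (a m : ℕ) (h : a < 8) : dn (a + 8 * m) 0 = a := by unfold dn; simp; omega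
theorem dn_s (i a m : ℕ) (h : a < 8) : dn (a + 8 * m) (i + 1) = dn m i := by
  unfold dn; rw [pow_succ', ← Nat.div_div_eq_div_mul, Nat.add_mul_div_left _ _ (by norm_num), Nat.div_eq_of_lt h, zero_add]
theorem dn_succ (i a m : ℕ) (h : a < 8) : dn (a + 8 * m) (i + 1) = dn m i := dn_s i a m h

theorem root_code (r : L8) (h2 : pairE8 r r = 2) (h0 : ∀ i, 0 ≤ r i) : ∃ n ∈ RL, dec n = r := by
  choose x hx using fun i => Int.eq_ofNat_of_zero_le (h0 i)
  have hs := pairE8_sos r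
  rw [h2] at hs
  simp only [hx] at hs
  have b4 : x 4 < 8 := by zify; nlinarith [sq_nonneg (3 * (x 5:ℤ) - 2 * x 4), sq_nonneg (2 * (x 6:ℤ) - x 5), sq_nonneg (2 * (x 7:ℤ) - x 4), sq_nonneg (5 * (x 3:ℤ) - 4 * x 4), sq_nonneg (4 * (x 2:ℤ) - 3 * x 3), sq_nonneg (3 * (x 1:ℤ) - 2 * x 2), sq_nonneg (2 * (x 0:ℤ) - x 1)]
  have A : ∀ (a b c : ℤ), a ^ 2 ≤ b → b < c ^ 2 → 0 ≤ c → a < c := fun a b c h1 h2 h3 => by nlinarith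
  have q5 := sq_nonneg (3 * (x 5:ℤ) - 2 * x 4)
  have q6 := sq_nonneg (2 * (x 6:ℤ) - x 5)
  have q7 := sq_nonneg (2 * (x 7:ℤ) - x 4)
  have q3 := sq_nonneg (5 * (x 3:ℤ) - 4 * x 4)
  have q2 := sq_nonneg (4 * (x 2:ℤ) - 3 * x 3)
  have q1 := sq_nonneg (3 * (x 1:ℤ) - 2 * x 2)
  have q0 := sq_nonneg (2 * (x 0:ℤ) - x 1)
  have q4 := mul_self_nonneg (x 4 : ℤ)
  have b5 := A (3 * (x 5:ℤ) - 2 * x 4) 12 4 (by linarith) (by norm_num) (by norm_num)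
  have b6 := A (2 * (x 6:ℤ) - x 5) 4 3 (by linarith) (by norm_num) (by norm_num)
  have b7 := A (2 * (x 7:ℤ) - x 4) 4 3 (by linarith) (by norm_num) (by norm_num)
  have b3 := A (5 * (x 3:ℤ) - 4 * x 4) 40 7 (by linarith) (by norm_num) (by norm_num)
  have b2 := A (4 * (x 2:ℤ) - 3 * x 3) 24 5 (by linarith) (by norm_num) (by norm_num)
  have b1 := A (3 * (x 1:ℤ) - 2 * x 2) 12 4 (by linarith) (by norm_num) (by norm_num)
  have b0 := A (2 * (x 0:ℤ) - x 1) 4 3 (by linarith) (by norm_num) (by norm_num)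
  have hsum : 2 * (x 4 * x 4) + 10 * sqd (3 * x 5) (2 * x 4) + 30 * sqd (2 * x 6) (x 5) + 30 * sqd (2 * x 7) (x 4) + 3 * sqd (5 * x 3) (4 * x 4)
      + 5 * sqd (4 * x 2) (3 * x 3) + 10 * sqd (3 * x 1) (2 * x 2) + 30 * sqd (2 * x 0) (x 1) = 120 := by
    zify; simp only [sqd_eq]; push_cast; linarith
  have hc := chkRoots_eq
  unfold chkRoots at hc
  simp only [List.all_eq_true, List.mem_range, Bool.or_eq_true, Bool.not_eq_true', List.any_eq_true] at hc
  have nb : ∀ a, a ≤ 120 → ¬ (Nat.blt 120 a = true) := by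
    intro a ha h; rw [Nat.blt_eq] at h; omega
  have c1 := ((((((hc (x 4) b4 (x 5) (by omega)).resolve_left (nb _ (by omega)) (x 6) (by omega)).resolve_left (nb _ (by omega)) (x 7) (by omega)).resolve_left
    (nb _ (by omega)) (x 3) (by omega)).resolve_left (nb _ (by omega)) (x 2) (by omega)).resolve_left (nb _ (by omega)) (x 1) (by omega)).resolve_left (nb _ (by omega)) (x 0) (by omega)
  rw [hsum] at c1
  obtain ⟨n, hn, hn2⟩ := c1.resolve_left (by decide)
  refine ⟨n, hn, ?_⟩
  have hn3 := Nat.eq_of_beq_eq_true hn2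
  have l7 : x 7 < 8 := by omega
  have l6 : x 6 < 8 := by omega
  have l5 : x 5 < 8 := by omega
  have l3 : x 3 < 8 := by omega
  have l2 : x 2 < 8 := by omega
  have l1 : x 1 < 8 := by omega
  have l0 : x 0 < 8 := by omega
  have hn4 : n = x 0 + 8 * (x 1 + 8 * (x 2 + 8 * (x 3 + 8 * (x 4 + 8 * (x 5 + 8 * (x 6 + 8 * (x 7 + 8 * 0))))))) := by rw [hn3]; ring
  funext i
  rw [hx i]
  unfold dec
  rw [hn4]
  congr 1
  fin_cases i <;> simp only [dn_succ, dn_zero, b4, l7, l6, l5, l3, l2, l1, l0, Fin.reduceFinMk, Fin.val_ofNat, Nat.reduceMod, Fin.isValue, Fin.zero_eta, Fin.mk_one, Fin.coe_ofNat_eq_mod,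
    dn_succ 6, dn_succ 5, dn_succ 4, dn_succ 3, dn_succ 2, dn_succ 1, dn_succ 0]

def RN : Finset ℕ := RL.toFinset
def RS : Finset L8 := RN.image dec
theorem RL_nodup : RL.Nodup := by decide +kernel
theorem RL_lt : ∀ n ∈ RL, n < 8 ^ 8 := by decide +kernel
theorem dec_inj {m n : ℕ} (hm : m < 8 ^ 8) (hn : n < 8 ^ 8) (h : dec m = dec n) : m = n := by
  have h' : ∀ i : Fin 8, dn m i.val = dn n i.val := fun i => by have := congrFun h i; unfold dec at this; exact_mod_cast this
  have h0 := h' 0; have h1 := h' 1; have h2 := h' 2; have h3 := h' 3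
  have h4 := h' 4; have h5 := h' 5; have h6 := h' 6; have h7 := h' 7
  simp [dn] at h0 h1 h2 h3 h4 h5 h6 h7
  norm_num at hm hn
  omega
theorem dec_injOn : Set.InjOn dec (RN : Set ℕ) := by
  intro m hm n hn h
  exact dec_inj (RL_lt m (by simpa [RN] using hm)) (RL_lt n (by simpa [RN] using hn)) h
def pN (n : ℕ) : ℤ := 
  2 * ((dn n 0 : ℤ) * dn n 0 + (dn n 1 : ℤ) * dn n 1 + (dn n 2 : ℤ) * dn n 2 + (dn n 3 : ℤ) * dn n 3 + (dn n 4 : ℤ) * dn n 4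
    + (dn n 5 : ℤ) * dn n 5 + (dn n 6 : ℤ) * dn n 6 + (dn n 7 : ℤ) * dn n 7 - (dn n 0 : ℤ) * dn n 1 - (dn n 1 : ℤ) * dn n 2
    - (dn n 2 : ℤ) * dn n 3 - (dn n 3 : ℤ) * dn n 4 - (dn n 4 : ℤ) * dn n 5 - (dn n 5 : ℤ) * dn n 6 - (dn n 4 : ℤ) * dn n 7)
theorem pN_all : ∀ n ∈ RL, pN n = 2 := by decide +kernel
theorem pN_eq (n : ℕ) : pairE8 (dec n) (dec n) = pN n := by
  simp [pairE8, E8Gram, Fin.sum_univ_eight, dec, pN]; ring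
theorem mem_RS (r : L8) : r ∈ RS ↔ pairE8 r r = 2 ∧ ∀ i, 0 ≤ r i := by
  constructor
  · intro h
    simp only [RS, RN, Finset.mem_image, List.mem_toFinset] at h
    obtain ⟨n, hn, rfl⟩ := h
    exact ⟨by rw [pN_eq]; exact pN_all n hn, fun i => by simp [dec]⟩
  · rintro ⟨h2, h0⟩
    obtain ⟨n, hn, e⟩ := root_code r h2 h0
    simp only [RS, RN, Finset.mem_image, List.mem_toFinset]
    exact ⟨n, hn, e⟩
theorem Phi_eq (τ : ℂ) (z : V8) : PhiE8 τ z = ∏ r ∈ RS, thr r τ z := by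
  unfold PhiE8
  rw [show (∏ᶠ (r : Fin 8 → ℤ) (_ : pairE8 r r = 2 ∧ ∀ i, 0 ≤ r i), (jtheta τ (pairC E8Gram (zc r) z) / dedekindEta τ ^ 3))
    = ∏ᶠ (r : Fin 8 → ℤ) (_ : r ∈ RS), thr r τ z from by
      refine finprod_congr fun r => ?_
      exact finprod_congr_Prop (propext (mem_RS r)).symm (fun _ => rfl)]
  exact finprod_mem_finset_eq_prod _ _

def E8inv : Matrix (Fin 8) (Fin 8) ℤ := !![2,3,4,5,6,4,2,3; 3,6,8,10,12,8,4,6; 4,8,12,15,18,12,6,9; 5,10,15,20,24,16,8,12;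
  6,12,18,24,30,20,10,15; 4,8,12,16,20,14,7,10; 2,4,6,8,10,7,4,5; 3,6,9,12,15,10,5,8]
def tr8 (w : V8) (i : Fin 8) : ℂ := ∑ j, (E8Gram i j : ℂ) * w j
theorem pc_tr8 (v w : V8) : pc v w = ∑ i, v i * tr8 w i := by
  simp only [pc_def, tr8, Finset.mul_sum, mul_assoc]
theorem inv_tr8 (w : V8) (i : Fin 8) : ∑ j, (E8inv i j : ℂ) * tr8 w j = w i := by
  fin_cases i <;> simp [E8inv, tr8, E8Gram, Fin.sum_univ_eight] <;> ring
theorem ofInv {ι : Type*} (s : Finset ι) (r : ι → L8) (e : ι → ℕ) (T : ℤ)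
    (h : ∀ i j, ∑ a ∈ s, (e a : ℤ) * (r a i * r a j) = T * E8inv i j) (z w : V8) :
    ∑ a ∈ s, (e a : ℂ) * (pc (zc (r a)) z * pc (zc (r a)) w) = T * pc z w := by
  have h' : ∀ i j, ∑ a ∈ s, (e a : ℂ) * ((r a i : ℂ) * (r a j : ℂ)) = T * (E8inv i j : ℂ) := by
    intro i j; exact_mod_cast congrArg (fun n : ℤ => (n : ℂ)) (h i j)
  calc ∑ a ∈ s, (e a : ℂ) * (pc (zc (r a)) z * pc (zc (r a)) w) 
      = ∑ a ∈ s, ∑ i, ∑ j, ((e a : ℂ) * ((r a i : ℂ) * (r a j : ℂ))) * (tr8 z i * tr8 w j) := by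
        refine Finset.sum_congr rfl fun a _ => ?_
        rw [pc_tr8, pc_tr8, Finset.sum_mul_sum, Finset.mul_sum]
        refine Finset.sum_congr rfl fun i _ => ?_
        rw [Finset.mul_sum]
        refine Finset.sum_congr rfl fun j _ => ?_
        simp only [zc]; ring
    _ = ∑ i, ∑ j, (T * (E8inv i j : ℂ)) * (tr8 z i * tr8 w j) := by
        rw [Finset.sum_comm]
        refine Finset.sum_congr rfl fun i _ => ?_
        rw [Finset.sum_comm]
        refine Finset.sum_congr rfl fun j _ => ?_
        rw [← Finset.sum_mul, h']
    _ = ∑ i, T * (tr8 z i * ∑ j, (E8inv i j : ℂ) * tr8 w j) := by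
        refine Finset.sum_congr rfl fun i _ => ?_
        rw [Finset.mul_sum, Finset.mul_sum]
        refine Finset.sum_congr rfl fun j _ => ?_
        ring
    _ = T * pc z w := by
        simp only [inv_tr8]
        rw [pc_symm, pc_tr8, Finset.mul_sum]
        refine Finset.sum_congr rfl fun i _ => ?_
        ring

theorem RS_sum_nat : ∀ i : Fin 8, ∀ j : Fin 8, (((RL.map fun n => dn n i.val * dn n j.val).sum : ℕ) : ℤ) = 30 * E8inv i j := by decide +kernel
theorem RS_sum (i j : Fin 8) : ∑ r ∈ RS, ((1 : ℕ) : ℤ) * (r i * r j) = 30 * E8inv i j := by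
  rw [RS, Finset.sum_image dec_injOn, RN, List.sum_toFinset _ RL_nodup, ← RS_sum_nat]
  push_cast
  simp [dec, List.map_map, Function.comp_def]
theorem RL_len : RL.length = 120 := by decide +kernel
theorem RS_card : RS.card = 120 := by
  rw [RS, Finset.card_image_of_injOn dec_injOn, RN, List.toFinset_card_of_nodup RL_nodup, RL_len]
theorem Phi_JF : JF (-120) 30 PhiE8 := by
  have := thetaBlock RS (fun r => r) (fun _ => 1) 30 (ofInv RS (fun r => r) (fun _ => 1) 30 RS_sum)
  simp only [Finset.sum_const, RS_card, pow_one, nsmul_eq_mul] at this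
  norm_num at this
  have e : PhiE8 = fun τ z => ∏ r ∈ RS, thr r τ z := by funext τ z; exact Phi_eq τ z
  rw [e]; exact this

theorem pairE8_def0 (x : L8) (h : pairE8 x x = 0) : x = 0 := by
  have hs := pairE8_sos x
  rw [h] at hs
  have q5 := sq_nonneg (3 * (x 5:ℤ) - 2 * x 4)
  have q6 := sq_nonneg (2 * (x 6:ℤ) - x 5)
  have q7 := sq_nonneg (2 * (x 7:ℤ) - x 4)
  have q3 := sq_nonneg (5 * (x 3:ℤ) - 4 * x 4)
  have q2 := sq_nonneg (4 * (x 2:ℤ) - 3 * x 3)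
  have q1 := sq_nonneg (3 * (x 1:ℤ) - 2 * x 2)
  have q0 := sq_nonneg (2 * (x 0:ℤ) - x 1)
  have q4 := mul_self_nonneg (x 4 : ℤ)
  have A : ∀ a : ℤ, a ^ 2 ≤ 0 → a = 0 := fun a h => by nlinarith [pow_eq_zero_iff (two_ne_zero) |>.1 (le_antisymm h (sq_nonneg a))]
  have e5 := A _ (by linarith : (3 * (x 5:ℤ) - 2 * x 4) ^ 2 ≤ 0)
  have e6 := A _ (by linarith : (2 * (x 6:ℤ) - x 5) ^ 2 ≤ 0)
  have e7 := A _ (by linarith : (2 * (x 7:ℤ) - x 4) ^ 2 ≤ 0)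
  have e3 := A _ (by linarith : (5 * (x 3:ℤ) - 4 * x 4) ^ 2 ≤ 0)
  have e2 := A _ (by linarith : (4 * (x 2:ℤ) - 3 * x 3) ^ 2 ≤ 0)
  have e1 := A _ (by linarith : (3 * (x 1:ℤ) - 2 * x 2) ^ 2 ≤ 0)
  have e0 := A _ (by linarith : (2 * (x 0:ℤ) - x 1) ^ 2 ≤ 0)
  have e4 := A (x 4) (by nlinarith)
  funext i
  fin_cases i <;> simp <;> omega
theorem pairE8_pm (a r : L8) (s : ℤ) (hs : s ^ 2 = 1): pairE8 (a + s • r) (a + s • r) = pairE8 a a + 2 * s * pairE8 a r + pairE8 r r := by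
  simp [pairE8, E8Gram, Fin.sum_univ_eight]
  linear_combination (2 * (r 0 ^ 2 + r 1 ^ 2 + r 2 ^ 2 + r 3 ^ 2 + r 4 ^ 2 + r 5 ^ 2 + r 6 ^ 2 + r 7 ^ 2 - r 0 * r 1 - r 1 * r 2
    - r 2 * r 3 - r 3 * r 4 - r 4 * r 5 - r 5 * r 6 - r 4 * r 7)) * hs
theorem RS_pair (a : L8) (ha : a ∈ RS) (r : L8) (hr : r ∈ RS) (hne : a ≠ r) : (pairE8 a r) ^ 2 ≠ 4 := by
  intro h
  obtain ⟨a2, a0⟩ := (mem_RS a).1 ha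
  obtain ⟨r2, r0⟩ := (mem_RS r).1 hr
  have : (pairE8 a r - 2) * (pairE8 a r + 2) = 0 := by linear_combination h
  rcases mul_eq_zero.1 this with h1 | h1
  · have e := pairE8_def0 (a + (-1 : ℤ) • r) (by rw [pairE8_pm _ _ _ (by norm_num), a2, r2]; linarith)
    apply hne; funext i; have := congrFun e i; simp at this; linarith
  · have e := pairE8_def0 (a + (1 : ℤ) • r) (by rw [pairE8_pm _ _ _ (by norm_num), a2, r2]; linarith)
    have : a = 0 := by funext i; have := congrFun e i; simp at this; have := a0 i; have := r0 i; simp; linarith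
    rw [this] at a2; simp [pairE8] at a2

theorem thr_nonzero {r : L8} (hr : pairE8 r r = 2) {τ : ℂ} (hτ : 0 < τ.im) : ∃ z, thr r τ z ≠ 0 := by
  obtain ⟨u0, hu⟩ := th_nonzero hτ
  refine ⟨(u0 / 2) • zc r, ?_⟩
  unfold thr
  rw [pc_smul_right, pc_int, hr]
  push_cast
  rwa [div_mul_cancel₀ _ two_ne_zero]
theorem Phi_nonzero {τ : ℂ} (hτ : 0 < τ.im) : ∃ z, PhiE8 τ z ≠ 0 := by
  obtain ⟨z, _, hz⟩ := commonNonzero isOpen_univ convex_univ RS (f := fun r => thr r τ) (fun r _ => (thr_hol r).fix hτ) ⟨0, trivial⟩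
    (fun r hr => by obtain ⟨z, hz⟩ := thr_nonzero ((mem_RS r).1 hr).1 hτ; exact ⟨z, trivial, hz⟩)
  exact ⟨z, by rw [Phi_eq]; exact Finset.prod_ne_zero_iff.2 hz⟩

def OR : Fin 8 → L8 := ![![0,0,0,0,0,0,0,1],![0,0,0,0,0,0,1,0],![0,0,0,1,0,0,0,0],![0,0,0,1,2,2,1,1],![0,1,0,0,0,0,0,0],
  ![0,1,2,2,2,2,1,1],![0,1,2,3,4,2,1,2],![2,3,4,5,6,4,2,3]]
theorem OR_sum (i j : Fin 8) : ∑ a, (OR a i * OR a j) = 2 * E8inv i j := by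
  revert i j; decide +kernel
theorem OR_pair (a b : Fin 8) : pairE8 (OR a) (OR b) = if a = b then 2 else 0 := by
  revert a b; decide +kernel
end E8J
end ModFl

section ModFm
open scoped Manifold
set_option linter.unusedVariables false
set_option linter.unusedSimpArgs false
namespace E8J

theorem HolD.add {f g : Fn} (hf : HolD f) (hg : HolD g) : HolD (fun τ z => f τ z + g τ z) := Hol.add hf hg
theorem HolD.sub {f g : Fn} (hf : HolD f) (hg : HolD g) : HolD (fun τ z => f τ z - g τ z) := Hol.sub hf hg
theorem HolD.mul {f g : Fn} (hf : HolD f) (hg : HolD g) : HolD (fun τ z => f τ z * g τ z) := Hol.mul hf hg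
theorem HolD.const (c : ℂ) : HolD (fun _ _ => c) := Hol.const c
theorem HolD.pow {f : Fn} (hf : HolD f) (n : ℕ) : HolD (fun τ z => f τ z ^ n) := Hol.pow hf n
theorem HolD.sum {ι : Type*} (s : Finset ι) {f : ι → Fn} (hf : ∀ i ∈ s, HolD (f i)) : HolD (fun τ z => ∑ i ∈ s, f i τ z) :=
  Hol.sum (U := D) s (f := fun i => unc (f i)) hf
theorem HolD.prod {ι : Type*} (s : Finset ι) {f : ι → Fn} (hf : ∀ i ∈ s, HolD (f i)) : HolD (fun τ z => ∏ i ∈ s, f i τ z) :=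
  Hol.prod (U := D) s (f := fun i => unc (f i)) hf
theorem HolD.ofTau {f : ℂ → ℂ} (hf : DifferentiableOn ℂ f {τ : ℂ | 0 < τ.im}) : HolD (fun τ _ => f τ) := by
  refine holOfDiff D_open ?_
  exact hf.comp (g := f) (f := Prod.fst) (by fun_prop) (fun p hp => hp)
theorem HolD.canc {f h : Fn} (hf : HolD f) (hh : HolD h) (h0 : ∀ τ : ℂ, 0 < τ.im → ∀ z, f τ z * h τ z = 0)
    (hn : ∃ τ : ℂ, 0 < τ.im ∧ ∃ z, f τ z ≠ 0) : ∀ τ : ℂ, 0 < τ.im → ∀ z, h τ z = 0 := by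
  obtain ⟨τ0, hτ0, z0, h1⟩ := hn
  intro τ hτ z
  exact noZeroDiv D_open D_convex hf hh (fun p hp => h0 p.1 hp p.2) (q := (τ0, z0)) hτ0 h1 (τ, z) hτ
theorem HolD.refl {f : Fn} (hf : HolD f) (r : L8) : HolD (fun τ z => f τ (refl r z)) := by
  have := Hol.compAffine (V := D) hf ((ContinuousLinearMap.fst ℂ ℂ V8).prod (ContinuousLinearMap.snd ℂ ℂ V8 -
    ((pcL (zc r)).comp (ContinuousLinearMap.snd ℂ ℂ V8)).smulRight (zc r))) 0
    (by intro p hp; simpa [D] using hp)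
  simp only [add_zero] at this
  exact this

theorem quotPhi {k t : ℤ} {f : Fn} (hf : JF k t f) (ha : Anti f) : ∃ h : Fn, JF (k + 120) (t - 30) h ∧
    ∀ τ : ℂ, 0 < τ.im → ∀ z, f τ z = h τ z * PhiE8 τ z := by
  obtain ⟨h, hh, hb, e⟩ := divideAll RS (fun r hr => ((mem_RS r).1 hr).1) RS_pair hf.hol hf.bd
    (fun r hr => hf.van ha ((mem_RS r).1 hr).1)
  have e' : ∀ τ : ℂ, 0 < τ.im → ∀ z, f τ z = h τ z * PhiE8 τ z := fun τ hτ z => by rw [e τ hτ z, Phi_eq]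
  refine ⟨h, ?_, e'⟩
  have := JF.quot hf Phi_JF hh hb e' (fun τ hτ => Phi_nonzero hτ)
  simpa [sub_neg_eq_add] using this

structure Data (F : Fin 9 → Fn) (g : ℂ → ℂ) : Prop where
  jf : ∀ j, JF (sakaiWt j) (sakaiIdx j) (F j)
  inv : ∀ j, Inv (F j)
  mf : MF 172 g
  jac : ∀ τ : ℂ, 0 < τ.im → ∀ z, jacJacobian sakaiIdx F τ z = g τ * PhiE8 τ z

theorem gExists {F : Fin 9 → Fn} (jf : ∀ j, JF (sakaiWt j) (sakaiIdx j) (F j)) (inv : ∀ j, Inv (F j)) : ∃ g, Data F g := by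
  obtain ⟨h, hh, e⟩ := quotPhi (JF.jac jf) (jac_anti (fun j => (jf j).hol) inv)
  have e1 : ∑ j, sakaiWt j = 44 := by decide
  have e2 : ∑ j, (sakaiIdx j : ℤ) = 30 := by decide
  rw [e1, e2] at hh
  norm_num at hh
  exact ⟨fun τ => h τ 0, jf, inv, hh.toMF0, fun τ hτ z => by rw [e τ hτ z, hh.constz le_rfl hτ z]⟩

theorem Data.phi_anti {F : Fin 9 → Fn} {g : ℂ → ℂ} (h : Data F g) (hg : ∃ τ : ℂ, 0 < τ.im ∧ g τ ≠ 0) : Anti PhiE8 := by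
  intro r hr
  have ha := jac_anti (m := sakaiIdx) (fun j => (h.jf j).hol) h.inv r hr
  have := HolD.canc (HolD.ofTau h.mf.diff) ((Phi_JF.hol.refl r).add Phi_JF.hol) (fun τ hτ z => by
    have := ha τ hτ z
    rw [h.jac τ hτ, h.jac τ hτ] at this
    linear_combination this) (by obtain ⟨τ, hτ, h⟩ := hg; exact ⟨τ, hτ, 0, h⟩)
  intro τ hτ z
  linear_combination this τ hτ z

theorem cramerRow (mm : Fin 9 → ℕ) (F : Fin 9 → Fn) (m : ℕ) (ψ : Fn) (τ : ℂ) (z : V8) :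
    ∑ j, (mm j : ℂ) * F j τ z * jacJacobian (Function.update mm j m) (Function.update F j ψ) τ z = 
      jacJacobian mm F τ z * (m * ψ τ z) := by
  let b : Fin 9 → ℂ := fun i => Fin.cases ((m : ℂ) * ψ τ z) (fun i' : Fin 8 => zdd (e8 i') ψ τ z) i
  have h := congrFun (Matrix.mulVec_cramer (jmat mm F τ z) b) 0
  have e : ∀ j, jacJacobian (Function.update mm j m) (Function.update F j ψ) τ z = Matrix.cramer (jmat mm F τ z) b j := by
    intro j
    rw [jac_eq, Matrix.cramer_apply]
    congr 1
    ext i l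
    rw [Matrix.updateCol_apply]
    by_cases hl : l = j
    · subst hl; simp [jmat, b]
    · simp [jmat, Function.update_of_ne hl, hl]
  simp only [e]
  rw [jac_eq]
  simpa [Matrix.mulVec, dotProduct, jmat, b] using h

theorem Data.step {F : Fin 9 → Fn} {g : ℂ → ℂ} (h : Data F g) (hg : ∃ τ : ℂ, 0 < τ.im ∧ g τ ≠ 0) {k : ℤ} {m : ℕ} {ψ : Fn}
    (hψ : JF k m ψ) (hi : Inv ψ) : ∃ f : Fin 9 → Fn, (∀ j, JF (k - sakaiWt j + 172) (m - sakaiIdx j) (f j)) ∧ (∀ j, Inv (f j)) ∧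
      ∀ τ : ℂ, 0 < τ.im → ∀ z, (m : ℂ) * (g τ * ψ τ z) = ∑ j, (sakaiIdx j : ℂ) * (F j τ z * f j τ z) := by
  have hanti := h.phi_anti hg
  have key : ∀ j, ∃ f : Fn, JF (k - sakaiWt j + 172) (m - sakaiIdx j) f ∧ Inv f ∧
      ∀ τ : ℂ, 0 < τ.im → ∀ z, jacJacobian (Function.update sakaiIdx j m) (Function.update F j ψ) τ z = f τ z * PhiE8 τ z := by
    intro j
    have j1 : ∀ i, JF (Function.update sakaiWt j k i) (Function.update sakaiIdx j m i) (Function.update F j ψ i) := by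
      intro i
      by_cases hl : i = j
      · subst hl; simpa using hψ
      · simpa [Function.update_of_ne hl] using h.jf i
    have j2 : ∀ i, Inv (Function.update F j ψ i) := by
      intro i
      by_cases hl : i = j
      · subst hl; simpa using hi
      · simpa [Function.update_of_ne hl] using h.inv i
    have ja := jac_anti (m := Function.update sakaiIdx j m) (fun i => (j1 i).hol) j2
    obtain ⟨f, hf, e⟩ := quotPhi (JF.jac j1) ja
    have e1 : ∑ i, Function.update sakaiWt j k i = 44 - sakaiWt j + k := by
      have e1 : ∑ j, sakaiWt j = 44 := by decide
      rw [Finset.sum_update_of_mem (Finset.mem_univ _), ← e1, Finset.sdiff_singleton_eq_erase]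
      rw [← Finset.add_sum_erase Finset.univ sakaiWt (Finset.mem_univ j)]; ring
    have e2 : ∑ i, ((Function.update sakaiIdx j m i : ℕ) : ℤ) = 30 - sakaiIdx j + m := by
      have e1 : ∑ j, (sakaiIdx j : ℤ) = 30 := by decide
      have : (fun i => ((Function.update sakaiIdx j m i : ℕ) : ℤ)) = Function.update (fun i => (sakaiIdx i : ℤ)) j (m : ℤ) := by
        funext i
        by_cases hl : i = j
        · subst hl; simp
        · simp [Function.update_of_ne hl]
      rw [this, Finset.sum_update_of_mem (Finset.mem_univ _), ← e1, Finset.sdiff_singleton_eq_erase]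
      rw [← Finset.add_sum_erase Finset.univ (fun i => (sakaiIdx i : ℤ)) (Finset.mem_univ j)]; ring
    rw [e1, e2] at hf
    refine ⟨f, by convert hf using 1 <;> ring, ?_, e⟩
    intro r hr
    have := HolD.canc Phi_JF.hol ((hf.hol.refl r).sub hf.hol) (fun τ hτ z => by
      have a1 := ja r hr τ hτ z
      rw [e τ hτ, e τ hτ, hanti r hr τ hτ] at a1
      linear_combination -a1) ⟨I, by simp, Phi_nonzero (by simp)⟩
    intro τ hτ z
    linear_combination this τ hτ z
  choose f hf hfi e using key
  refine ⟨f, hf, hfi, ?_⟩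
  have := HolD.canc Phi_JF.hol (((HolD.const (m : ℂ)).mul ((HolD.ofTau h.mf.diff).mul hψ.hol)).sub
    (HolD.sum Finset.univ (f := fun j τ z => (sakaiIdx j : ℂ) * (F j τ z * f j τ z)) 
      (fun j _ => (HolD.const (sakaiIdx j : ℂ)).mul ((h.jf j).hol.mul (hf j).hol)))) (fun τ hτ z => by
      have c := cramerRow sakaiIdx F m ψ τ z
      rw [h.jac τ hτ] at c
      simp only [fun j => e j τ hτ z] at c
      rw [mul_sub, sub_eq_zero, Finset.mul_sum]
      trans g τ * PhiE8 τ z * (m * ψ τ z)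
      · ring
      rw [← c]
      exact Finset.sum_congr rfl fun j _ => by ring) ⟨I, by simp, Phi_nonzero (by simp)⟩
  intro τ hτ z
  linear_combination this τ hτ z
end E8J
end ModFm

section ModFo
open scoped Manifold
set_option linter.unusedVariables false
set_option linter.unusedSimpArgs false
namespace E8J

theorem zlineD {f : Fn} (hf : HolD f) {τ : ℂ} (hτ : 0 < τ.im) (v : V8) (w : ℂ) :
    HasDerivAt (fun w : ℂ => f τ (w • v)) (zdd v f τ (w • v)) w := by
  simpa using hf.hasDeriv hτ 0 v w

theorem JF.modLine {k t : ℤ} {f : Fn} (hf : JF k t f) {a b c d : ℤ} (hd : a * d - b * c = 1) {τ : ℂ} (hτ : 0 < τ.im) (v : V8) (w : ℂ) :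
    f (((a : ℂ) * τ + (b : ℂ)) / ((c : ℂ) * τ + (d : ℂ))) (w • v) = ((c : ℂ) * τ + (d : ℂ)) ^ k *
      Complex.exp ((t : ℂ) * Real.pi * I * c * ((c : ℂ) * τ + (d : ℂ)) * pc v v * w ^ 2) * f τ ((((c : ℂ) * τ + (d : ℂ)) * w) • v) := by
  have hj := den_ne hd hτ
  set j := (c : ℂ) * τ + (d : ℂ)
  have := hf.mod a b c d hd τ hτ ((j * w) • v)
  rw [div_eq_smul, smul_smul, ← mul_assoc, inv_mul_cancel₀ hj, one_mul] at this
  rw [this]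
  congr 2
  change Complex.exp (_ * pc _ _ / _) = _
  rw [pc_smul_right, pc_smul_left]
  congr 1
  change _ / j = _
  field_simp

theorem d2_law {f : Fn} {k : ℤ} (hf : JF k 1 f) (v : V8) {a b c d : ℤ} (hd : a * d - b * c = 1) {τ : ℂ} (hτ : 0 < τ.im) :
    zdd v (zdd v f) (((a : ℂ) * τ + (b : ℂ)) / ((c : ℂ) * τ + (d : ℂ))) 0 = ((c : ℂ) * τ + (d : ℂ)) ^ k * 
      (((c : ℂ) * τ + (d : ℂ)) ^ 2 * zdd v (zdd v f) τ 0 + 2 * Real.pi * I * pc v v * c * ((c : ℂ) * τ + (d : ℂ)) * f τ 0) := by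
  have hj := den_ne hd hτ
  have hτ' := im_mob hd hτ
  have hm := hf.modLine hd hτ v
  set j := (c : ℂ) * τ + (d : ℂ)
  set τ' := ((a : ℂ) * τ + (b : ℂ)) / j
  set A : ℂ := Real.pi * I * c * j * pc v v with hA
  have hexp : ∀ w : ℂ, HasDerivAt (fun w : ℂ => Complex.exp (A * w ^ 2)) (Complex.exp (A * w ^ 2) * (A * (2 * w))) w := by
    intro w
    have := (((hasDerivAt_id w).pow 2).const_mul A).cexp
    refine this.congr_deriv ?_
    simp
  have hHj : ∀ (G : Fn), HolD G → ∀ w : ℂ, HasDerivAt (fun w : ℂ => G τ ((j * w) • v)) (j * zdd v G τ ((j * w) • v)) w := by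
    intro G hG w
    have := (zlineD hG hτ v (j * w)).comp w ((hasDerivAt_id w).const_mul j)
    refine this.congr_deriv ?_
    ring
  have hm' : ∀ w : ℂ, f τ' (w • v) = j ^ k * (Complex.exp (A * w ^ 2) * f τ ((j * w) • v)) := by
    intro w; rw [hm w, ← mul_assoc]; congr 3; rw [hA]; push_cast; ring
  have h1 : ∀ w : ℂ, zdd v f τ' (w • v) = j ^ k * (Complex.exp (A * w ^ 2) * (A * (2 * w)) * f τ ((j * w) • v) + 
      Complex.exp (A * w ^ 2) * (j * zdd v f τ ((j * w) • v))) := by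
    intro w
    refine (zlineD hf.hol hτ' v w).unique ?_
    have := ((hexp w).mul (hHj f hf.hol w)).const_mul (j ^ k)
    refine this.congr_of_eventuallyEq (Filter.Eventually.of_forall fun w => hm' w)
  have h2 := (zlineD (hf.hol.zdd v) hτ' v 0)
  have h3 := ((((hexp 0).mul (((hasDerivAt_id (0:ℂ)).const_mul 2).const_mul A)).mul (hHj f hf.hol 0)).add 
    ((hexp 0).mul ((hHj _ (hf.hol.zdd v) 0).const_mul j))).const_mul (j ^ k)
  have h4 := h2.unique (h3.congr_of_eventuallyEq (Filter.Eventually.of_forall fun w => by simpa using h1 w))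
  simp only [zero_smul, mul_zero] at h4
  rw [h4]
  simp
  left
  rw [hA]; ring

theorem F0_nonzero {f : Fn} (hf : JF 4 1 f) {c : ℕ → (Fin 8 → ℚ) → ℂ} (hc : FourierRep E8Gram f c)
    (h0 : ∀ ℓ : Fin 8 → ℚ, c 0 ℓ = if ℓ = 0 then 1 else 0) {τ : ℂ} (hτ : 0 < τ.im) : ∃ z, f τ z ≠ 0 := by
  by_contra hcon
  push Not at hcon
  let v : V8 := e8 0
  have hv : ‖v‖ ≤ 1 := by
    rw [pi_norm_le_iff_of_nonneg zero_le_one]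
    intro i; simp only [v, e8, Pi.single_apply]; split_ifs <;> simp
  obtain ⟨C, hC⟩ := fourierLimit hc h0 0
  have hlim : Filter.Tendsto (fun τ : ℂ => C * Real.exp (-(2 * Real.pi * (τ.im - 1)))) Iinf (nhds 0) := by
    have h1 : Filter.Tendsto (fun y : ℝ => Real.exp (-(2 * Real.pi * (y - 1)))) Filter.atTop (nhds 0) := by
      refine Real.tendsto_exp_neg_atTop_nhds_zero.comp (Filter.Tendsto.const_mul_atTop (by positivity) ?_)
      exact Filter.tendsto_atTop_add_const_right _ (-1) Filter.tendsto_id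
    have h2 : Filter.Tendsto Complex.im Iinf Filter.atTop := Filter.tendsto_comap
    simpa using (h1.comp h2).const_mul C
  have hev : ∀ᶠ τ in Iinf, 1 ≤ τ.im := Iinf_basis.mem_of_mem (i := 1) trivial
  refine noCommonZero (e := fun τ => f τ 0) (a := fun τ => zdd v (zdd v f) τ 0) (Q := pc v v) ?_ hf.toMF0 
    (((hf.hol.zdd v).zdd v).tau 0) ?_ ?_ ?_ hτ ⟨hcon 0, ?_⟩
  · simp [pc_def, v, e8, Fin.sum_univ_eight, E8Gram, Pi.single_apply]
  · intro a b c d hd τ hτ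
    rw [d2_law hf v hd hτ]
    simp only [show (4 : ℤ) = ((4:ℕ):ℤ) from rfl, zpow_natCast]
    ring
  · rw [tendsto_iff_norm_sub_tendsto_zero]
    refine squeeze_zero' (Filter.Eventually.of_forall fun _ => norm_nonneg _) ?_ hlim
    filter_upwards [hev] with τ h1
    exact hC τ h1 0 (by simp)
  · refine squeeze_zero_norm' ?_ (by simpa using hlim.const_mul 2 : Filter.Tendsto (fun x : ℂ => 2 * (C * Real.exp (-(2 * Real.pi * (x.im - 1))))) Iinf (nhds 0))
    filter_upwards [hev] with τ h1
    have hτ : 0 < τ.im := by linarith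
    have e1 : ∀ w : ℂ, deriv (fun w : ℂ => f τ (w • v) - 1) w = zdd v f τ (w • v) := fun w =>
      ((zlineD hf.hol hτ v w).sub_const 1).deriv
    have e2 : iteratedDeriv 2 (fun w : ℂ => f τ (w • v) - 1) 0 = zdd v (zdd v f) τ 0 := by
      rw [iteratedDeriv_succ, iteratedDeriv_one, funext e1]
      simpa using (zlineD (hf.hol.zdd v) hτ v 0).deriv
    rw [← e2]
    have := Complex.norm_iteratedDeriv_le_of_forall_mem_sphere_norm_le (f := fun w : ℂ => f τ (w • v) - 1) (c := 0) (R := 1) 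
      (C := C * Real.exp (-(2 * Real.pi * (τ.im - 1)))) 2 one_pos
      (Differentiable.diffContOnCl (fun w => ((zlineD hf.hol hτ v w).sub_const 1).differentiableAt)) (by
        intro w hw
        refine hC τ h1 _ ?_
        rw [sub_zero, norm_smul]
        have : ‖w‖ = 1 := by simpa using hw
        rw [this, one_mul]; exact hv)
    simpa using this
  · have : f τ = fun _ => 0 := funext hcon
    have h1 : ∀ z, zdd v f τ z = 0 := fun z => by simp [zdd, this]
    simp [zdd, h1]
    simp only [zdd] at h1
    simp [h1]
end E8J
end ModFo

section ModFp
open scoped Manifold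
set_option linter.unusedVariables false
set_option linter.unusedSimpArgs false
namespace E8J

/-- iterated directional derivative -/
def itd (v : V8) (j : ℕ) (f : Fn) : Fn := (zdd v)^[j] f
theorem itd_zero (v : V8) (f : Fn) : itd v 0 f = f := rfl
theorem itd_succ (v : V8) (j : ℕ) (f : Fn) : itd v (j + 1) f = zdd v (itd v j f) := Function.iterate_succ_apply' _ _ _
theorem HolD.itd {f : Fn} (hf : HolD f) (v : V8) (j : ℕ) : HolD (itd v j f) := by
  induction j with
  | zero => exact hf
  | succ j ih => rw [itd_succ]; exact ih.zdd v
theorem Bd.itd {f : Fn} (hb : Bd f) (hf : HolD f) (v : V8) (j : ℕ) : Bd (itd v j f) := by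
  induction j with
  | zero => exact hb
  | succ j ih => rw [itd_succ]; exact ih.zdd (hf.itd v j) v
theorem zdd_congr {f g : Fn} {τ : ℂ} (h : ∀ z, f τ z = g τ z) (v z : V8) : zdd v f τ z = zdd v g τ z := by
  simp only [zdd, h]
theorem itd_iter {f : Fn} (hf : HolD f) {τ : ℂ} (hτ : 0 < τ.im) (v : V8) (j : ℕ) :
    iteratedDeriv j (fun w : ℂ => f τ (w • v)) = fun w => itd v j f τ (w • v) := by
  induction j with
  | zero => simp [itd_zero]
  | succ j ih =>
    rw [iteratedDeriv_succ, ih]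
    funext w
    rw [itd_succ]
    exact (zlineD (hf.itd v j) hτ v w).deriv

theorem itd_lin {f h : Fn} (hf : HolD f) (hh : HolD h) (a b : ℂ → ℂ) (v : V8) (j : ℕ) {τ : ℂ} (hτ : 0 < τ.im) (z : V8) :
    itd v j (fun τ z => a τ * f τ z - b τ * h τ z) τ z = a τ * itd v j f τ z - b τ * itd v j h τ z := by
  induction j generalizing z with
  | zero => rfl
  | succ j ih =>
    rw [itd_succ, zdd_congr (g := fun τ z => a τ * itd v j f τ z - b τ * itd v j h τ z) ih, itd_succ, itd_succ]
    exact (((hf.itd v j).hasDeriv0 hτ z v).const_mul (a τ) |>.sub (((hh.itd v j).hasDeriv0 hτ z v).const_mul (b τ))).deriv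
theorem itd_smul (f : Fn) (s : ℂ) (v : V8) (j : ℕ) (τ : ℂ) (z : V8) : itd (s • v) j f τ z = s ^ j * itd v j f τ z := by
  induction j generalizing z with
  | zero => simp [itd_zero]
  | succ j ih =>
    rw [itd_succ, zdd_congr (g := fun τ z => s ^ j * itd v j f τ z) ih, itd_succ, zdd_smul, pow_succ, mul_comm (s ^ j), mul_assoc]
    congr 1
    simp only [zdd]
    rw [deriv_const_mul_field]

theorem itd_poly {f : Fn} (hf : HolD f) (z0 v : V8) (j : ℕ) : ∃ g : ℕ → Fn, (∀ i, HolD (g i)) ∧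
    ∀ (u : ℂ) (τ : ℂ), 0 < τ.im → ∀ z, itd (z0 + u • v) j f τ z = ∑ i ∈ Finset.range (j + 1), u ^ i * g i τ z := by
  induction j with
  | zero => exact ⟨fun _ => f, fun _ => hf, by simp [itd_zero]⟩
  | succ j ih =>
    obtain ⟨g, hg, e⟩ := ih
    refine ⟨fun i τ z => (if i ≤ j then zdd z0 (g i) τ z else 0) + (if i = 0 then 0 else zdd v (g (i - 1)) τ z), fun i => ?_, ?_⟩
    · refine HolD.add ?_ ?_
      · by_cases h : i ≤ j
        · simp only [h, if_true]; exact (hg i).zdd z0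
        · simp only [h, if_false]; exact HolD.const 0
      · by_cases h : i = 0
        · simp only [h, if_true]; exact HolD.const 0
        · simp only [h, if_false]; exact (hg (i - 1)).zdd v
    · intro u τ hτ z
      rw [itd_succ, zdd_congr (g := fun τ z => ∑ i ∈ Finset.range (j + 1), u ^ i * g i τ z) (e u τ hτ)]
      have h1 : zdd (z0 + u • v) (fun τ z => ∑ i ∈ Finset.range (j + 1), u ^ i * g i τ z) τ z =
          ∑ i ∈ Finset.range (j + 1), u ^ i * (zdd z0 (g i) τ z + u * zdd v (g i) τ z) := by
        have := HasDerivAt.fun_sum (u := Finset.range (j + 1)) (fun i _ => ((hg i).hasDeriv0 hτ z (z0 + u • v)).const_mul (u ^ i))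
        refine this.deriv.trans ?_
        refine Finset.sum_congr rfl fun i _ => ?_
        rw [zdd_add (hg i) _ _ hτ, zdd_smul]
      rw [h1]
      simp only [mul_add, Finset.sum_add_distrib]
      congr 1
      · rw [Finset.sum_range_succ _ (j + 1)]
        simp only [show ¬ (j + 1 ≤ j) by omega, if_false, mul_zero, add_zero]
        exact Finset.sum_congr rfl fun i hi => by rw [if_pos (by simp at hi; omega)]
      · rw [Finset.sum_range_succ' _ (j + 1)]
        simp only [if_true, mul_zero, add_zero]
        exact Finset.sum_congr rfl fun i hi => by simp; ring

theorem polyZero {n N : ℕ} (hn : n ≤ N) (c : ℕ → ℂ) (h : ∀ a : Fin (N + 1), ∑ i ∈ Finset.range (n + 1), (a.val : ℂ) ^ i * c i = 0) (u : ℂ) :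
    ∑ i ∈ Finset.range (n + 1), u ^ i * c i = 0 := by
  let p : Polynomial ℂ := ∑ i ∈ Finset.range (n + 1), Polynomial.C (c i) * Polynomial.X ^ i
  have he : ∀ u, p.eval u = ∑ i ∈ Finset.range (n + 1), u ^ i * c i := by
    intro u
    simp only [p, Polynomial.eval_finsetSum, Polynomial.eval_mul, Polynomial.eval_C, Polynomial.eval_pow, Polynomial.eval_X]
    exact Finset.sum_congr rfl fun i _ => mul_comm _ _
  have hd : p.natDegree ≤ n := by
    refine Polynomial.natDegree_sum_le_of_forall_le _ _ fun i hi => (Polynomial.natDegree_C_mul_X_pow_le _ _).trans ?_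
    simp at hi; omega
  have : p = 0 := by
    refine Polynomial.eq_zero_of_natDegree_lt_card_of_eval_eq_zero p (f := fun a : Fin (N + 1) => (a.val : ℂ)) ?_ ?_ ?_
    · intro a b h; simpa [Fin.ext_iff] using h
    · intro a; rw [he]; exact h a
    · simp; omega
  rw [← he, this]; simp

/-- grid points -/
def gpt {N : ℕ} (a : Fin 7 → Fin (N + 1)) : V8 := Fin.cons 1 (fun i => ((a i).val : ℂ))

theorem gridZero {f : Fn} (hf : HolD f) {j N : ℕ} (hj : j ≤ N) {τ : ℂ} (hτ : 0 < τ.im)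
    (h : ∀ a : Fin 7 → Fin (N + 1), itd (gpt a) j f τ 0 = 0) (z : V8) : itd z j f τ 0 = 0 := by
  have step : ∀ n : ℕ, n ≤ 7 → ∀ y : Fin 7 → ℂ, (∀ i : Fin 7, n ≤ i.val → ∃ a : Fin (N + 1), y i = (a.val : ℂ)) → 
      itd (Fin.cons 1 y : V8) j f τ 0 = 0 := by
    intro n
    induction n with
    | zero =>
      intro _ y hy
      choose a ha using fun i => hy i (Nat.zero_le _)
      have : y = fun i => ((a i).val : ℂ) := funext ha
      rw [this]; exact h a
    | succ n ih =>
      intro hn y hy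
      let i0 : Fin 7 := ⟨n, by omega⟩
      obtain ⟨g, hg, e⟩ := itd_poly hf (Fin.cons 1 (Function.update y i0 0) : V8) (e8 i0.succ) j
      have hline : ∀ u : ℂ, (Fin.cons 1 (Function.update y i0 0) : V8) + u • e8 i0.succ = Fin.cons 1 (Function.update y i0 u) := by
        intro u
        funext i
        refine Fin.cases ?_ (fun i => ?_) i
        · simp only [Pi.add_apply, Fin.cons_zero, Pi.smul_apply, e8, Pi.single_apply]
          rw [if_neg (Fin.succ_ne_zero i0).symm]; simp
        · simp only [Pi.add_apply, Fin.cons_succ, Pi.smul_apply, smul_eq_mul, e8]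
          by_cases hi : i = i0
          · subst hi; simp
          · rw [Function.update_of_ne hi, Function.update_of_ne hi, Pi.single_apply, if_neg (by simpa [Fin.succ_inj] using hi)]; simp
      have := polyZero hj (fun i => g i τ 0) (fun a => by
        rw [← e _ τ hτ 0, hline]
        refine ih (by omega) _ fun i hi => ?_
        by_cases hi0 : i = i0
        · exact ⟨a, by subst hi0; simp⟩
        · rw [Function.update_of_ne hi0]
          refine hy i ?_
          have : i.val ≠ n := fun h => hi0 (Fin.ext h)
          omega) (y i0)
      rw [← e _ τ hτ 0, hline, Function.update_eq_self] at this
      exact this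
  have h1 : ∀ z : V8, z 0 ≠ 0 → itd z j f τ 0 = 0 := by
    intro z hz
    have e : z = z 0 • (Fin.cons 1 (fun i : Fin 7 => z i.succ / z 0) : V8) := by
      funext i
      refine Fin.cases ?_ (fun i => ?_) i
      · simp
      · simp; field_simp
    rw [e, itd_smul, step 7 le_rfl _ (fun i hi => absurd i.2 (by omega)), mul_zero]
  by_cases hz : z 0 = 0
  · obtain ⟨g, hg, e⟩ := itd_poly hf (z + (1:ℂ) • e8 0) (e8 0) j
    have := polyZero hj (fun i => g i τ 0) (fun a => by
      rw [← e _ τ hτ 0]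
      refine h1 _ ?_
      simp [e8, hz]
      exact_mod_cast (by omega : 1 + a.val ≠ 0)) (-1)
    rw [← e _ τ hτ 0] at this
    simpa using this
  · exact h1 z hz

theorem iterPow (j : ℕ) {h : ℂ → ℂ} (hh : Differentiable ℂ h) : iteratedDeriv j (fun w => w ^ j * h w) 0 = j.factorial * h 0 := by
  induction j generalizing h with
  | zero => simp
  | succ j ih =>
    have hd : Differentiable ℂ (deriv h) := hh.deriv
    have e : deriv (fun w => w ^ (j + 1) * h w) = fun w => w ^ j * ((j + 1) * h w + w * deriv h w) := by
      funext w
      have := ((hasDerivAt_pow (j + 1) w).mul (hh w).hasDerivAt)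
      refine this.deriv.trans ?_
      push_cast [Nat.add_sub_cancel]; ring
    rw [iteratedDeriv_succ', e, ih (by fun_prop)]
    push_cast [Nat.factorial_succ]; ring

theorem factorPow {H : ℂ → ℂ} (hH : Differentiable ℂ H) (j : ℕ) (h0 : ∀ i < j, iteratedDeriv i H 0 = 0) :
    ∃ h : ℂ → ℂ, Differentiable ℂ h ∧ ∀ w, H w = w ^ j * h w := by
  induction j with
  | zero => exact ⟨H, hH, by simp⟩
  | succ j ih =>
    obtain ⟨h, hh, e⟩ := ih fun i hi => h0 i (by omega)
    have h1 := h0 j (by omega)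
    rw [funext e, iterPow j hh] at h1
    have h2 : h 0 = 0 := (mul_eq_zero.1 h1).resolve_left (by exact_mod_cast j.factorial_ne_zero)
    refine ⟨dslope h 0, ?_, fun w => ?_⟩
    · rw [← differentiableOn_univ, Complex.differentiableOn_dslope (by simp)]
      exact hh.differentiableOn
    · have := sub_smul_dslope h 0 w
      rw [e w, pow_succ, mul_assoc]
      congr 1
      simpa [h2] using this.symm

theorem JF.itdMF {k t : ℤ} {f : Fn} (hf : JF k t f) (v : V8) (j : ℕ) (h0 : ∀ i < j, ∀ τ : ℂ, 0 < τ.im → itd v i f τ 0 = 0) :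
    MF (k + j) (fun τ => itd v j f τ 0) := by
  refine ⟨(hf.hol.itd v j).tau 0, fun a b c d hd τ hτ => ?_, ?_⟩
  · have hj := den_ne hd hτ
    have hτ' := im_mob hd hτ
    have hm := hf.modLine hd hτ v
    set J := (c : ℂ) * τ + (d : ℂ)
    set τ' := ((a : ℂ) * τ + (b : ℂ)) / J
    have i1 : ∀ i {τ : ℂ}, 0 < τ.im → itd v i f τ 0 = iteratedDeriv i (fun w : ℂ => f τ (w • v)) 0 := by
      intro i τ hτ; rw [itd_iter hf.hol hτ]; simp
    have hdH : Differentiable ℂ (fun w : ℂ => f τ (w • v)) := fun w => (zlineD hf.hol hτ v w).differentiableAt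
    obtain ⟨h, hh, e⟩ := factorPow hdH j (fun i hi => by rw [← i1 i hτ]; exact h0 i hi τ hτ)
    set A := (t : ℂ) * Real.pi * I * c * J * pc v v
    have e' : (fun w : ℂ => f τ' (w • v)) = fun w => w ^ j * (J ^ k * J ^ j * Complex.exp (A * w ^ 2) * h (J * w)) := by
      funext w
      rw [hm w, e (J * w), mul_pow]; ring
    rw [i1 j hτ', i1 j hτ, e', funext e, iterPow j (by fun_prop), iterPow j hh, zpow_add₀ hj, zpow_natCast]
    simp; ring
  · obtain ⟨C, Y, ε, hY, hε, h⟩ := Bd_iff.1 (hf.bd.itd hf.hol v j) 0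
    refine Asymptotics.IsBigO.of_bound C ?_
    filter_upwards [Iinf_basis.mem_of_mem (i := Y) trivial] with τ hτ
    simpa using h τ hτ 0 (by simpa using hε)
end E8J
end ModFp

section ModFq
open scoped Manifold
set_option linter.unusedVariables false
set_option linter.unusedSimpArgs false
namespace E8J

theorem pr_le (u : Fin 8 → ℝ) {c : ℝ} (h : ∀ i, |u i| ≤ c) : pr u u ≤ 30 * c ^ 2 := by
  have hc : 0 ≤ c := (abs_nonneg _).trans (h 0)
  have p : ∀ i j, u i * u j ≤ c ^ 2 ∧ - (u i * u j) ≤ c ^ 2 := by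
    intro i j
    have : |u i * u j| ≤ c ^ 2 := by
      rw [abs_mul, sq]; exact mul_le_mul (h i) (h j) (abs_nonneg _) hc
    exact ⟨(le_abs_self _).trans this, (neg_le_abs _).trans this⟩
  rw [pr_expand]
  linarith [(p 0 0).1, (p 1 1).1, (p 2 2).1, (p 3 3).1, (p 4 4).1, (p 5 5).1, (p 6 6).1, (p 7 7).1,
    (p 0 1).2, (p 1 0).2, (p 1 2).2, (p 2 1).2, (p 2 3).2, (p 3 2).2, (p 3 4).2, (p 4 3).2, (p 4 5).2, (p 5 4).2,
    (p 5 6).2, (p 6 5).2, (p 4 7).2, (p 7 4).2]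

def box : Set ((Fin 8 → ℝ) × (Fin 8 → ℝ)) := Set.Icc 0 1 ×ˢ Set.Icc 0 1

theorem JF.boxBound {k t : ℤ} {f : Fn} (hf : JF k t f) (ht : 0 ≤ t) {τ : ℂ} (hτ : 0 < τ.im) {C1 : ℝ}
    (hC1 : ∀ p ∈ box, ‖f τ (τ • rc p.1 + rc p.2)‖ ≤ C1) (u s : Fin 8 → ℝ) :
    ‖f τ (τ • rc u + rc s)‖ ≤ Real.exp (t * Real.pi * τ.im * pr u u) * C1 := by
  let x : L8 := fun i => ⌊u i⌋
  let y : L8 := fun i => ⌊s i⌋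
  let a : Fin 8 → ℝ := fun i => Int.fract (u i)
  let b : Fin 8 → ℝ := fun i => Int.fract (s i)
  have hab : (a, b) ∈ box := by
    refine ⟨⟨fun i => Int.fract_nonneg _, fun i => (Int.fract_lt_one _).le⟩, ⟨fun i => Int.fract_nonneg _, fun i => (Int.fract_lt_one _).le⟩⟩
  have hu : u = (fun i => (x i : ℝ)) + a := by
    funext i; exact (Int.floor_add_fract (u i)).symm
  have hz : τ • rc u + rc s = (τ • rc a + rc b) + τ • zc x + zc y := by
    funext i
    simp only [Pi.add_apply, Pi.smul_apply, smul_eq_mul, rc, zc, a, b, x, y]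
    have h1 : ((u i : ℝ) : ℂ) = (⌊u i⌋ : ℂ) + ((Int.fract (u i) : ℝ) : ℂ) := by
      exact_mod_cast congrArg (fun r : ℝ => (r:ℂ)) (Int.floor_add_fract (u i)).symm
    have h2 : ((s i : ℝ) : ℂ) = (⌊s i⌋ : ℂ) + ((Int.fract (s i) : ℝ) : ℂ) := by
      exact_mod_cast congrArg (fun r : ℝ => (r:ℂ)) (Int.floor_add_fract (s i)).symm
    rw [h1, h2]; ring
  have h1 := hf.ell x y τ hτ (τ • rc a + rc b)
  rw [shift_eq, ← hz] at h1
  rw [h1, norm_mul]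
  have b1 := hC1 _ hab
  refine mul_le_mul ?_ b1 (norm_nonneg _) (Real.exp_pos _).le
  rw [Complex.norm_exp, Real.exp_le_exp]
  have hxr : zc x = rc (fun i => (x i : ℝ)) := by funext i; simp [zc, rc]
  have e1 : pairC E8Gram (zc x) (zc x) * τ + 2 * pairC E8Gram (zc x) (τ • rc a + rc b) =
      ((pr (fun i => (x i : ℝ)) (fun i => (x i : ℝ)) + 2 * pr (fun i => (x i : ℝ)) a : ℝ) : ℂ) * τ + ((2 * pr (fun i => (x i : ℝ)) b : ℝ) : ℂ) := by
    change pc _ _ * τ + 2 * pc _ _ = _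
    rw [hxr, pc_add_right, pc_smul_right, pc_rc, pc_rc, pc_rc]; push_cast; ring
  rw [e1]
  have e2 := pr_add (fun i => (x i : ℝ)) a
  rw [← hu] at e2
  set Q := pr (fun i => (x i : ℝ)) (fun i => (x i : ℝ)) + 2 * pr (fun i => (x i : ℝ)) a with hQ
  set R := 2 * pr (fun i => (x i : ℝ)) b
  have e3 : (-(t : ℂ) * Real.pi * I * ((Q : ℂ) * τ + (R : ℂ))).re = t * Real.pi * τ.im * Q := by
    have : -(t : ℂ) * Real.pi * I * ((Q : ℂ) * τ + (R : ℂ)) = ((-(t * Real.pi) : ℝ) : ℂ) * (I * ((Q : ℂ) * τ + (R : ℂ))) := by push_cast; ring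
    rw [this, Complex.re_ofReal_mul]
    simp; ring
  rw [e3]
  have hq := pr_nonneg a
  have ht' : (0:ℝ) ≤ t := by exact_mod_cast ht
  have hc : 0 ≤ (t : ℝ) * Real.pi * τ.im := by positivity
  exact mul_le_mul_of_nonneg_left (by linarith) hc

theorem JF.vanish {k t : ℤ} {f : Fn} (hf : JF k t f) (ht : 0 ≤ t) {N : ℕ} (hN : 32000 * t ≤ N)
    (h0 : ∀ j ≤ N, ∀ v τ, 0 < τ.im → itd v j f τ 0 = 0) : ∀ τ, 0 < τ.im → ∀ z, f τ z = 0 := by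
  have hrc : Continuous rc := by unfold rc; fun_prop
  have key : ∀ τ : ℂ, ‖τ - I‖ < 1/2 → ∀ z, f τ z = 0 := by
    intro τ hτI
    have him : |τ.im - 1| < 1/2 := by
      have := Complex.abs_im_le_norm (τ - I)
      simp at this
      linarith
    rw [abs_lt] at him
    have hτ : 0 < τ.im := by linarith
    have hnτ : ‖τ‖ ≤ 3/2 := by
      have : τ = (τ - I) + I := by ring
      rw [this]; refine (norm_add_le _ _).trans ?_
      simp; linarith
    have hK : IsCompact box := isCompact_Icc.prod isCompact_Icc
    obtain ⟨p, hp, hmax⟩ := hK.exists_isMaxOn ⟨(0,0), by simp [box]⟩ (f := fun p => ‖f τ (τ • rc p.1 + rc p.2)‖)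
      ((hf.hol.cont hτ).comp (by fun_prop)).norm.continuousOn
    set S := ‖f τ (τ • rc p.1 + rc p.2)‖ with hS
    have hC1 : ∀ q ∈ box, ‖f τ (τ • rc q.1 + rc q.2)‖ ≤ S := fun q hq => hmax hq
    set z0 := τ • rc p.1 + rc p.2 with hz0
    have hz0n : ∀ i, ‖z0 i‖ ≤ 5/2 := by
      intro i
      simp only [hz0, Pi.add_apply, Pi.smul_apply, smul_eq_mul, rc]
      refine (norm_add_le _ _).trans ?_
      rw [norm_mul, Complex.norm_real, Complex.norm_real, Real.norm_eq_abs, Real.norm_eq_abs]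
      have q1 := hp.1.1 i
      have q2 := hp.1.2 i
      have q3 := hp.2.1 i
      have q4 := hp.2.2 i
      simp at q1 q2 q3 q4
      rw [abs_of_nonneg q1, abs_of_nonneg q3]
      nlinarith [norm_nonneg τ]
    have hdH : Differentiable ℂ (fun w : ℂ => f τ (w • z0)) := fun w => (zlineD hf.hol hτ z0 w).differentiableAt
    obtain ⟨h, hh, e⟩ := factorPow hdH (N + 1) (fun i hi => by
      rw [itd_iter hf.hol hτ]; simpa using h0 i (by omega) z0 τ hτ)
    have hT : ∀ w : ℂ, ‖w‖ = 3 → ‖h w‖ ≤ Real.exp (32000 * t) * S / 3 ^ (N + 1) := by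
      intro w hw
      rw [le_div_iff₀ (by positivity)]
      have e1 : ‖h w‖ * 3 ^ (N + 1) = ‖f τ (w • z0)‖ := by
        have := congrArg norm (e w)
        simp only [norm_mul, norm_pow, hw] at this
        rw [this]; ring
      rw [e1]
      choose s u hsu using fun i => lattice_coords hτ ((w • z0) i)
      have hz : w • z0 = τ • rc u + rc s := by
        funext i; rw [hsu i]; simp [rc]; ring
      rw [hz]
      refine (hf.boxBound ht hτ hC1 u s).trans (mul_le_mul_of_nonneg_right ?_ (norm_nonneg _))
      rw [Real.exp_le_exp]
      have hu : ∀ i, |u i| ≤ 15 := by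
        intro i
        have h1 : ((w • z0) i).im = u i * τ.im := by rw [hsu i]; simp
        have h2 := Complex.abs_im_le_norm ((w • z0) i)
        rw [h1, abs_mul, abs_of_pos hτ] at h2
        have h3 : ‖(w • z0) i‖ ≤ 15/2 := by
          rw [Pi.smul_apply, smul_eq_mul, norm_mul, hw]; linarith [hz0n i]
        nlinarith [abs_nonneg (u i)]
      have h1 := pr_le u hu
      have ht' : (0:ℝ) ≤ t := by exact_mod_cast ht
      have h2 : Real.pi * τ.im * pr u u ≤ 32000 := by
        have a1 : Real.pi * τ.im ≤ 3.15 * 1.5 := mul_le_mul (Real.pi_lt_d2.le) (by linarith) hτ.le (by norm_num)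
        calc Real.pi * τ.im * pr u u ≤ (3.15 * 1.5) * (30 * 15 ^ 2) := mul_le_mul a1 h1 (pr_nonneg u) (by norm_num)
          _ ≤ 32000 := by norm_num
      nlinarith
    have hm := maxmod hh (by norm_num : (0:ℝ) < 3) hT 1 (by norm_num)
    have e1 : ‖h 1‖ = S := by
      have := congrArg norm (e 1)
      simp only [one_smul, one_pow, one_mul] at this
      rw [← this]
    rw [e1, le_div_iff₀ (by positivity)] at hm
    have hexp : Real.exp (32000 * t) < 3 ^ (N + 1) := by
      have : (32000 * t : ℝ) ≤ N := by exact_mod_cast hN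
      calc Real.exp (32000 * t) ≤ Real.exp N := Real.exp_le_exp.2 this
        _ = Real.exp 1 ^ N := by rw [← Real.exp_nat_mul]; simp
        _ ≤ 3 ^ N := pow_le_pow_left₀ (Real.exp_pos _).le (Real.exp_one_lt_d9.le.trans (by norm_num)) _
        _ < 3 ^ (N + 1) := pow_lt_pow_right₀ (by norm_num) (by omega)
    have hS0 : S = 0 := by
      have : 0 ≤ S := norm_nonneg _
      nlinarith
    intro z
    choose s u hsu using fun i => lattice_coords hτ (z i)
    have hz : z = τ • rc u + rc s := by
      funext i; rw [hsu i]; simp [rc]; ring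
    have := hf.boxBound ht hτ hC1 u s
    rw [← hz, hS0, mul_zero] at this
    exact norm_le_zero_iff.1 this
  intro τ hτ z
  have hq : ((I, 0) : ℂ × V8) ∈ D := by simp [D]
  refine eqZeroOfOpen D_open D_convex hf.hol hq ?_ (τ, z) hτ
  have : ∀ᶠ x : ℂ × V8 in nhds (I, 0), ‖x.1 - I‖ < 1/2 := by
    have : Continuous fun x : ℂ × V8 => ‖x.1 - I‖ := by fun_prop
    refine this.continuousAt.eventually_lt continuousAt_const ?_
    simp
  filter_upwards [this] with x hx
  exact key x.1 hx x.2
end E8J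
end ModFq

section ModFr
open scoped Manifold
set_option linter.unusedVariables false
set_option linter.unusedSimpArgs false
namespace E8J

def Gc (N : ℕ) : ℕ := (N + 1) ^ 7
theorem Gc_pos (N : ℕ) : 0 < Gc N := by unfold Gc; positivity
def pts (N n : ℕ) : Fin 7 → Fin (N + 1) :=
  (finFunctionFinEquiv (m := N + 1) (n := 7)).symm ⟨n % Gc N, Nat.mod_lt _ (Gc_pos N)⟩
theorem pts_surj (N : ℕ) (a : Fin 7 → Fin (N + 1)) : ∃ n < Gc N, pts N n = a := by
  refine ⟨(finFunctionFinEquiv a).val, (finFunctionFinEquiv a).2, ?_⟩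
  unfold pts
  rw [Equiv.symm_apply_eq]
  exact Fin.ext (Nat.mod_eq_of_lt (finFunctionFinEquiv a).2)
theorem pts_add (N j n : ℕ) : pts N (j * Gc N + n) = pts N n := by
  unfold pts; congr 2; simp
def lam (N n : ℕ) (f : Fn) (τ : ℂ) : ℂ := itd (gpt (pts N n)) (n / Gc N) f τ 0

theorem JF.lamMF {k t : ℤ} {f : Fn} (hf : JF k t f) (N n : ℕ) (h0 : ∀ n' < n, ∀ τ : ℂ, 0 < τ.im → lam N n' f τ = 0) :
    MF (k + ((n / Gc N : ℕ) : ℤ)) (lam N n f) := by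
  refine hf.itdMF _ _ fun i hi τ hτ => ?_
  have h1 := h0 (i * Gc N + n % Gc N) (by
    calc i * Gc N + n % Gc N < i * Gc N + Gc N := by have := Nat.mod_lt n (Gc_pos N); omega
      _ = (i + 1) * Gc N := by ring
      _ ≤ n / Gc N * Gc N := Nat.mul_le_mul_right _ hi
      _ ≤ n := Nat.div_mul_le_self _ _) τ hτ
  unfold lam at h1
  rw [pts_add] at h1
  have e1 : (i * Gc N + n % Gc N) / Gc N = i := by
    rw [Nat.add_comm, Nat.add_mul_div_right _ _ (Gc_pos N), Nat.div_eq_of_lt (Nat.mod_lt n (Gc_pos N)), zero_add]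
  have e2 : pts N (n % Gc N) = pts N n := by unfold pts; congr 2; simp
  rwa [e1, e2] at h1

theorem MF.hol {k : ℤ} {f : ℂ → ℂ} (h : MF k f) : HolD (fun τ _ => f τ) := HolD.ofTau h.diff

theorem MF.mul_ne {k l : ℤ} {f g : ℂ → ℂ} (hf : MF k f) (hg : MF l g) (nf : ∃ τ, 0 < τ.im ∧ f τ ≠ 0) (ng : ∃ τ, 0 < τ.im ∧ g τ ≠ 0) :
    ∃ τ, 0 < τ.im ∧ f τ * g τ ≠ 0 := by
  by_contra hc
  push Not at hc
  obtain ⟨τ, hτ, h⟩ := ng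
  obtain ⟨τ', hτ', h'⟩ := nf
  exact h (HolD.canc hf.hol hg.hol (fun τ hτ _ => hc τ hτ) ⟨τ', hτ', 0, h'⟩ τ hτ 0)

theorem depend {ι : Type*} [DecidableEq ι] {t : ℤ} (ht : 0 ≤ t) {N : ℕ} (hN : 32000 * t ≤ N) (r : ℕ) :
    r ≤ (N + 1) * Gc N → ∀ (s : Finset ι) (k : ι → ℤ) (f : ι → Fn), (∀ i ∈ s, JF (k i) t (f i)) →
    (∀ i ∈ s, ∀ n < (N + 1) * Gc N - r, ∀ τ : ℂ, 0 < τ.im → lam N n (f i) τ = 0) → r < s.card →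
    ∃ (w : ℤ) (c : ι → ℂ → ℂ), (∀ i ∈ s, MF (w - k i) (c i)) ∧ (∃ i ∈ s, ∃ τ : ℂ, 0 < τ.im ∧ c i τ ≠ 0) ∧
      ∀ τ : ℂ, 0 < τ.im → ∀ z, ∑ i ∈ s, c i τ * f i τ z = 0 := by
  induction r with
  | zero =>
    intro _ s k f hf h0 hs
    obtain ⟨i0, hi0⟩ := Finset.card_pos.1 hs
    have hz : ∀ τ, 0 < τ.im → ∀ z, f i0 τ z = 0 := by
      refine (hf i0 hi0).vanish ht hN fun j hj v τ hτ => ?_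
      refine gridZero (hf i0 hi0).hol hj hτ (fun a => ?_) v
      obtain ⟨n, hn, e⟩ := pts_surj N a
      have := h0 i0 hi0 (j * Gc N + n) (by
        calc j * Gc N + n < j * Gc N + Gc N := by omega
          _ = (j + 1) * Gc N := by ring
          _ ≤ (N + 1) * Gc N := Nat.mul_le_mul_right _ (by omega)) τ hτ
      unfold lam at this
      rwa [pts_add, e, Nat.add_comm, Nat.add_mul_div_right _ _ (Gc_pos N), Nat.div_eq_of_lt hn, zero_add] at this
    refine ⟨k i0, fun i => if i = i0 then fun _ => 1 else fun _ => 0, fun i hi => ?_, ⟨i0, hi0, I, by simp, by simp⟩, fun τ hτ z => ?_⟩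
    · by_cases h : i = i0
      · subst h; simpa using MF.const 1
      · simp only [h, if_false]; exact MF.zero _
    · refine Finset.sum_eq_zero fun i hi => ?_
      by_cases h : i = i0
      · subst h; simp [hz τ hτ z]
      · simp [h]
  | succ r ih =>
    intro hr s k f hf h0 hs
    set n := (N + 1) * Gc N - (r + 1) with hn
    have hn1 : (N + 1) * Gc N - r = n + 1 := by omega
    by_cases hall : ∀ i ∈ s, ∀ τ : ℂ, 0 < τ.im → lam N n (f i) τ = 0
    · refine ih (by omega) s k f hf (fun i hi n' hn' τ hτ => ?_) (by omega)
      rw [hn1] at hn'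
      rcases Nat.lt_succ_iff_lt_or_eq.1 hn' with h | h
      · exact h0 i hi n' h τ hτ
      · rw [h]; exact hall i hi τ hτ
    · push Not at hall
      obtain ⟨i0, hi0, τ0, hτ0, hne⟩ := hall
      set j : ℤ := ((n / Gc N : ℕ) : ℤ) with hj
      have hμ : ∀ i ∈ s, MF (k i + j) (lam N n (f i)) := fun i hi => (hf i hi).lamMF N n (h0 i hi)
      have hl : ∀ i ∈ s, ∀ n' τ, 0 < τ.im → lam N n' (fun τ z => lam N n (f i0) τ * f i τ z - lam N n (f i) τ * f i0 τ z) τ =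
          lam N n (f i0) τ * lam N n' (f i) τ - lam N n (f i) τ * lam N n' (f i0) τ := by
        intro i hi n' τ hτ
        exact itd_lin (hf i hi).hol (hf i0 hi0).hol (lam N n (f i0)) (lam N n (f i)) _ _ hτ 0
      obtain ⟨w, c, hc, ⟨i1, hi1, τ1, hτ1, hne1⟩, hsum⟩ := ih (by omega) (s.erase i0) (fun i => k i + k i0 + j)
        (fun i τ z => lam N n (f i0) τ * f i τ z - lam N n (f i) τ * f i0 τ z) (fun i hi => by
          have hi := Finset.mem_of_mem_erase hi
          have a1 := JF.smulMF (hμ i0 hi0) (hf i hi)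
          have a2 := JF.smulMF (hμ i hi) (hf i0 hi0)
          have e1 : k i + k i0 + j = k i0 + j + k i := by ring
          have e2 : k i0 + j + k i = k i + j + k i0 := by ring
          simp only [e1]
          rw [← e2] at a2
          exact a1.sub a2) (fun i hi n' hn' τ hτ => by
          have hi := Finset.mem_of_mem_erase hi
          rw [hl i hi n' τ hτ]
          rw [hn1] at hn'
          rcases Nat.lt_succ_iff_lt_or_eq.1 hn' with h | h
          · rw [h0 i hi n' h τ hτ, h0 i0 hi0 n' h τ hτ]; ring
          · rw [h]; ring) (by rw [Finset.card_erase_of_mem hi0]; omega)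
      have hi1' := Finset.mem_erase.1 hi1
      refine ⟨w, fun i => if i = i0 then fun τ => ∑ l ∈ s.erase i0, (-1) * (c l τ * lam N n (f l) τ) else fun τ => c i τ * lam N n (f i0) τ,
        fun i hi => ?_, ⟨i1, hi1'.2, ?_⟩, fun τ hτ z => ?_⟩
      · by_cases h : i = i0
        · subst h
          simp only [if_true]
          have : ∀ u ⊆ s.erase i, MF (w - k i) (fun τ => ∑ l ∈ u, (-1) * (c l τ * lam N n (f l) τ)) := by
            intro u
            induction u using Finset.induction_on with
            | empty => intro _; simpa using MF.zero _
            | insert a u ha ih2 =>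
              intro hsub
              simp only [Finset.sum_insert ha]
              refine MF.add ?_ (ih2 fun x hx => hsub (Finset.mem_insert_of_mem hx))
              have ha' := hsub (Finset.mem_insert_self a u)
              have := ((hc a ha').mul (hμ a (Finset.mem_of_mem_erase ha'))).cmul (-1)
              have e : w - (k a + k i + j) + (k a + j) = w - k i := by ring
              rwa [e] at this
          exact this _ subset_rfl
        · simp only [h, if_false]
          have := (hc i (Finset.mem_erase.2 ⟨h, hi⟩)).mul (hμ i0 hi0)
          have e : w - (k i + k i0 + j) + (k i0 + j) = w - k i := by ring
          rwa [e] at this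
      · simp only [hi1'.1, if_false]
        exact MF.mul_ne (hc i1 hi1) (hμ i0 hi0) ⟨τ1, hτ1, hne1⟩ ⟨τ0, hτ0, hne⟩
      · rw [← Finset.add_sum_erase s _ hi0]
        simp only [if_true]
        rw [← hsum τ hτ z, Finset.sum_mul, ← Finset.sum_add_distrib]
        refine Finset.sum_congr rfl fun i hi => ?_
        rw [if_neg (Finset.ne_of_mem_erase hi)]; ring

theorem depend0 {ι : Type*} [DecidableEq ι] {t : ℤ} (ht : 0 ≤ t) {N : ℕ} (hN : 32000 * t ≤ N)
    (s : Finset ι) (k : ι → ℤ) (f : ι → Fn) (hf : ∀ i ∈ s, JF (k i) t (f i)) (hs : (N + 1) ^ 8 < s.card) :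
    ∃ (w : ℤ) (c : ι → ℂ → ℂ), (∀ i ∈ s, MF (w - k i) (c i)) ∧ (∃ i ∈ s, ∃ τ : ℂ, 0 < τ.im ∧ c i τ ≠ 0) ∧
      ∀ τ : ℂ, 0 < τ.im → ∀ z, ∑ i ∈ s, c i τ * f i τ z = 0 :=
  depend ht hN ((N + 1) * Gc N) le_rfl s k f hf (fun i hi n hn => by simp at hn) (by
    have : (N + 1) * Gc N = (N + 1) ^ 8 := by unfold Gc; ring
    omega)
end E8J
end ModFr

section ModFs
open scoped Manifold
set_option linter.unusedVariables false
set_option linter.unusedSimpArgs false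
namespace E8J

theorem zdd_mul {f g : Fn} (hf : HolD f) (hg : HolD g) (v : V8) {τ : ℂ} (hτ : 0 < τ.im) (z : V8) :
    zdd v (fun τ z => f τ z * g τ z) τ z = zdd v f τ z * g τ z + f τ z * zdd v g τ z := by
  have := ((hf.hasDeriv0 hτ z v).mul (hg.hasDeriv0 hτ z v)).deriv
  simp only [zero_smul, add_zero] at this
  exact this
theorem zdd_addf {f g : Fn} (hf : HolD f) (hg : HolD g) (v : V8) {τ : ℂ} (hτ : 0 < τ.im) (z : V8) :
    zdd v (fun τ z => f τ z + g τ z) τ z = zdd v f τ z + zdd v g τ z :=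
  ((hf.hasDeriv0 hτ z v).add (hg.hasDeriv0 hτ z v)).deriv
theorem zdd_tau (h : ℂ → ℂ) (v : V8) (τ : ℂ) (z : V8) : zdd v (fun τ _ => h τ) τ z = 0 := by
  simp [zdd]

def Kv (F : Fin 9 → Fn) (τ : ℂ) (z : V8) (v0 : ℂ) (v : V8) : Prop :=
  ∀ j, v0 * (sakaiIdx j : ℂ) * F j τ z + zdd v (F j) τ z = 0
def Kd (F : Fin 9 → Fn) (s : ℤ) (A : Fn) : Prop := HolD A ∧
  ∀ τ : ℂ, 0 < τ.im → ∀ z v0 v, Kv F τ z v0 v → v0 * (s : ℂ) * A τ z + zdd v A τ z = 0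

theorem Kd.mul {F : Fin 9 → Fn} {s t : ℤ} {A B : Fn} (hA : Kd F s A) (hB : Kd F t B) : Kd F (s + t) (fun τ z => A τ z * B τ z) := by
  refine ⟨hA.1.mul hB.1, fun τ hτ z v0 v h => ?_⟩
  have h1 := hA.2 τ hτ z v0 v h
  have h2 := hB.2 τ hτ z v0 v h
  rw [zdd_mul hA.1 hB.1 v hτ]
  push_cast
  linear_combination B τ z * h1 + A τ z * h2
theorem Kd.add {F : Fin 9 → Fn} {s : ℤ} {A B : Fn} (hA : Kd F s A) (hB : Kd F s B) : Kd F s (fun τ z => A τ z + B τ z) := by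
  refine ⟨hA.1.add hB.1, fun τ hτ z v0 v h => ?_⟩
  have h1 := hA.2 τ hτ z v0 v h
  have h2 := hB.2 τ hτ z v0 v h
  rw [zdd_addf hA.1 hB.1 v hτ]
  linear_combination h1 + h2
theorem Kd.tau (F : Fin 9 → Fn) {h : ℂ → ℂ} (hh : HolD (fun τ _ => h τ)) : Kd F 0 (fun τ _ => h τ) :=
  ⟨hh, fun τ hτ z v0 v _ => by rw [zdd_tau]; simp⟩
theorem Kd.zero (F : Fin 9 → Fn) (s : ℤ) : Kd F s (fun _ _ => 0) :=
  ⟨HolD.const 0, fun τ hτ z v0 v _ => by rw [zdd_tau (fun _ => 0)]; simp⟩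
theorem Kd.smul {F : Fin 9 → Fn} {s : ℤ} {A : Fn} {h : ℂ → ℂ} (hh : HolD (fun τ _ => h τ)) (hA : Kd F s A) :
    Kd F s (fun τ z => h τ * A τ z) := by
  simpa using (Kd.tau F hh).mul hA
theorem Kd.pow {F : Fin 9 → Fn} {s : ℤ} {A : Fn} (hA : Kd F s A) (n : ℕ) : Kd F (n * s) (fun τ z => A τ z ^ n) := by
  induction n with
  | zero => simpa using Kd.tau F (h := fun _ => 1) (HolD.const 1)
  | succ n ih =>
    have := ih.mul hA
    have e : ((n + 1 : ℕ) : ℤ) * s = n * s + s := by push_cast; ring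
    rw [e]; simpa only [pow_succ] using this
theorem Kd.sum {ι : Type*} {F : Fin 9 → Fn} {s : ℤ} (u : Finset ι) {A : ι → Fn} (hA : ∀ i ∈ u, Kd F s (A i)) :
    Kd F s (fun τ z => ∑ i ∈ u, A i τ z) := by
  classical
  induction u using Finset.induction_on with
  | empty => simpa using Kd.zero F s
  | insert a u ha ih =>
    simp only [Finset.sum_insert ha]
    exact (hA a (Finset.mem_insert_self _ _)).add (ih fun i hi => hA i (Finset.mem_insert_of_mem hi))
theorem Kd.prod {ι : Type*} {F : Fin 9 → Fn} {s : ι → ℤ} (u : Finset ι) {A : ι → Fn} (hA : ∀ i ∈ u, Kd F (s i) (A i)) :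
    Kd F (∑ i ∈ u, s i) (fun τ z => ∏ i ∈ u, A i τ z) := by
  classical
  induction u using Finset.induction_on with
  | empty => simpa using Kd.tau F (h := fun _ => 1) (HolD.const 1)
  | insert a u ha ih =>
    simp only [Finset.sum_insert ha, Finset.prod_insert ha]
    exact (hA a (Finset.mem_insert_self _ _)).mul (ih fun i hi => hA i (Finset.mem_insert_of_mem hi))
theorem Kd.F {F : Fin 9 → Fn} (hF : ∀ j, HolD (F j)) (j : Fin 9) : Kd F (sakaiIdx j) (F j) :=
  ⟨hF j, fun τ hτ z v0 v h => by simpa using h j⟩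

theorem algSum {F : Fin 9 → Fn} (hFind : AlgIndepOverM F) {κ : Type*} [Fintype κ] (dd : κ → Fin 9 → ℕ)
    (inj : Function.Injective dd) (c : κ → ℂ → ℂ) (hc : ∀ e, ∃ w, MF w (c e))
    (h0 : ∀ τ : ℂ, 0 < τ.im → ∀ z, ∑ e, c e τ * ∏ j, F j τ z ^ (dd e j) = 0) : ∀ e τ, 0 < τ.im → c e τ = 0 := by
  classical
  have hs : ∀ d, Function.extend dd c 0 d ≠ 0 → ∃ e, dd e = d := by
    intro d hd
    by_contra h
    exact hd (Function.extend_apply' _ _ _ h)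
  have := hFind (Function.extend dd c 0) ((Set.finite_range dd).subset fun d hd => hs d hd) (fun d hd => by
    obtain ⟨e, rfl⟩ := hs d hd
    rw [inj.extend_apply]
    obtain ⟨w, hw⟩ := hc e
    exact ⟨w, hw.toIs⟩) (fun τ hτ z => by
    rw [finsum_eq_sum_of_support_subset _ (s := Finset.univ.image dd), Finset.sum_image (fun a _ b _ h => inj h)]
    · simp only [inj.extend_apply]
      exact h0 τ hτ z
    · intro d hd
      have : Function.extend dd c 0 d ≠ 0 := by
        intro h; simp [h] at hd
      simpa using hs d this)
  intro e τ hτ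
  have h1 := this (dd e) τ hτ
  rwa [inj.extend_apply] at h1

/-- exponents of the monomials -/
def mexp (s : ℕ) (e : Fin 8 → Fin (s + 1)) (b : Fin (s + 1)) : Fin 9 → ℕ :=
  Fin.cons (37 * s - 8 * b.val - ∑ j : Fin 8, (e j).val * sakaiIdx j.succ) (fun j => (e j).val)
theorem mexp_idx (s : ℕ) (e : Fin 8 → Fin (s + 1)) (b : Fin (s + 1)) :
    ∑ j, (mexp s e b j : ℤ) * (sakaiIdx j : ℤ) = 37 * s - 8 * b.val := by
  have h : ∑ j : Fin 8, (e j).val * sakaiIdx j.succ ≤ 29 * s := by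
    calc ∑ j : Fin 8, (e j).val * sakaiIdx j.succ ≤ ∑ j : Fin 8, s * sakaiIdx j.succ :=
          Finset.sum_le_sum fun j _ => Nat.mul_le_mul_right _ (by have := (e j).2; omega)
      _ = s * ∑ j : Fin 8, sakaiIdx j.succ := by rw [Finset.mul_sum]
      _ = 29 * s := by rw [show ∑ j : Fin 8, sakaiIdx j.succ = 29 by decide]; ring
  have hb : b.val ≤ s := by omega
  rw [Fin.sum_univ_succ]
  simp only [mexp, Fin.cons_zero, Fin.cons_succ, show sakaiIdx 0 = 1 by decide]
  have e1 : ∑ j : Fin 8, ((e j).val : ℤ) * (sakaiIdx j.succ : ℤ) = ((∑ j : Fin 8, (e j).val * sakaiIdx j.succ : ℕ) : ℤ) := by push_cast; rfl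
  rw [e1]
  omega
theorem mexp_inj (s : ℕ) (b : Fin (s + 1)) : Function.Injective (fun e => mexp s e b) := by
  intro e e' h
  funext j
  have := congrFun h j.succ
  simp only [mexp, Fin.cons_succ] at this
  exact Fin.ext this

def Rel (F : Fin 9 → Fn) (x : Fn) (n : ℕ) : Prop := ∃ (t : ℤ) (A : ℕ → Fn), (∀ b : ℕ, Kd F (t - 8 * b) (A b)) ∧
  (∃ b ≤ n, ∃ τ : ℂ, 0 < τ.im ∧ ∃ z, A b τ z ≠ 0) ∧ ∀ τ : ℂ, 0 < τ.im → ∀ z, ∑ b ∈ Finset.range (n + 1), A b τ z * x τ z ^ b = 0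

theorem relExists {F : Fin 9 → Fn} (hF : ∀ j, JF (sakaiWt j) (sakaiIdx j) (F j)) (hFind : AlgIndepOverM F) {k : ℤ} {x : Fn}
    (hx : JF k 8 x) : ∃ n, Rel F x n := by
  let s : ℕ := 1184001 ^ 8
  have hs : ((32000 * 37 * s) + 1) ^ 8 < (s + 1) ^ 9 := by
    have hs1 : 1 ≤ s := Nat.one_le_pow _ _ (by norm_num)
    calc ((32000 * 37 * s) + 1) ^ 8 ≤ (1184001 * s) ^ 8 := Nat.pow_le_pow_left (by omega) _
      _ = s * s ^ 8 := by rw [mul_pow]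
      _ < (s + 1) ^ 9 := by
        rw [← pow_succ']; exact Nat.pow_lt_pow_left (by omega) (by norm_num)
  generalize s = s at hs
  let K : (Fin 8 → Fin (s + 1)) × Fin (s + 1) → ℤ := fun p => ∑ j, (mexp s p.1 p.2 j : ℤ) * sakaiWt j + p.2.val * k
  let f : (Fin 8 → Fin (s + 1)) × Fin (s + 1) → Fn := fun p τ z => (∏ j, F j τ z ^ (mexp s p.1 p.2 j)) * x τ z ^ p.2.val
  have hf : ∀ p, JF (K p) (37 * s) (f p) := by
    intro p
    have h1 := JF.prod Finset.univ (fun j _ => (hF j).pow (mexp s p.1 p.2 j))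
    have h2 := h1.mul (hx.pow p.2.val)
    rw [mexp_idx] at h2
    have e : (37 * (s:ℤ) - 8 * p.2.val) + (p.2.val : ℤ) * 8 = 37 * s := by ring
    rw [e] at h2
    exact h2
  obtain ⟨w, c, hc, ⟨p1, _, τ1, hτ1, hne⟩, hsum⟩ := depend0 (t := 37 * s) (by positivity) (N := 32000 * 37 * s) (by push_cast; linarith)
    Finset.univ K f (fun p _ => hf p) (by
      simp only [Finset.card_univ, Fintype.card_prod, Fintype.card_fun, Fintype.card_fin]
      rwa [← pow_succ])
  let A : ℕ → Fn := fun b τ z => if h : b < s + 1 then ∑ e : Fin 8 → Fin (s + 1), c (e, ⟨b, h⟩) τ * ∏ j, F j τ z ^ (mexp s e ⟨b, h⟩ j) else 0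
  refine ⟨s, 37 * s, A, fun b => ?_, ⟨p1.2.val, by omega, ?_⟩, fun τ hτ z => ?_⟩
  · by_cases h : b < s + 1
    · simp only [A, h, dif_pos]
      refine Kd.sum _ fun e _ => ?_
      have h1 := Kd.prod Finset.univ (fun j _ => (Kd.F (fun j => (hF j).hol) j).pow (mexp s e ⟨b, h⟩ j))
      rw [mexp_idx] at h1
      exact Kd.smul (hc _ (Finset.mem_univ _)).hol h1
    · simp only [A, h, dif_neg, not_false_eq_true]
      exact Kd.zero _ _
  · by_contra hcon
    push Not at hcon
    have := algSum hFind (fun e => mexp s e p1.2) (mexp_inj s p1.2) (fun e => c (e, p1.2)) (fun e => ⟨_, hc _ (Finset.mem_univ _)⟩)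
      (fun τ hτ z => by
        have := hcon τ hτ z
        simpa only [A, p1.2.2, dif_pos] using this)
    exact hne (this p1.1 τ1 hτ1)
  · rw [← hsum τ hτ z, Fintype.sum_prod_type_right, Finset.sum_range]
    refine Finset.sum_congr rfl fun b _ => ?_
    simp only [A, b.2, dif_pos, f, Finset.sum_mul]
    exact Finset.sum_congr rfl fun e _ => by ring

theorem killer {F : Fin 9 → Fn} (hF : ∀ j, JF (sakaiWt j) (sakaiIdx j) (F j)) (hFind : AlgIndepOverM F) {k : ℤ} {x : Fn}
    (hx : JF k 8 x) : ∃ B : Fn, HolD B ∧ (∃ τ : ℂ, 0 < τ.im ∧ ∃ z, B τ z ≠ 0) ∧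
      ∀ τ : ℂ, 0 < τ.im → ∀ z v0 v, Kv F τ z v0 v → B τ z * (v0 * 8 * x τ z + zdd v x τ z) = 0 := by
  classical
  have hex := relExists hF hFind hx
  obtain ⟨t, A, hA, hne, hsum⟩ := Nat.find_spec hex
  have hmin := fun m => @Nat.find_min _ _ hex m
  generalize Nat.find hex = n at *
  have hB : ∀ b, HolD (A b) := fun b => (hA b).1
  refine ⟨fun τ z => ∑ b ∈ Finset.range n, ((b:ℂ) + 1) * (A (b + 1) τ z * x τ z ^ b), ?_, ?_, ?_⟩
  · exact HolD.sum _ fun b _ => (HolD.const _).mul ((hB _).mul (hx.hol.pow b))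
  · by_contra hcon
    push Not at hcon
    have h0 : ∀ b < n, ∀ τ : ℂ, 0 < τ.im → ∀ z, A (b + 1) τ z = 0 := by
      intro b hb τ hτ z
      by_contra hA1
      refine hmin (n - 1) (by omega) ⟨t - 8, fun b τ z => ((b:ℂ) + 1) * A (b + 1) τ z, fun b => ?_, ⟨b, by omega, τ, hτ, z, ?_⟩, fun τ hτ z => ?_⟩
      · have := Kd.smul (h := fun _ => (b:ℂ) + 1) (HolD.const _) (hA (b + 1))
        have e : t - 8 - 8 * (b:ℤ) = t - 8 * ((b + 1 : ℕ) : ℤ) := by push_cast; ring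
        rw [e]; exact this
      · exact mul_ne_zero (by exact_mod_cast Nat.succ_ne_zero b) hA1
      · rw [Nat.sub_add_cancel (by omega)]
        rw [← hcon τ hτ z]
        exact Finset.sum_congr rfl fun b _ => by ring
    obtain ⟨b, hb, τ, hτ, z, hz⟩ := hne
    have h1 := hsum τ hτ z
    rw [Finset.sum_range_succ', Finset.sum_eq_zero (fun b hb => by rw [h0 b (by simpa using hb) τ hτ z, zero_mul])] at h1
    rcases b with _ | b
    · exact hz (by simpa using h1)
    · exact hz (h0 b (by omega) τ hτ z)
  · intro τ hτ z v0 v h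
    have hd : zdd v (fun τ z => ∑ b ∈ Finset.range (n + 1), A b τ z * x τ z ^ b) τ z = 0 := by
      rw [zdd_congr (g := fun _ _ => 0) (fun z => hsum τ hτ z)]
      exact zdd_tau (fun _ => 0) v τ z
    have hd2 : zdd v (fun τ z => ∑ b ∈ Finset.range (n + 1), A b τ z * x τ z ^ b) τ z =
        ∑ b ∈ Finset.range (n + 1), (zdd v (A b) τ z * x τ z ^ b + A b τ z * ((b:ℂ) * x τ z ^ (b - 1) * zdd v x τ z)) := by
      have := HasDerivAt.fun_sum (u := Finset.range (n + 1)) (fun b _ =>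
        ((hB b).hasDeriv0 hτ z v).mul ((hx.hol.hasDeriv0 hτ z v).pow b))
      have := this.deriv
      simp only [Pi.mul_apply, Pi.pow_apply, zero_smul, add_zero] at this
      exact this
    rw [hd2] at hd
    have h2 : ∀ b ∈ Finset.range (n + 1), zdd v (A b) τ z * x τ z ^ b + A b τ z * ((b:ℂ) * x τ z ^ (b - 1) * zdd v x τ z) =
        -(v0 * t) * (A b τ z * x τ z ^ b) + (b:ℂ) * (A b τ z * x τ z ^ (b - 1)) * (v0 * 8 * x τ z + zdd v x τ z) := by
      intro b _
      have := (hA b).2 τ hτ z v0 v h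
      push_cast at this
      rcases b with _ | b
      · simp at this ⊢; linear_combination x τ z ^ 0 * this
      · simp only [Nat.add_sub_cancel, pow_succ]
        push_cast at this ⊢
        linear_combination x τ z ^ b * x τ z * this
    rw [Finset.sum_congr rfl h2, Finset.sum_add_distrib, ← Finset.mul_sum, hsum τ hτ z, mul_zero, zero_add, ← Finset.sum_mul,
      Finset.sum_range_succ'] at hd
    simpa [mul_comm, mul_assoc, mul_left_comm] using hd
end E8J
end ModFs

section ModFt
open scoped Manifold
set_option linter.unusedVariables false
set_option linter.unusedSimpArgs false
namespace E8J

theorem zdd_thr (s : L8) (v : V8) {τ : ℂ} (hτ : 0 < τ.im) (z : V8) :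
    zdd v (thr s) τ z = pc (zc s) v * deriv (th τ) (pc (zc s) z) := by
  have h1 : HasDerivAt (fun w : ℂ => pc (zc s) z + w * pc (zc s) v) (pc (zc s) v) 0 := by
    simpa using ((hasDerivAt_id (0:ℂ)).mul_const (pc (zc s) v)).const_add (pc (zc s) z)
  have h2 : HasDerivAt (th τ) (deriv (th τ) (pc (zc s) z)) (pc (zc s) z + 0 * pc (zc s) v) := by
    rw [zero_mul, add_zero]; exact (th_diff hτ _).hasDerivAt
  have h3 := h2.comp (0:ℂ) h1
  have e : (fun w : ℂ => thr s τ (z + w • v)) = th τ ∘ (fun w : ℂ => pc (zc s) z + w * pc (zc s) v) := by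
    funext w; simp [thr, pc_add_right, pc_smul_right]
  unfold zdd
  rw [e, h3.deriv, mul_comm]

theorem pc_two (s : L8) (z : V8) : pc (zc ((2:ℤ) • s)) z = 2 * pc (zc s) z := by
  have : zc ((2:ℤ) • s) = (2:ℂ) • zc s := by funext i; simp [zc]
  rw [this, pc_smul_left]

def Qf (s : L8) : Fn := fun τ z => 4 * (thr ((2:ℤ) • s) τ z * zdd (zc s) (thr s) τ z) - thr s τ z * zdd (zc s) (thr ((2:ℤ) • s)) τ z
theorem Qf_hol (s : L8) : HolD (Qf s) :=
  ((HolD.const 4).mul ((thr_hol _).mul ((thr_hol s).zdd _))).sub ((thr_hol s).mul ((thr_hol _).zdd _))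
theorem Qf_dir (s : L8) (hs : pairE8 s s = 2) (v : V8) {τ : ℂ} (hτ : 0 < τ.im) (z : V8) :
    2 * (4 * (thr ((2:ℤ) • s) τ z * zdd v (thr s) τ z) - thr s τ z * zdd v (thr ((2:ℤ) • s)) τ z) = pc (zc s) v * Qf s τ z := by
  have h2 : pc (zc s) (zc s) = 2 := by rw [pc_int, hs]; norm_num
  unfold Qf
  simp only [zdd_thr _ _ hτ, pc_two, h2]; ring
theorem Qf_nonzero (s : L8) (hs : pairE8 s s = 2) {τ : ℂ} (hτ : 0 < τ.im) : ∃ z, Qf s τ z ≠ 0 := by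
  by_contra hc
  push Not at hc
  have h2 : pc (zc s) (zc s) = 2 := by rw [pc_int, hs]; norm_num
  have hH : ∀ w : ℂ, 8 * (th τ (2 * w) * deriv (th τ) w) - 4 * (th τ w * deriv (th τ) (2 * w)) = 0 := by
    intro w
    have := hc ((w / 2) • zc s)
    have e : w / 2 * 2 = w := by ring
    have e2 : w / 2 * (2 * 2) = 2 * w := by ring
    simp only [Qf, zdd_thr _ _ hτ, thr, pc_two, pc_smul_right, h2, e, e2] at this
    linear_combination this
  have ht : Differentiable ℂ (deriv (th τ)) := (th_diff hτ).deriv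
  have d0 := th_deriv0 hτ
  set α : ℂ := 2 * Real.pi * I with hα
  have l : HasDerivAt (fun w : ℂ => 2 * w) 2 0 := by simpa using (hasDerivAt_id (0:ℂ)).const_mul 2
  have dt : HasDerivAt (deriv (th τ)) (deriv (deriv (th τ)) 0) 0 := (ht 0).hasDerivAt
  have d2 : HasDerivAt (fun w => th τ (2 * w)) (α * 2) 0 := HasDerivAt.comp (h₂ := th τ) 0 (by simpa using d0) l
  have dt2 : HasDerivAt (fun w => deriv (th τ) (2 * w)) (deriv (deriv (th τ)) 0 * 2) 0 :=
    HasDerivAt.comp (h₂ := deriv (th τ)) 0 (by simpa using dt) l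
  have hd := (((d2.mul dt).const_mul 8).sub ((d0.mul dt2).const_mul 4)).deriv
  have e0 : deriv (((fun y => 8 * ((fun w => th τ (2 * w)) * deriv (th τ)) y) - fun y => 4 * (th τ * fun w => deriv (th τ) (2 * w)) y)) 0 = 0 := by
    have : ((fun y => 8 * ((fun w => th τ (2 * w)) * deriv (th τ)) y) - fun y => 4 * (th τ * fun w => deriv (th τ) (2 * w)) y) = fun _ => 0 := by
      funext w; exact hH w
    rw [this]; simp
  rw [e0] at hd
  simp only [mul_zero, th_zero hτ, d0.deriv, zero_mul, add_zero] at hd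
  have hα0 : α ≠ 0 := by simp [hα, Real.pi_ne_zero]
  have : α * α * 12 = 0 := by linear_combination -hd
  simp [hα0] at this

def ro (o : Option (Fin 8)) (a : Fin 8) : L8 := if o = some a then (2:ℤ) • OR a else OR a
def eo (o : Option (Fin 8)) (a : Fin 8) : ℕ := if o = some a then 1 else 4
def xo (o : Option (Fin 8)) : Fn := fun τ z => ∏ a, thr (ro o a) τ z ^ eo o a
theorem xo_JF (o : Option (Fin 8)) : JF (-(∑ i, (eo o i : ℤ))) 8 (xo o) := by
  refine thetaBlock Finset.univ (ro o) (eo o) 8 (ofInv Finset.univ (ro o) (eo o) 8 fun i j => ?_)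
  have e : ∀ a, (eo o a : ℤ) * (ro o a i * ro o a j) = 4 * (OR a i * OR a j) := by
    intro a
    unfold eo ro
    split_ifs <;> simp <;> ring
  rw [Finset.sum_congr rfl fun a _ => e a, ← Finset.mul_sum, OR_sum]; ring
theorem xo_rel (i : Fin 8) (τ : ℂ) (z : V8) :
    xo (some i) τ z * thr (OR i) τ z ^ 4 = xo none τ z * thr ((2:ℤ) • OR i) τ z := by
  unfold xo
  rw [← Finset.mul_prod_erase Finset.univ _ (Finset.mem_univ i), ← Finset.mul_prod_erase Finset.univ (fun a => thr (ro none a) τ z ^ eo none a) (Finset.mem_univ i)]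
  have : ∏ a ∈ Finset.univ.erase i, thr (ro (some i) a) τ z ^ eo (some i) a = ∏ a ∈ Finset.univ.erase i, thr (ro none a) τ z ^ eo none a := by
    refine Finset.prod_congr rfl fun a ha => ?_
    have := (Finset.ne_of_mem_erase ha).symm
    simp [ro, eo, this]
  rw [this]
  simp [ro, eo]; ring

theorem xo_kill {i : Fin 8} {τ : ℂ} (hτ : 0 < τ.im) {z : V8} {v0 : ℂ} {v : V8}
    (h0 : v0 * 8 * xo none τ z + zdd v (xo none) τ z = 0) (hi : v0 * 8 * xo (some i) τ z + zdd v (xo (some i)) τ z = 0) :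
    xo none τ z * (pc (zc (OR i)) v * Qf (OR i) τ z) = 0 := by
  have h4 : HolD (fun τ z => thr (OR i) τ z ^ 4) := (thr_hol _).pow 4
  have z4 : zdd v (fun τ z => thr (OR i) τ z ^ 4) τ z = 4 * thr (OR i) τ z ^ 3 * zdd v (thr (OR i)) τ z := by
    have := ((thr_hol (OR i)).hasDeriv0 hτ z v).pow 4
    have := this.deriv
    simp only [zero_smul, add_zero] at this
    refine Eq.trans ?_ (this.trans ?_)
    · rfl
    · norm_num
  have e := zdd_congr (f := fun τ z => xo (some i) τ z * thr (OR i) τ z ^ 4) (g := fun τ z => xo none τ z * thr ((2:ℤ) • OR i) τ z)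
    (xo_rel i τ) v z
  rw [zdd_mul (xo_JF _).hol h4 v hτ, zdd_mul (xo_JF _).hol (thr_hol _) v hτ, z4] at e
  have r := xo_rel i τ z
  rw [← Qf_dir (OR i) (by simp [OR_pair]) v hτ z]
  linear_combination 2 * thr (OR i) τ z * e - 2 * thr (OR i) τ z ^ 5 * hi + 2 * thr (OR i) τ z * thr ((2:ℤ) • OR i) τ z * h0
    + (16 * v0 * thr (OR i) τ z - 8 * zdd v (thr (OR i)) τ z) * r

theorem OR_ker {v : V8} (h : ∀ i, pc (zc (OR i)) v = 0) : v = 0 := by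
  have h1 : ∀ z, pc z v = 0 := by
    intro z
    have := ofInv Finset.univ OR (fun _ => 1) 2 (fun i j => by simpa using OR_sum i j) z v
    simp [h] at this
    exact this
  funext i
  rw [← inv_tr8 v i]
  refine Finset.sum_eq_zero fun j _ => ?_
  have := h1 (e8 j)
  rw [pc_tr8] at this
  simp [e8, Pi.single_apply] at this
  simp [this]

theorem Data.g_ne {F : Fin 9 → Fn} {g : ℂ → ℂ} (h : Data F g) (hFind : AlgIndepOverM F) : ∃ τ : ℂ, 0 < τ.im ∧ g τ ≠ 0 := by
  by_contra hc
  push Not at hc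
  choose B hB hBn hBk using fun o => killer h.jf hFind (xo_JF o)
  obtain ⟨p, hp, hn⟩ := commonNonzero D_open D_convex (Finset.univ : Finset (Option (Fin 8) ⊕ Fin 8 ⊕ Fin 8))
    (f := Sum.elim (fun o => unc (B o)) (Sum.elim (fun i => unc (Qf (OR i))) (fun i => unc (thr (OR i)))))
    (fun i _ => by
      rcases i with o | i | i
      · exact hB o
      · exact Qf_hol _
      · exact thr_hol _) D_nonempty (fun i _ => by
      rcases i with o | i | i
      · obtain ⟨τ, hτ, z, hz⟩ := hBn o
        exact ⟨(τ, z), hτ, hz⟩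
      · obtain ⟨z, hz⟩ := Qf_nonzero (OR i) (by simp [OR_pair]) (τ := I) (by simp)
        exact ⟨(I, z), by simp [D], hz⟩
      · obtain ⟨z, hz⟩ := thr_nonzero (r := OR i) (by simp [OR_pair]) (τ := I) (by simp)
        exact ⟨(I, z), by simp [D], hz⟩)
  obtain ⟨τ, z⟩ := p
  have hτ : 0 < τ.im := hp
  have nB : ∀ o, B o τ z ≠ 0 := fun o => hn (Sum.inl o) (Finset.mem_univ _)
  have nQ : ∀ i, Qf (OR i) τ z ≠ 0 := fun i => hn (Sum.inr (Sum.inl i)) (Finset.mem_univ _)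
  have nT : ∀ i, thr (OR i) τ z ≠ 0 := fun i => hn (Sum.inr (Sum.inr i)) (Finset.mem_univ _)
  have nx : xo none τ z ≠ 0 := by
    unfold xo
    refine Finset.prod_ne_zero_iff.2 fun a _ => pow_ne_zero _ ?_
    simpa [ro] using nT a
  have hdet : (jmat sakaiIdx F τ z).det = 0 := by
    rw [← jac_eq, h.jac τ hτ z, hc τ hτ, zero_mul]
  obtain ⟨v, hv, hvm⟩ := Matrix.exists_vecMul_eq_zero_iff.2 hdet
  have hK : Kv F τ z (v 0) (fun i => v i.succ) := by
    intro j
    have h1 := congrFun hvm j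
    simp only [Matrix.vecMul, dotProduct, jmat, Matrix.of_apply, Fin.sum_univ_succ (n := 8), Fin.cases_zero, Fin.cases_succ, Pi.zero_apply] at h1
    rw [zdd_lin (h.jf j).hol _ hτ]
    rw [← h1, mul_assoc]
  have hk : ∀ o, v 0 * 8 * xo o τ z + zdd (fun i => v i.succ) (xo o) τ z = 0 :=
    fun o => (mul_eq_zero.1 (hBk o τ hτ z _ _ hK)).resolve_left (nB o)
  have hv' : (fun i => v i.succ : V8) = 0 := OR_ker fun i => by
    have := xo_kill hτ (hk none) (hk (some i))
    exact (mul_eq_zero.1 ((mul_eq_zero.1 this).resolve_left nx)).resolve_right (nQ i)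
  have hv0 : v 0 = 0 := by
    have := hk none
    rw [hv'] at this
    have e : zdd 0 (xo none) τ z = 0 := by simp [zdd]
    rw [e, add_zero] at this
    have := (mul_eq_zero.1 this).resolve_right nx
    simpa using this
  apply hv
  funext i
  refine Fin.cases hv0 (fun i => congrFun hv' i) i
end E8J
end ModFt

section ModFu
open scoped Manifold
set_option linter.unusedVariables false
set_option linter.unusedSimpArgs false
namespace E8J

def mons (m : ℕ) : Finset (Fin 9 → ℕ) := (Fintype.piFinset fun _ : Fin 9 => Finset.range (m + 1)).filter fun d => ∑ j, d j * sakaiIdx j = m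
theorem sakaiIdx_pos (j : Fin 9) : 1 ≤ sakaiIdx j := by revert j; decide
theorem mem_mons (m : ℕ) (d : Fin 9 → ℕ) : d ∈ mons m ↔ ∑ j, d j * sakaiIdx j = m := by
  simp only [mons, Finset.mem_filter, Fintype.mem_piFinset, Finset.mem_range, and_iff_right_iff_imp]
  intro h j
  have h1 : d j * sakaiIdx j ≤ m := by
    rw [← h]; exact Finset.single_le_sum (f := fun j => d j * sakaiIdx j) (fun _ _ => Nat.zero_le _) (Finset.mem_univ j)
  have := Nat.le_mul_of_pos_right (d j) (sakaiIdx_pos j)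
  omega

def Rep (F : Fin 9 → Fn) (k : ℤ) (m : ℕ) (ψ : Fn) : Prop := ∃ c : (Fin 9 → ℕ) → ℂ → ℂ,
  (∀ d, MF (k - ∑ j, (d j : ℤ) * sakaiWt j) (c d)) ∧
  ∀ τ : ℂ, 0 < τ.im → ∀ z, ψ τ z = ∑ d ∈ mons m, c d τ * ∏ j, F j τ z ^ d j

theorem Rep.congr {F : Fin 9 → Fn} {k : ℤ} {m : ℕ} {ψ φ : Fn} (h : Rep F k m ψ) (e : ∀ τ : ℂ, 0 < τ.im → ∀ z, φ τ z = ψ τ z) :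
    Rep F k m φ := by
  obtain ⟨c, h1, h2⟩ := h
  exact ⟨c, h1, fun τ hτ z => (e τ hτ z).trans (h2 τ hτ z)⟩
theorem Rep.add {F : Fin 9 → Fn} {k : ℤ} {m : ℕ} {ψ φ : Fn} (h : Rep F k m ψ) (h' : Rep F k m φ) : Rep F k m (fun τ z => ψ τ z + φ τ z) := by
  obtain ⟨c, h1, h2⟩ := h
  obtain ⟨c', h1', h2'⟩ := h'
  refine ⟨fun d τ => c d τ + c' d τ, fun d => (h1 d).add (h1' d), fun τ hτ z => ?_⟩
  simp only [h2 τ hτ z, h2' τ hτ z, ← Finset.sum_add_distrib]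
  exact Finset.sum_congr rfl fun _ _ => by ring
theorem Rep.zero (F : Fin 9 → Fn) (k : ℤ) (m : ℕ) : Rep F k m (fun _ _ => 0) :=
  ⟨fun _ _ => 0, fun d => MF.zero _, fun τ hτ z => by simp⟩
theorem Rep.sum {ι : Type*} {F : Fin 9 → Fn} {k : ℤ} {m : ℕ} (u : Finset ι) {ψ : ι → Fn} (h : ∀ i ∈ u, Rep F k m (ψ i)) :
    Rep F k m (fun τ z => ∑ i ∈ u, ψ i τ z) := by
  classical
  induction u using Finset.induction_on with
  | empty => simpa using Rep.zero F k m
  | insert a u ha ih =>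
    simp only [Finset.sum_insert ha]
    exact (h a (Finset.mem_insert_self _ _)).add (ih fun i hi => h i (Finset.mem_insert_of_mem hi))
theorem Rep.smul {F : Fin 9 → Fn} {k l : ℤ} {m : ℕ} {ψ : Fn} {g : ℂ → ℂ} (hg : MF l g) (h : Rep F k m ψ) :
    Rep F (l + k) m (fun τ z => g τ * ψ τ z) := by
  obtain ⟨c, h1, h2⟩ := h
  refine ⟨fun d τ => g τ * c d τ, fun d => ?_, fun τ hτ z => ?_⟩
  · have := hg.mul (h1 d)
    rwa [← add_sub_assoc] at this
  · simp only [h2 τ hτ z, Finset.mul_sum]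
    exact Finset.sum_congr rfl fun _ _ => by ring
theorem Rep.ofMF (F : Fin 9 → Fn) {k : ℤ} {f : ℂ → ℂ} (hf : MF k f) : Rep F k 0 (fun τ _ => f τ) := by
  refine ⟨fun d => if d = 0 then f else fun _ => 0, fun d => ?_, fun τ hτ z => ?_⟩
  · by_cases h : d = 0
    · subst h; simpa using hf
    · simp only [h, if_false]; exact MF.zero _
  · have : mons 0 = {0} := by
      ext d
      rw [mem_mons, Finset.mem_singleton]
      constructor
      · intro h
        funext j
        have := Finset.sum_eq_zero_iff.1 h j (Finset.mem_univ j)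
        exact (Nat.mul_eq_zero.1 this).resolve_right (by have := sakaiIdx_pos j; omega)
      · rintro rfl; simp
    rw [this]; simp
theorem Rep.mulF {F : Fin 9 → Fn} {k : ℤ} {m : ℕ} {ψ : Fn} (h : Rep F k m ψ) (i : Fin 9) :
    Rep F (k + sakaiWt i) (m + sakaiIdx i) (fun τ z => F i τ z * ψ τ z) := by
  classical
  obtain ⟨c, h1, h2⟩ := h
  have hinj : Function.Injective (fun d : Fin 9 → ℕ => d + Pi.single i 1) := add_left_injective _
  refine ⟨fun d => if d i = 0 then fun _ => 0 else c (d - Pi.single i 1), fun d => ?_, fun τ hτ z => ?_⟩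
  · by_cases hd : d i = 0
    · simp only [hd, if_true]; exact MF.zero _
    · simp only [hd, if_false]
      have := h1 (d - Pi.single i 1)
      have e : ∑ j, ((d - Pi.single i 1 : Fin 9 → ℕ) j : ℤ) * sakaiWt j = ∑ j, (d j : ℤ) * sakaiWt j - sakaiWt i := by
        rw [eq_sub_iff_add_eq]
        have : sakaiWt i = ∑ j, ((Pi.single i 1 : Fin 9 → ℕ) j : ℤ) * sakaiWt j := by
          simp [Pi.single_apply]
        rw [this, ← Finset.sum_add_distrib]
        refine Finset.sum_congr rfl fun j _ => ?_
        rw [← add_mul]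
        congr 1
        by_cases hj : j = i
        · subst hj; simp; omega
        · simp [hj]
      rw [e] at this
      have e2 : k + sakaiWt i - ∑ j, (d j : ℤ) * sakaiWt j = k - (∑ j, (d j : ℤ) * sakaiWt j - sakaiWt i) := by ring
      rwa [e2]
  · have hsub : (mons m).image (fun d => d + Pi.single i 1) ⊆ mons (m + sakaiIdx i) := by
      intro d' hd'
      obtain ⟨d, hd, rfl⟩ := Finset.mem_image.1 hd'
      rw [mem_mons] at hd ⊢
      simp [add_mul, Finset.sum_add_distrib, hd, Pi.single_apply]
    show F i τ z * ψ τ z = _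
    rw [← Finset.sum_subset hsub, Finset.sum_image (fun a _ b _ h => hinj h), h2 τ hτ z, Finset.mul_sum]
    · refine Finset.sum_congr rfl fun d _ => ?_
      have e1 : (d + Pi.single i 1 : Fin 9 → ℕ) i ≠ 0 := by simp
      have e2 : d + Pi.single i 1 - Pi.single i 1 = d := by funext j; simp
      have e3 : ∏ j, F j τ z ^ (Pi.single i 1 : Fin 9 → ℕ) j = F i τ z := by
        rw [Finset.prod_eq_single i]
        · simp
        · intro j _ hj; simp [hj]
        · simp
      simp only [e1, if_false, e2]
      simp only [Pi.add_apply, pow_add, Finset.prod_mul_distrib, e3]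
      ring
    · intro d hd hn
      by_cases hz : d i = 0
      · simp [hz]
      · exfalso
        apply hn
        rw [Finset.mem_image]
        have hdd : d - Pi.single i 1 + Pi.single i 1 = d := by
          funext j
          by_cases hj : j = i
          · subst hj; simp; omega
          · simp [hj]
        refine ⟨d - Pi.single i 1, ?_, hdd⟩
        rw [mem_mons] at hd ⊢
        rw [← hdd] at hd
        simp only [Pi.add_apply, add_mul, Finset.sum_add_distrib] at hd
        have : ∑ j, (Pi.single i 1 : Fin 9 → ℕ) j * sakaiIdx j = sakaiIdx i := by simp [Pi.single_apply]
        omega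

/-- index one -/
theorem indexOne {F0 ψ : Fn} {G g : ℂ → ℂ} {k : ℤ} (hF0 : JF 4 1 F0) {c : ℕ → (Fin 8 → ℚ) → ℂ} (hc : FourierRep E8Gram F0 c)
    (h0 : ∀ ℓ : Fin 8 → ℚ, c 0 ℓ = if ℓ = 0 then 1 else 0) (hψ : JF k 1 ψ) (hg : HolD (fun τ _ => g τ))
    (hgn : ∃ τ : ℂ, 0 < τ.im ∧ g τ ≠ 0) (e : ∀ τ : ℂ, 0 < τ.im → ∀ z, g τ * ψ τ z = F0 τ z * G τ) :
    ∃ h : ℂ → ℂ, MF (k - 4) h ∧ ∀ τ : ℂ, 0 < τ.im → ∀ z, ψ τ z = F0 τ z * h τ := by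
  classical
  have hW : ∀ z' τ, 0 < τ.im → ∀ z, ψ τ z * F0 τ z' = ψ τ z' * F0 τ z := by
    intro z' τ hτ z
    rw [← sub_eq_zero]
    obtain ⟨τ0, hτ0, hg0⟩ := hgn
    refine HolD.canc hg (h := fun τ z => ψ τ z * F0 τ z' - ψ τ z' * F0 τ z) 
      ((hψ.hol.mul (HolD.ofTau (hF0.hol.tau z'))).sub ((HolD.ofTau (hψ.hol.tau z')).mul hF0.hol)) ?_ ⟨τ0, hτ0, 0, hg0⟩ τ hτ z
    intro τ hτ z
    have e1 := e τ hτ z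
    have e2 := e τ hτ z'
    linear_combination F0 τ z' * e1 - F0 τ z * e2
  have hne : ∀ τ : ℂ, ∃ z, 0 < τ.im → F0 τ z ≠ 0 := by
    intro τ
    by_cases hτ : 0 < τ.im
    · obtain ⟨z, hz⟩ := F0_nonzero hF0 hc h0 hτ
      exact ⟨z, fun _ => hz⟩
    · exact ⟨0, fun h => absurd h hτ⟩
  choose zz hzz using hne
  let h : ℂ → ℂ := fun τ => ψ τ (zz τ) / F0 τ (zz τ)
  have hh : ∀ τ : ℂ, 0 < τ.im → ∀ z, ψ τ z = F0 τ z * h τ := by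
    intro τ hτ z
    have := hW (zz τ) τ hτ z
    have hn := hzz τ hτ
    simp only [h]
    field_simp
    linear_combination this
  refine ⟨h, ⟨?_, ?_, ?_⟩, hh⟩
  · intro τ0 hτ0
    have hτ0' : 0 < τ0.im := hτ0
    have hd : DifferentiableWithinAt ℂ (fun τ => ψ τ (zz τ0) / F0 τ (zz τ0)) {τ : ℂ | 0 < τ.im} τ0 :=
      (hψ.hol.tau (zz τ0) τ0 hτ0).div (hF0.hol.tau (zz τ0) τ0 hτ0) (hzz τ0 hτ0')
    refine hd.congr_of_eventuallyEq ?_ ?_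
    · have hcn : ContinuousWithinAt (fun τ => F0 τ (zz τ0)) {τ : ℂ | 0 < τ.im} τ0 := (hF0.hol.tau (zz τ0) τ0 hτ0).continuousWithinAt
      filter_upwards [hcn.eventually_ne (hzz τ0 hτ0'), self_mem_nhdsWithin] with τ h1 h2
      rw [hh τ h2 (zz τ0)]; field_simp
    · rw [hh τ0 hτ0 (zz τ0)]
      have := hzz τ0 hτ0'
      field_simp
  · intro a b c d hdet τ hτ
    have hj := den_ne hdet hτ
    have hτ' := im_mob hdet hτ
    have m1 := hψ.mod a b c d hdet τ hτ (zz τ)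
    have m2 := hF0.mod a b c d hdet τ hτ (zz τ)
    rw [hh _ hτ', m2, hh τ hτ] at m1
    have hn := hzz τ hτ
    have hE := Complex.exp_ne_zero (((1:ℤ) : ℂ) * (Real.pi : ℂ) * Complex.I * (c : ℂ) * pairC E8Gram (zz τ) (zz τ) / ((c : ℂ) * τ + (d : ℂ)))
    rw [zpow_sub₀ hj]
    have h4 : ((c : ℂ) * τ + (d : ℂ)) ^ (4:ℤ) ≠ 0 := zpow_ne_zero _ hj
    rw [div_mul_eq_mul_div, eq_div_iff h4]
    apply mul_left_cancel₀ (mul_ne_zero hE hn)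
    linear_combination m1
  · obtain ⟨C, Y, ε, hY, hε, hb⟩ := Bd_iff.1 hψ.bd 0
    obtain ⟨C', hC'⟩ := fourierLimit hc h0 0
    have hlim : ∀ᶠ y : ℝ in Filter.atTop, C' * Real.exp (-(2 * Real.pi * (y - 1))) < 1/2 := by
      have : Filter.Tendsto (fun y : ℝ => C' * Real.exp (-(2 * Real.pi * (y - 1)))) Filter.atTop (nhds (C' * 0)) := by
        refine Filter.Tendsto.const_mul _ ?_
        refine Real.tendsto_exp_neg_atTop_nhds_zero.comp ?_
        exact Filter.Tendsto.const_mul_atTop (by positivity) (Filter.tendsto_atTop_add_const_right _ (-1) Filter.tendsto_id)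
      rw [mul_zero] at this
      exact this.eventually_lt_const (by norm_num)
    refine Asymptotics.IsBigO.of_bound (2 * C) ?_
    have hl2 : ∀ᶠ τ : ℂ in Iinf, C' * Real.exp (-(2 * Real.pi * (τ.im - 1))) < 1/2 := Filter.tendsto_comap.eventually hlim
    filter_upwards [hl2, Iinf_basis.mem_of_mem (i := max Y 1) trivial] with τ h1 h2
    have hY2 : Y ≤ τ.im := (le_max_left _ _).trans h2
    have h12 : 1 ≤ τ.im := (le_max_right _ _).trans h2
    have b1 := hb τ hY2 0 (by simpa using hε)
    have b2 := (hC' τ h12 0 (by simp)).trans h1.le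
    have b3 : 1/2 ≤ ‖F0 τ 0‖ := by
      have := norm_sub_norm_le (1:ℂ) (1 - F0 τ 0)
      rw [norm_sub_rev] at b2
      simp at this
      linarith
    rw [hh τ (by linarith) 0, norm_mul] at b1
    simp only [norm_one, mul_one]
    nlinarith [norm_nonneg (h τ)]

theorem Data.main {F : Fin 9 → Fn} {g : ℂ → ℂ} (h : Data F g) (hFind : AlgIndepOverM F) {c : ℕ → (Fin 8 → ℚ) → ℂ}
    (hc : FourierRep E8Gram (F 0) c) (h0 : ∀ ℓ : Fin 8 → ℚ, c 0 ℓ = if ℓ = 0 then 1 else 0) (m : ℕ) : ∀ (k : ℤ) (ψ : Fn),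
    JF k m ψ → Inv ψ → Rep F (k + 172 * ((m - 1 : ℕ) : ℤ)) m (fun τ z => g τ ^ (m - 1) * ψ τ z) := by
  induction m using Nat.strong_induction_on with
  | _ m ih =>
  intro k ψ hψ hi
  have hg := h.g_ne hFind
  rcases Nat.eq_zero_or_pos m with hm | hm
  · subst hm
    have := Rep.ofMF F hψ.toMF0
    simp only [Nat.zero_sub, Nat.cast_zero, mul_zero, add_zero, pow_zero, one_mul]
    exact this.congr fun τ hτ z => hψ.constz (by simp) hτ z
  obtain ⟨f, hf, hfi, e⟩ := h.step hg hψ hi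
  rcases Nat.eq_or_lt_of_le hm with hm1 | hm2
  · have hm1 : m = 1 := hm1.symm
    subst hm1
    have hF0 : JF 4 1 (F 0) := by simpa [sakaiWt, sakaiIdx] using h.jf 0
    obtain ⟨q, hq, hq2⟩ := indexOne (ψ := ψ) (k := k) (G := fun τ => f 0 τ 0) hF0 hc h0 (by simpa using hψ) h.mf.hol hg (fun τ hτ z => by
      have := e τ hτ z
      rw [Finset.sum_eq_single 0 (fun j _ hj => by
        rw [(hf j).negIndex (by revert hj; revert j; decide) hτ z]; ring) (by simp)] at this
      rw [(hf 0).constz (by decide) hτ z] at this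
      simpa [sakaiIdx] using this)
    have := (Rep.ofMF F hq).mulF 0
    simp only [Nat.sub_self, Nat.cast_zero, mul_zero, add_zero, pow_zero, one_mul]
    have e1 : k - 4 + sakaiWt 0 = k := by simp [sakaiWt]
    have e2 : 0 + sakaiIdx 0 = 1 := by decide
    rw [e1, e2] at this
    exact this.congr hq2
  · have hm2 : 2 ≤ m := hm2
    have key : ∀ j, Rep F (k + 172 * ((m - 1 : ℕ) : ℤ)) m (fun τ z => ((sakaiIdx j : ℂ) / m) * (F j τ z * (g τ ^ (m - 2) * f j τ z))) := by
      intro j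
      by_cases hj : sakaiIdx j ≤ m
      · have hp := sakaiIdx_pos j
        have r1 := ih (m - sakaiIdx j) (by omega) _ (f j) (by
          have := hf j
          rwa [← Nat.cast_sub hj] at this) (hfi j)
        have r2 := r1.smul (h.mf.pow (m - 2 - (m - sakaiIdx j - 1)))
        have r3 := (r2.mulF j).smul (MF.const ((sakaiIdx j : ℂ) / m))
        have e1 : m - sakaiIdx j + sakaiIdx j = m := by omega
        have e2 : 0 + (((m - 2 - (m - sakaiIdx j - 1) : ℕ) : ℤ) * 172 + (k - sakaiWt j + 172 + 172 * ((m - sakaiIdx j - 1 : ℕ) : ℤ)) + sakaiWt j) =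
            k + 172 * ((m - 1 : ℕ) : ℤ) := by
          have : (((m - 2 - (m - sakaiIdx j - 1) : ℕ) : ℤ)) = ((m - 1 : ℕ) : ℤ) - 1 - ((m - sakaiIdx j - 1 : ℕ) : ℤ) := by omega
          rw [this]; ring
        rw [e1, e2] at r3
        refine r3.congr fun τ hτ z => ?_
        rw [← mul_assoc (g τ ^ _) (g τ ^ _), ← pow_add]
        congr 5
        omega
      · refine (Rep.zero F _ _).congr fun τ hτ z => ?_
        rw [(hf j).negIndex (by push Not at hj; omega) hτ z]; ring
    refine (Rep.sum Finset.univ fun j _ => key j).congr fun τ hτ z => ?_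
    have := e τ hτ z
    have hm0 : (m : ℂ) ≠ 0 := by exact_mod_cast (by omega : m ≠ 0)
    have hp : g τ ^ (m - 1) = g τ ^ (m - 2) * g τ := by rw [← pow_succ]; congr 1; omega
    rw [hp]
    apply mul_left_cancel₀ hm0
    have e3 : (m:ℂ) * ∑ j, ((sakaiIdx j : ℂ) / m) * (F j τ z * (g τ ^ (m - 2) * f j τ z)) = g τ ^ (m - 2) * ∑ j, (sakaiIdx j : ℂ) * (F j τ z * f j τ z) := by
      rw [Finset.mul_sum, Finset.mul_sum]
      refine Finset.sum_congr rfl fun j _ => ?_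
      field_simp
    rw [e3, ← this]; ring
end E8J
end ModFu

section ModFv
open scoped Manifold
set_option linter.unusedVariables false
set_option linter.unusedSimpArgs false
namespace E8J

theorem g_elliptic {g : ℂ → ℂ} (h : MF 172 g) : ∃ ρ : ℂ, 0 < ρ.im ∧ g ρ = 0 := by
  let ρ : ℂ := ⟨-1/2, Real.sqrt 3 / 2⟩
  have h3 : Real.sqrt 3 * Real.sqrt 3 = 3 := Real.mul_self_sqrt (by norm_num)
  have him : 0 < ρ.im := by
    show 0 < Real.sqrt 3 / 2
    positivity
  have hq : ρ ^ 2 + ρ + 1 = 0 := by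
    rw [pow_two]
    apply Complex.ext
    · simp only [ρ, Complex.add_re, Complex.mul_re, Complex.one_re, Complex.zero_re]
      nlinarith
    · simp only [ρ, Complex.add_im, Complex.mul_im, Complex.one_im, Complex.zero_im]
      nlinarith
  refine ⟨ρ, him, ?_⟩
  have h1 : ρ + 1 ≠ 0 := by
    intro h0
    have : (ρ + 1).im = 0 := by rw [h0]; simp
    simp at this
    linarith
  have hl := h.law 0 (-1) 1 1 (by norm_num) ρ him
  push_cast at hl
  have e1 : (0 * ρ + -1) / (1 * ρ + 1) = ρ := by
    rw [div_eq_iff (by simpa using h1)]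
    linear_combination -hq
  have hc : ρ ^ 3 = 1 := by linear_combination (ρ - 1) * hq
  have e2 : (1 * ρ + 1) ^ (172 : ℤ) = ρ ^ 2 := by
    have : 1 * ρ + 1 = - ρ ^ 2 := by linear_combination hq
    rw [this]
    have e : (-ρ ^ 2) ^ (172 : ℤ) = (-ρ ^ 2) ^ (172 : ℕ) := by norm_cast
    rw [e]
    calc (-ρ ^ 2) ^ (172 : ℕ) = (ρ ^ 3) ^ 114 * ρ ^ 2 := by ring
      _ = ρ ^ 2 := by rw [hc]; ring
  rw [e1, e2] at hl
  have h4 : ρ ^ 2 - 1 ≠ 0 := by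
    intro h0
    have : ρ = -2 := by linear_combination hq - h0
    rw [this] at him
    simp at him
  have : (ρ ^ 2 - 1) * g ρ = 0 := by linear_combination -hl
  exact (mul_eq_zero.1 this).resolve_left h4

theorem fsum_mons {m : ℕ} (c : (Fin 9 → ℕ) → ℂ → ℂ) (τ : ℂ) (P : (Fin 9 → ℕ) → ℂ) :
    ∑ᶠ d : Fin 9 → ℕ, (if d ∈ mons m then c d else fun _ => 0) τ * P d = ∑ d ∈ mons m, c d τ * P d := by
  rw [finsum_eq_sum_of_support_subset _ (s := mons m)]
  · refine Finset.sum_congr rfl fun d hd => ?_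
    simp [hd]
  · intro d hd
    by_contra hn
    have hn' : d ∉ mons m := by simpa using hn
    exact hd (by simp [hn'])

theorem fin_mons {m : ℕ} (c : (Fin 9 → ℕ) → ℂ → ℂ) :
    {d : Fin 9 → ℕ | (if d ∈ mons m then c d else fun _ => 0) ≠ 0}.Finite := by
  refine (mons m).finite_toSet.subset ?_
  intro d hd
  by_contra hn
  have hn' : d ∉ mons m := by simpa using hn
  exact hd (by simp [hn']; rfl)

theorem prodDiv (F : Fin 9 → ℂ) (x : ℂ) {m : ℕ} {d : Fin 9 → ℕ} (hd : d ∈ mons m) :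
    ∏ j, (F j / x ^ (sakaiIdx j)) ^ (d j) = (∏ j, F j ^ d j) / x ^ m := by
  rw [mem_mons] at hd
  simp only [div_pow, Finset.prod_div_distrib, ← pow_mul]
  rw [Finset.prod_pow_eq_pow_sum, ← hd]
  congr 2
  exact Finset.sum_congr rfl fun j _ => mul_comm _ _

theorem part3 {F : Fin 9 → Fn} (hFind : AlgIndepOverM F) {k : ℤ} {m : ℕ} {ψ : Fn} (h : Rep F k m ψ) :
    ∃ c : (Fin 9 → ℕ) → ℂ → ℂ, MPolyRep sakaiWt sakaiIdx F k m c ψ ∧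
      ∀ c' : (Fin 9 → ℕ) → ℂ → ℂ, MPolyRep sakaiWt sakaiIdx F k m c' ψ → ∀ d τ, 0 < τ.im → c d τ = c' d τ := by
  classical
  obtain ⟨c, h1, h2⟩ := h
  let c0 : (Fin 9 → ℕ) → ℂ → ℂ := fun d => if d ∈ mons m then c d else fun _ => 0
  have hM0 : ∀ d, MF (k - ∑ j, (d j : ℤ) * sakaiWt j) (c0 d) := by
    intro d
    by_cases hd : d ∈ mons m
    · simp only [c0, hd, if_true]; exact h1 d
    · simp only [c0, hd, if_false]; exact MF.zero _
  have hr : MPolyRep sakaiWt sakaiIdx F k m c0 ψ := by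
    refine ⟨fin_mons c, fun d hd => ⟨?_, (hM0 d).toIs⟩, fun τ hτ z => ?_⟩
    · rw [← mem_mons]
      by_contra hn
      exact hd (by simp only [c0, hn, if_false]; rfl)
    · rw [h2 τ hτ z]; exact (fsum_mons c τ _).symm
  refine ⟨c0, hr, fun c' hc' d τ hτ => ?_⟩
  obtain ⟨f1, f2, f3⟩ := hc'
  have hM' : ∀ d, MF (k - ∑ j, (d j : ℤ) * sakaiWt j) (c' d) := by
    intro d
    by_cases hd : c' d = 0
    · rw [hd]; exact MF.zero _
    · exact IsModularForm.toMF (f2 d hd).2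
  have hfs : ∀ (u : (Fin 9 → ℕ) → ℂ → ℂ) (τ : ℂ) (P : (Fin 9 → ℕ) → ℂ), {d | u d ≠ 0}.Finite →
      (Function.support fun d => u d τ * P d).Finite := by
    intro u τ P hu
    refine hu.subset fun d hd h0 => hd ?_
    simp [h0]
  have := hFind (fun d τ => c0 d τ + (-1) * c' d τ) ?_ ?_ ?_ d τ hτ
  · linear_combination this
  · refine (hr.1.union f1).subset fun d hd => ?_
    by_contra hn
    simp only [Set.mem_union, Set.mem_setOf_eq, not_or, not_not] at hn
    apply hd
    funext τ
    simp [hn.1, hn.2]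
  · intro d _
    exact ⟨_, ((hM0 d).add ((hM' d).cmul (-1))).toIs⟩
  · intro τ hτ z
    have e1 := hr.2.2 τ hτ z
    have e2 := f3 τ hτ z
    have e3 : ∀ d : Fin 9 → ℕ, (c0 d τ + (-1) * c' d τ) * ∏ j, F j τ z ^ d j = c0 d τ * ∏ j, F j τ z ^ d j - c' d τ * ∏ j, F j τ z ^ d j := by
      intro d; ring
    simp only [e3]
    rw [finsum_sub_distrib (hfs c0 τ _ hr.1) (hfs c' τ _ f1), ← e1, ← e2, sub_self]

theorem part4 {F : Fin 9 → Fn} {g : ℂ → ℂ} (hg : MF 172 g) {k l : ℤ} {m : ℕ} {ψ : Fn}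
    (h : Rep F l m (fun τ z => g τ ^ (m - 1) * ψ τ z)) :
    ∃ c : (Fin 9 → ℕ) → ℂ → ℂ, {d : Fin 9 → ℕ | c d ≠ 0}.Finite ∧
      (∀ d, c d ≠ 0 → ∃ w : ℤ, IsModularForm w (c d)) ∧
      ∀ τ : ℂ, 0 < τ.im → g τ ≠ 0 → ∀ z : Fin 8 → ℂ,
        ψ τ z = ∑ᶠ d : Fin 9 → ℕ, c d τ * ∏ j, (F j τ z / g τ ^ (sakaiIdx j)) ^ (d j) := by
  classical
  obtain ⟨c, h1, h2⟩ := h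
  rcases Nat.eq_zero_or_pos m with hm | hm
  · subst hm
    refine ⟨fun d => if d ∈ mons 0 then c d else fun _ => 0, fin_mons c, fun d hd => ?_, fun τ hτ hgτ z => ?_⟩
    · by_cases hd : d ∈ mons 0
      · simp only [hd, if_true]; exact ⟨_, (h1 d).toIs⟩
      · simp only [hd, if_false]; exact ⟨0, (MF.zero _).toIs⟩
    · rw [fsum_mons c τ]
      have := h2 τ hτ z
      simp only [Nat.zero_sub, pow_zero, one_mul] at this
      rw [this]
      refine Finset.sum_congr rfl fun d hd => ?_
      rw [prodDiv _ _ hd]; simp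
  · refine ⟨fun d => if d ∈ mons m then (fun τ => g τ * c d τ) else fun _ => 0, fin_mons (fun d τ => g τ * c d τ), fun d hd => ?_, fun τ hτ hgτ z => ?_⟩
    · by_cases hd : d ∈ mons m
      · simp only [hd, if_true]; exact ⟨_, (hg.mul (h1 d)).toIs⟩
      · simp only [hd, if_false]; exact ⟨0, (MF.zero _).toIs⟩
    · rw [fsum_mons (fun d τ => g τ * c d τ) τ]
      have := h2 τ hτ z
      simp only at this
      have e : ∑ d ∈ mons m, g τ * c d τ * ∏ j, (F j τ z / g τ ^ sakaiIdx j) ^ d j = g τ / g τ ^ m * (g τ ^ (m - 1) * ψ τ z) := by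
        rw [this, Finset.mul_sum]
        refine Finset.sum_congr rfl fun d hd => ?_
        rw [prodDiv _ _ hd]; ring
      rw [e]
      obtain ⟨n, rfl⟩ : ∃ n, m = n + 1 := ⟨m - 1, by omega⟩
      simp only [Nat.add_sub_cancel]
      rw [pow_succ]
      field_simp

theorem part5 {F : Fin 9 → Fn} {g : ℂ → ℂ} (h : Data F g) (hFind : AlgIndepOverM F) {cc : ℕ → (Fin 8 → ℚ) → ℂ}
    (hc : FourierRep E8Gram (F 0) cc) (h0 : ∀ ℓ : Fin 8 → ℚ, cc 0 ℓ = if ℓ = 0 then 1 else 0) :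
    ∃ c : (Fin 9 → ℕ) → ℂ → ℂ, {d : Fin 9 → ℕ | c d ≠ 0}.Finite ∧
        (∀ d, c d ≠ 0 → ∃ w : ℤ, IsModularForm w (c d)) ∧
        ∀ (k : ℤ) (m : ℕ) (ψ : ℂ → (Fin 8 → ℂ) → ℂ),
          IsWeakJacobiForm E8Gram k m ψ → GInvariant weylE8 ψ →
          ¬ ∀ τ : ℂ, 0 < τ.im → g τ ≠ 0 → ∀ z : Fin 8 → ℂ,
            ψ τ z = ∑ᶠ d : Fin 9 → ℕ, c d τ * ∏ j, (F j τ z / g τ ^ (sakaiIdx j)) ^ (d j) := by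
  classical
  let c : (Fin 9 → ℕ) → ℂ → ℂ := fun d => if d = Pi.single 0 1 then fun _ => 1 else fun _ => 0
  refine ⟨c, ?_, ?_, ?_⟩
  · refine (Set.finite_singleton (Pi.single 0 1 : Fin 9 → ℕ)).subset fun d hd => ?_
    by_contra hn
    have hn' : ¬ d = Pi.single 0 1 := by simpa using hn
    exact hd (by simp only [c, hn', if_false]; rfl)
  · intro d _
    refine ⟨0, MF.toIs ?_⟩
    by_cases hd : d = Pi.single 0 1
    · simp only [c, hd, if_true]; exact MF.const 1
    · simp only [c, hd, if_false]; exact MF.const 0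
  · intro k m ψ hψ hi hrep
    have hψ' := JF.ofWeak hψ
    have hsum : ∀ τ z, ∑ᶠ d : Fin 9 → ℕ, c d τ * ∏ j, (F j τ z / g τ ^ (sakaiIdx j)) ^ (d j) = F 0 τ z / g τ := by
      intro τ z
      rw [finsum_eq_single _ (Pi.single 0 1 : Fin 9 → ℕ)]
      · rw [Finset.prod_eq_single 0]
        · simp [c, sakaiIdx]
        · intro j _ hj; simp [hj]
        · simp
      · intro d hd; simp [c, hd]
    have hF0 : JF 4 1 (F 0) := by simpa [sakaiWt, sakaiIdx] using h.jf 0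
    obtain ⟨τ1, hτ1, hg1⟩ := h.g_ne hFind
    have hz := HolD.canc h.mf.hol (h := fun τ z => g τ * ψ τ z - F 0 τ z) ((h.mf.hol.mul hψ'.hol).sub hF0.hol) (by
      intro τ hτ z
      by_cases hgz : g τ = 0
      · simp [hgz]
      · have := hrep τ hτ hgz z
        rw [hsum] at this
        rw [this]
        field_simp
        simp) ⟨τ1, hτ1, 0, hg1⟩
    obtain ⟨ρ, hρ, hgρ⟩ := g_elliptic h.mf
    obtain ⟨z, hz0⟩ := F0_nonzero hF0 hc h0 hρ
    have := hz ρ hρ z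
    simp only [hgρ, zero_mul, zero_sub, neg_eq_zero] at this
    exact hz0 this

theorem final
    (F : Fin 9 → ℂ → (Fin 8 → ℂ) → ℂ)
    (hF : ∀ j, IsWeakJacobiForm E8Gram (sakaiWt j) (sakaiIdx j) (F j))
    (hFG : ∀ j, GInvariant weylE8 (F j))
    (hFhol : ∀ j, ∃ c : ℕ → (Fin 8 → ℚ) → ℂ, FourierRep E8Gram (F j) c ∧
      (∀ (n : ℕ) (ℓ : Fin 8 → ℚ), c n ℓ ≠ 0 → pairQ E8Gram ℓ ℓ ≤ 2 * n * sakaiIdx j) ∧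
      (∀ ℓ : Fin 8 → ℚ, c 0 ℓ = if ℓ = 0 then 1 else 0))
    (hFind : AlgIndepOverM F) :
    ∃ g : ℂ → ℂ,
      (∀ τ : ℂ, 0 < τ.im → ∀ z : Fin 8 → ℂ,
        jacJacobian sakaiIdx F τ z = g τ * PhiE8 τ z) ∧
      IsModularForm 172 g ∧
      (∀ (k : ℤ) (m : ℕ) (ψ : ℂ → (Fin 8 → ℂ) → ℂ),
        IsWeakJacobiForm E8Gram k m ψ → GInvariant weylE8 ψ →
        ∃ c : (Fin 9 → ℕ) → ℂ → ℂ,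
          MPolyRep sakaiWt sakaiIdx F (k + 172 * ((m - 1 : ℕ) : ℤ)) m c
            (fun τ z => g τ ^ (m - 1) * ψ τ z) ∧
          ∀ c' : (Fin 9 → ℕ) → ℂ → ℂ,
            MPolyRep sakaiWt sakaiIdx F (k + 172 * ((m - 1 : ℕ) : ℤ)) m c'
              (fun τ z => g τ ^ (m - 1) * ψ τ z) →
            ∀ d τ, 0 < τ.im → c d τ = c' d τ) ∧
      (∀ (k : ℤ) (m : ℕ) (ψ : ℂ → (Fin 8 → ℂ) → ℂ),
        IsWeakJacobiForm E8Gram k m ψ → GInvariant weylE8 ψ →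
        ∃ c : (Fin 9 → ℕ) → ℂ → ℂ, {d : Fin 9 → ℕ | c d ≠ 0}.Finite ∧
          (∀ d, c d ≠ 0 → ∃ w : ℤ, IsModularForm w (c d)) ∧
          ∀ τ : ℂ, 0 < τ.im → g τ ≠ 0 → ∀ z : Fin 8 → ℂ,
            ψ τ z = ∑ᶠ d : Fin 9 → ℕ, c d τ * ∏ j, (F j τ z / g τ ^ (sakaiIdx j)) ^ (d j)) ∧
      (∃ c : (Fin 9 → ℕ) → ℂ → ℂ, {d : Fin 9 → ℕ | c d ≠ 0}.Finite ∧
        (∀ d, c d ≠ 0 → ∃ w : ℤ, IsModularForm w (c d)) ∧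
        ∀ (k : ℤ) (m : ℕ) (ψ : ℂ → (Fin 8 → ℂ) → ℂ),
          IsWeakJacobiForm E8Gram k m ψ → GInvariant weylE8 ψ →
          ¬ ∀ τ : ℂ, 0 < τ.im → g τ ≠ 0 → ∀ z : Fin 8 → ℂ,
            ψ τ z = ∑ᶠ d : Fin 9 → ℕ, c d τ * ∏ j, (F j τ z / g τ ^ (sakaiIdx j)) ^ (d j)) := by
  obtain ⟨g, h⟩ := gExists (fun j => JF.ofWeak (hF j)) (fun j => GInvariant.inv (hFG j))
  obtain ⟨cc, hc, _, h0⟩ := hFhol 0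
  refine ⟨g, h.jac, h.mf.toIs, fun k m ψ hψ hi => ?_, fun k m ψ hψ hi => ?_, part5 h hFind hc h0⟩
  · exact part3 hFind (h.main hFind hc h0 m k ψ (JF.ofWeak hψ) (GInvariant.inv hi))
  · exact part4 (k := k) h.mf (h.main hFind hc h0 m k ψ (JF.ofWeak hψ) (GInvariant.inv hi))

end E8J
end ModFv

/-- (structure of `W(E_8)`-invariant Jacobi forms) With Sakai's nine
forms `A_i, B_j`, the quotient `g := J(A_1,…,B_6)/Φ_{E_8}` is a modular form of weight
`172` on `SL₂(ℤ)`; every `W(E_8)`-invariant weak Jacobi form `φ_m` of weight `k` and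
index `m` satisfies `g^{m-1} φ_m = P(A_1,…,B_6)` for a unique polynomial `P` over
`M_*(SL₂(ℤ))`; and with `Â_i := A_i/g^i`, `B̂_j := B_j/g^j` one has
`J^{w,W(E_8)}_{*,E_8,*} ⊊ M_*(SL₂(ℤ))[Â_1,…,Â_5,B̂_2,…,B̂_6]`. -/
theorem E8_jacobi_forms_structure
    (F : Fin 9 → ℂ → (Fin 8 → ℂ) → ℂ)
    (hF : ∀ j, IsWeakJacobiForm E8Gram (sakaiWt j) (sakaiIdx j) (F j))
    (hFG : ∀ j, GInvariant weylE8 (F j))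
    (hFhol : ∀ j, ∃ c : ℕ → (Fin 8 → ℚ) → ℂ, FourierRep E8Gram (F j) c ∧
      (∀ (n : ℕ) (ℓ : Fin 8 → ℚ), c n ℓ ≠ 0 → pairQ E8Gram ℓ ℓ ≤ 2 * n * sakaiIdx j) ∧
      (∀ ℓ : Fin 8 → ℚ, c 0 ℓ = if ℓ = 0 then 1 else 0))
    (hFind : AlgIndepOverM F) :
    ∃ g : ℂ → ℂ,
      (∀ τ : ℂ, 0 < τ.im → ∀ z : Fin 8 → ℂ,
        jacJacobian sakaiIdx F τ z = g τ * PhiE8 τ z) ∧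
      IsModularForm 172 g ∧
      (∀ (k : ℤ) (m : ℕ) (ψ : ℂ → (Fin 8 → ℂ) → ℂ),
        IsWeakJacobiForm E8Gram k m ψ → GInvariant weylE8 ψ →
        ∃ c : (Fin 9 → ℕ) → ℂ → ℂ,
          MPolyRep sakaiWt sakaiIdx F (k + 172 * ((m - 1 : ℕ) : ℤ)) m c
            (fun τ z => g τ ^ (m - 1) * ψ τ z) ∧
          ∀ c' : (Fin 9 → ℕ) → ℂ → ℂ,
            MPolyRep sakaiWt sakaiIdx F (k + 172 * ((m - 1 : ℕ) : ℤ)) m c'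
              (fun τ z => g τ ^ (m - 1) * ψ τ z) →
            ∀ d τ, 0 < τ.im → c d τ = c' d τ) ∧
      (∀ (k : ℤ) (m : ℕ) (ψ : ℂ → (Fin 8 → ℂ) → ℂ),
        IsWeakJacobiForm E8Gram k m ψ → GInvariant weylE8 ψ →
        ∃ c : (Fin 9 → ℕ) → ℂ → ℂ, {d : Fin 9 → ℕ | c d ≠ 0}.Finite ∧
          (∀ d, c d ≠ 0 → ∃ w : ℤ, IsModularForm w (c d)) ∧
          ∀ τ : ℂ, 0 < τ.im → g τ ≠ 0 → ∀ z : Fin 8 → ℂ,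
            ψ τ z = ∑ᶠ d : Fin 9 → ℕ, c d τ * ∏ j, (F j τ z / g τ ^ (sakaiIdx j)) ^ (d j)) ∧
      (∃ c : (Fin 9 → ℕ) → ℂ → ℂ, {d : Fin 9 → ℕ | c d ≠ 0}.Finite ∧
        (∀ d, c d ≠ 0 → ∃ w : ℤ, IsModularForm w (c d)) ∧
        ∀ (k : ℤ) (m : ℕ) (ψ : ℂ → (Fin 8 → ℂ) → ℂ),
          IsWeakJacobiForm E8Gram k m ψ → GInvariant weylE8 ψ →
          ¬ ∀ τ : ℂ, 0 < τ.im → g τ ≠ 0 → ∀ z : Fin 8 → ℂ,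
            ψ τ z = ∑ᶠ d : Fin 9 → ℕ, c d τ * ∏ j, (F j τ z / g τ ^ (sakaiIdx j)) ^ (d j)) := by
  exact E8J.final F hF hFG hFhol hFind

end
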